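/- arXiv:1404.6011 — 4 statements merged into one kernel-verified Lean document; each statement's English description precedes it below -/
import Mathlib

section
/- Let d ≥ 2 be an integer and let h ∈ ℂ[z] be a non-constant polynomial. If there exist infinitely many t ∈ ℂ such that both the map z ↦ z^d + t and the map z ↦ z^d + h(t) are postcritically finite, then there exists a complex number ζ with ζ^(d-1) = 1 such that h(z) = ζ·z (i.e., h equals ζ times the identity polynomial). -/
/-- A point `a` is preperiodic under `f` if some iterate repeats:
`f^[m+n] a = f^[m] a` with `n ≥ 1`. The map `z ↦ z^d + c` is PCF iff `0` is
preperiodic under it. -/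
def Preperiodic (f : ℂ → ℂ) (a : ℂ) : Prop :=
  ∃ m n : ℕ, 0 < n ∧ f^[m + n] a = f^[m] a

open Polynomial

/-- The orbit of the critical point `0` under `z ↦ z ^ d + c`. -/
def criticalOrbit {S : Type*} [Semiring S] (d : ℕ) (c : S) : ℕ → S
  | 0 => 0
  | n + 1 => criticalOrbit d c n ^ d + c

lemma map_criticalOrbit {S T : Type*} [Semiring S] [Semiring T] (f : S →+* T) (d : ℕ) (c : S)
    (n : ℕ) : f (criticalOrbit d c n) = criticalOrbit d (f c) n := by
  induction n with
  | zero => simp [criticalOrbit]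
  | succ n ih => simp [criticalOrbit, ih]

lemma eval_criticalOrbit {S : Type*} [CommSemiring S] (d : ℕ) (p : S[X]) (x : S) (n : ℕ) :
    (criticalOrbit d p n).eval x = criticalOrbit d (p.eval x) n :=
  map_criticalOrbit (evalRingHom x) d p n

lemma iterate_eq_criticalOrbit {S : Type*} [Semiring S] (d : ℕ) (c : S) (n : ℕ) :
    (fun z => z ^ d + c)^[n] 0 = criticalOrbit d c n := by
  induction n with
  | zero => rfl
  | succ n ih => rw [Function.iterate_succ_apply', ih]; rfl

/-- The map `z ↦ z ^ d + c` is postcritically finite. -/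
def IsPCF {S : Type*} [Semiring S] (d : ℕ) (c : S) : Prop :=
  ∃ m n : ℕ, 0 < n ∧ criticalOrbit d c (m + n) = criticalOrbit d c m

lemma preperiodic_iff_isPCF (d : ℕ) (c : ℂ) :
    Preperiodic (fun z => z ^ d + c) 0 ↔ IsPCF d c := by
  simp only [Preperiodic, IsPCF, iterate_eq_criticalOrbit]

lemma IsPCF.map {S T : Type*} [Semiring S] [Semiring T] (f : S →+* T) {d : ℕ} {c : S}
    (hc : IsPCF d c) : IsPCF d (f c) := by
  obtain ⟨m, n, hn, h⟩ := hc
  exact ⟨m, n, hn, by rw [← map_criticalOrbit, h, map_criticalOrbit]⟩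

lemma IsPCF.of_map {S T : Type*} [Semiring S] [Semiring T] (f : S →+* T)
    (hf : Function.Injective f) {d : ℕ} {c : S} (hc : IsPCF d (f c)) : IsPCF d c := by
  obtain ⟨m, n, hn, h⟩ := hc
  exact ⟨m, n, hn, hf (by rw [map_criticalOrbit, h, map_criticalOrbit])⟩

lemma criticalOrbit_natDegree_leadingCoeff {R : Type*} [CommRing R] [IsDomain R] {d : ℕ}
    (hd : 2 ≤ d) {p : R[X]} (hp : 0 < p.natDegree) (n : ℕ) :
    (criticalOrbit d p (n + 1)).natDegree = p.natDegree * d ^ n ∧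
      (criticalOrbit d p (n + 1)).leadingCoeff = p.leadingCoeff ^ d ^ n := by
  induction n with
  | zero =>
    have : criticalOrbit d p 1 = p := by
      simp [criticalOrbit, show d ≠ 0 by omega]
    simp [this]
  | succ n ih =>
    obtain ⟨h1, h2⟩ := ih
    have hlt : p.natDegree < (criticalOrbit d p (n + 1) ^ d).natDegree := by
      rw [natDegree_pow, h1]
      have : 1 ≤ d ^ n := Nat.one_le_pow _ _ (by omega)
      nlinarith [Nat.mul_le_mul hd (Nat.mul_le_mul (le_refl p.natDegree) this)]
    have h3 : criticalOrbit d p (n + 1 + 1) = criticalOrbit d p (n + 1) ^ d + p := rfl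
    rw [h3, natDegree_add_eq_left_of_natDegree_lt hlt,
      leadingCoeff_add_of_degree_lt' (degree_lt_degree hlt), natDegree_pow, leadingCoeff_pow,
      h1, h2]
    constructor
    · ring
    · rw [← pow_mul, pow_succ]

lemma IsPCF.isIntegral {R : Type*} [CommRing R] {d : ℕ} (hd : 2 ≤ d) {c : R} (hc : IsPCF d c) :
    IsIntegral ℤ c := by
  obtain ⟨m, n, hn, h⟩ := hc
  have hX : 0 < (X : ℤ[X]).natDegree := by simp
  have key : ∀ j, (criticalOrbit d (X : ℤ[X]) (j + 1)).natDegree = d ^ j ∧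
      (criticalOrbit d (X : ℤ[X]) (j + 1)).Monic := fun j => by
    have := criticalOrbit_natDegree_leadingCoeff hd hX j
    rwa [leadingCoeff_X, one_pow, natDegree_X, one_mul] at this
  obtain ⟨s, rfl⟩ : ∃ s, n = s + 1 := ⟨n - 1, by omega⟩
  refine ⟨criticalOrbit d X (m + s + 1) - criticalOrbit d X m, ?_, ?_⟩
  · refine (key _).2.sub_of_left ?_
    cases m with
    | zero =>
      have : criticalOrbit d (X : ℤ[X]) 0 = 0 := rfl
      rw [this, degree_zero, bot_lt_iff_ne_bot, Ne, degree_eq_bot]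
      exact (key _).2.ne_zero
    | succ m =>
      apply degree_lt_degree
      rw [(key _).1, (key _).1]
      exact Nat.pow_lt_pow_right hd (by omega)
  · have := map_criticalOrbit (eval₂RingHom (algebraMap ℤ R) c) d X
    simp only [coe_eval₂RingHom, eval₂_X] at this
    rw [eval₂_sub, this, this, sub_eq_zero]
    exact h

lemma IsPCF.norm_criticalOrbit_le {d : ℕ} (hd : 2 ≤ d) {c : ℂ} (hc : IsPCF d c) (l : ℕ) :
    ‖criticalOrbit d c l‖ ≤ 2 := by
  obtain ⟨m, n, hn, h⟩ := hc
  have step : ∀ j, 2 < ‖criticalOrbit d c j‖ → ‖c‖ ≤ ‖criticalOrbit d c j‖ →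
      ‖criticalOrbit d c j‖ < ‖criticalOrbit d c (j + 1)‖ := by
    intro j h2 hcj
    set z := criticalOrbit d c j
    have h3 : criticalOrbit d c (j + 1) = z ^ d + c := rfl
    have h4 : ‖z‖ ^ d - ‖c‖ ≤ ‖z ^ d + c‖ := by
      rw [← norm_pow]
      have := norm_sub_le (z ^ d + c) c
      rw [add_sub_cancel_right] at this
      linarith
    have h5 : ‖z‖ ^ 2 ≤ ‖z‖ ^ d := pow_le_pow_right₀ (by linarith) hd
    rw [h3]
    nlinarith
  have grow : ∀ j, 2 < ‖criticalOrbit d c j‖ → ‖c‖ ≤ ‖criticalOrbit d c j‖ →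
      ∀ i, ‖criticalOrbit d c j‖ ≤ ‖criticalOrbit d c (j + i)‖ := by
    intro j h2 hcj i
    induction i with
    | zero => exact le_refl _
    | succ i ih =>
      exact ih.trans (step (j + i) (h2.trans_le ih) (hcj.trans ih)).le
  have contra : ∀ j, 2 < ‖criticalOrbit d c j‖ → ‖c‖ ≤ ‖criticalOrbit d c j‖ → False := by
    intro j h2 hcj
    have period : ∀ i, criticalOrbit d c (m + i + n) = criticalOrbit d c (m + i) := by
      intro i
      induction i with
      | zero => simpa using h
      | succ i ih =>
        have : m + (i + 1) + n = (m + i + n) + 1 := by ring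
        rw [this, ← add_assoc m i 1]
        simp only [criticalOrbit, ih]
    have h6 := grow j h2 hcj m
    have h7 := step (j + m) (h2.trans_le h6) (hcj.trans h6)
    have h8 := grow (j + m + 1) (by linarith) (by linarith) (n - 1)
    rw [show j + m + 1 + (n - 1) = m + j + n by omega, period, add_comm m j] at h8
    linarith
  by_contra! hl
  by_cases hcl : ‖c‖ ≤ ‖criticalOrbit d c l‖
  · exact contra l hl hcl
  · have h1 : criticalOrbit d c 1 = c := by simp [criticalOrbit, show d ≠ 0 by omega]
    refine contra 1 ?_ ?_ <;> rw [h1]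
    linarith

lemma IsPCF.norm_le {d : ℕ} (hd : 2 ≤ d) {c : ℂ} (hc : IsPCF d c) : ‖c‖ ≤ 2 := by
  have h1 : criticalOrbit d c 1 = c := by simp [criticalOrbit, show d ≠ 0 by omega]
  simpa [h1] using hc.norm_criticalOrbit_le hd 1

lemma det_eval_powers_eq {F : Type*} [Field F] {q : F[X]} (hq : 0 < q.natDegree) {N : ℕ}
    (w : Fin N → F) :
    (Matrix.of fun i j : Fin N => w i ^ ((j : ℕ) % q.natDegree) *
        q.eval (w i) ^ ((j : ℕ) / q.natDegree)).det =
      q.leadingCoeff ^ (∑ j : Fin N, (j : ℕ) / q.natDegree) * (Matrix.vandermonde w).det := by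
  have hq0 : q ≠ 0 := fun h => by simp [h] at hq
  have hb : q.leadingCoeff ≠ 0 := leadingCoeff_ne_zero.2 hq0
  set r := q.natDegree with hr
  set b := q.leadingCoeff with hbdef
  have hmon : (C b⁻¹ * q).Monic := by
    rw [mul_comm]; exact monic_mul_leadingCoeff_inv hq0
  have hdeg : (C b⁻¹ * q).natDegree = r := natDegree_C_mul (inv_ne_zero hb)
  rw [Matrix.det_eval_matrixOfPolynomials_eq_det_vandermonde w
    (fun j => X ^ ((j : ℕ) % r) * (C b⁻¹ * q) ^ ((j : ℕ) / r)) ?_ ?_, ← Finset.prod_pow_eq_pow_sum,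
    ← Matrix.det_mul_row]
  · congr 1
    ext i j
    simp only [Matrix.of_apply, eval_mul, eval_pow, eval_X, eval_C]
    rw [mul_pow]
    have : b ^ ((j : ℕ) / r) * b⁻¹ ^ ((j : ℕ) / r) = 1 := by
      rw [← mul_pow, mul_inv_cancel₀ hb, one_pow]
    linear_combination (-(w i ^ ((j : ℕ) % r) * q.eval (w i) ^ ((j : ℕ) / r))) * this
  · intro j
    rw [Monic.natDegree_mul (monic_X_pow _) (hmon.pow _), natDegree_X_pow, hmon.natDegree_pow, hdeg,
      Nat.mod_add_div']
  · intro j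
    exact (monic_X_pow _).mul (hmon.pow _)

lemma norm_vandermonde_le {q : ℂ[X]} (hq : 0 < q.natDegree) {N : ℕ} (w : Fin N → ℂ) {B : ℝ}
    (hw : ∀ i, ‖w i‖ ≤ 2) (hB : ∀ i, ‖q.eval (w i)‖ ≤ B) :
    ‖q.leadingCoeff‖ ^ (∑ j : Fin N, (j : ℕ) / q.natDegree) * ‖(Matrix.vandermonde w).det‖ ≤
      (N.factorial * 2 ^ (q.natDegree * N)) * B ^ (∑ j : Fin N, (j : ℕ) / q.natDegree) := by
  rw [← norm_pow, ← norm_mul, ← det_eval_powers_eq hq, Matrix.det_apply]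
  refine (norm_sum_le _ _).trans ?_
  have key : ∀ g : Equiv.Perm (Fin N),
      ‖Equiv.Perm.sign g • ∏ i : Fin N, (Matrix.of fun i j : Fin N =>
      w i ^ ((j : ℕ) % q.natDegree) * q.eval (w i) ^ ((j : ℕ) / q.natDegree)) (g i) i‖ ≤
      2 ^ (q.natDegree * N) * B ^ (∑ j : Fin N, (j : ℕ) / q.natDegree) := by
    intro g
    have hs : ‖Equiv.Perm.sign g • ∏ i : Fin N, (Matrix.of fun i j : Fin N =>
      w i ^ ((j : ℕ) % q.natDegree) * q.eval (w i) ^ ((j : ℕ) / q.natDegree)) (g i) i‖ =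
      ‖∏ i : Fin N, (Matrix.of fun i j : Fin N =>
      w i ^ ((j : ℕ) % q.natDegree) * q.eval (w i) ^ ((j : ℕ) / q.natDegree)) (g i) i‖ := by
      rcases Int.units_eq_one_or (Equiv.Perm.sign g) with h | h <;> rw [h] <;> simp
    rw [hs, norm_prod]
    calc _ ≤ ∏ i : Fin N, ((2 : ℝ) ^ q.natDegree * B ^ ((i : ℕ) / q.natDegree)) := by
          refine Finset.prod_le_prod (fun _ _ => norm_nonneg _) fun i _ => ?_
          rw [Matrix.of_apply, norm_mul, norm_pow, norm_pow]
          refine mul_le_mul ?_ (pow_le_pow_left₀ (norm_nonneg _) (hB _) _) (by positivity)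
            (by positivity)
          exact (pow_le_pow_left₀ (norm_nonneg _) (hw _) _).trans
            (pow_le_pow_right₀ (by norm_num) (Nat.mod_lt _ hq).le)
      _ = _ := by
          rw [Finset.prod_mul_distrib, Finset.prod_pow_eq_pow_sum, Finset.prod_pow_eq_pow_sum,
            Finset.sum_const, Finset.card_univ, Fintype.card_fin, smul_eq_mul, mul_comm N]
  refine (Finset.sum_le_sum fun g _ => key g).trans (le_of_eq ?_)
  rw [Finset.sum_const, Finset.card_univ, Fintype.card_perm, Fintype.card_fin, nsmul_eq_mul,
    mul_assoc]

lemma one_le_prod_embeddings_of_isIntegral {L : Type*} [Field L] [NumberField L] {x : L}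
    (hx : IsIntegral ℤ x) (hx0 : x ≠ 0) : 1 ≤ ∏ σ : L →ₐ[ℚ] ℂ, ‖σ x‖ := by
  rw [← norm_prod, ← Algebra.norm_eq_prod_embeddings ℚ ℂ x]
  obtain ⟨m, hm⟩ := IsIntegrallyClosed.isIntegral_iff.1 (Algebra.isIntegral_norm ℚ hx)
  have h0 : Algebra.norm ℚ x ≠ 0 := Algebra.norm_ne_zero_iff.2 hx0
  rw [← hm] at h0 ⊢
  have hm0 : m ≠ 0 := by rintro rfl; simp at h0
  simpa using (by exact_mod_cast Int.one_le_abs hm0 : (1 : ℝ) ≤ |(m : ℝ)|)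

lemma exists_factorial_mul_pow_lt (W c : ℕ) (hW : 0 < W) :
    ∃ N : ℕ, ((N.factorial : ℝ) * 2 ^ (W * N)) ^ c < 2 ^ (∑ j : Fin N, (j : ℕ) / W) := by
  obtain ⟨m, hm⟩ : ∃ m : ℕ, 1 + 2 * W + 2 * W * (m + W) * c < 2 ^ m := by
    set α := 1 + 2 * W + 2 * W * W * c with hα
    set β := 2 * W * c with hβ
    refine ⟨2 * (α + 2 * β), ?_⟩
    set s := α + 2 * β with hs
    have h1 : s + 1 ≤ 2 ^ s := Nat.lt_two_pow_self
    have h2 : 2 ^ (2 * s) = 2 ^ s * 2 ^ s := by rw [two_mul, pow_add]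
    have h3 : (s + 1) * (s + 1) ≤ 2 ^ s * 2 ^ s := Nat.mul_le_mul h1 h1
    have h4 : 1 + 2 * W + 2 * W * (2 * s + W) * c = α + 2 * β * s := by rw [hα, hβ]; ring
    have h5 : s * s = α * s + 2 * β * s := by rw [← add_mul]
    rw [h2, h4]
    nlinarith [Nat.zero_le (α * s)]
  refine ⟨2 ^ m, ?_⟩
  set N := 2 ^ m with hN
  set S := ∑ j : Fin N, (j : ℕ) / W with hS
  have hsum : N * (N - 1) ≤ 2 * (W * S + W * N) := by
    have h1 : (∑ j : Fin N, (j : ℕ)) * 2 = N * (N - 1) := by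
      rw [Fin.sum_univ_eq_sum_range (fun j => j), Finset.sum_range_id_mul_two]
    have h2 : ∑ j : Fin N, (j : ℕ) ≤ ∑ j : Fin N, (W * ((j : ℕ) / W) + W) := by
      refine Finset.sum_le_sum fun j _ => ?_
      have := Nat.div_add_mod (j : ℕ) W
      have := Nat.mod_lt (j : ℕ) hW
      omega
    rw [Finset.sum_add_distrib, ← Finset.mul_sum, Finset.sum_const, Finset.card_univ,
      Fintype.card_fin, smul_eq_mul, mul_comm N W, ← hS] at h2
    linarith
  have hlt : (m + W) * N * c < S := by
    have hNpos : 0 < N := by positivity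
    by_contra! hcon
    have h1 : N * (N - 1) ≤ N * (2 * W + 2 * W * (m + W) * c) := by
      calc N * (N - 1) ≤ 2 * (W * S + W * N) := hsum
        _ ≤ 2 * (W * ((m + W) * N * c) + W * N) := by gcongr
        _ = _ := by ring
    have := Nat.le_of_mul_le_mul_left h1 hNpos
    omega
  have hfac : (N.factorial : ℝ) ≤ 2 ^ (m * N) := by
    have : N.factorial ≤ N ^ N := Nat.factorial_le_pow N
    rw [pow_mul]
    exact_mod_cast this
  calc ((N.factorial : ℝ) * 2 ^ (W * N)) ^ c ≤ (2 ^ (m * N) * 2 ^ (W * N)) ^ c := by gcongr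
    _ = 2 ^ ((m + W) * N * c) := by rw [← pow_add, ← pow_mul, ← add_mul]
    _ < 2 ^ S := pow_lt_pow_right₀ (by norm_num) hlt

lemma norm_embedding_vandermonde_le {L : Type*} [Field L] (σ : L →+* ℂ) {q : L[X]} {W : ℕ}
    (hdeg : q.natDegree = W) (hW : 0 < W) {N : ℕ} (t : Fin N → L) {B : ℝ}
    (ht : ∀ i, ‖σ (t i)‖ ≤ 2) (hB : ∀ i, ‖σ (q.eval (t i))‖ ≤ B) :
    ‖σ q.leadingCoeff‖ ^ (∑ j : Fin N, (j : ℕ) / W) * ‖σ (Matrix.vandermonde t).det‖ ≤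
      (N.factorial * 2 ^ (W * N)) * B ^ (∑ j : Fin N, (j : ℕ) / W) := by
  have hd : (q.map σ).natDegree = W := by rw [natDegree_map, hdeg]
  have hv : (Matrix.vandermonde fun i => σ (t i)).det = σ (Matrix.vandermonde t).det := by
    simp [Matrix.det_vandermonde, map_prod, map_sub]
  have := norm_vandermonde_le (q := q.map σ) (by rwa [hd]) (fun i => σ (t i)) ht (B := B)
    (fun i => by rw [eval_map, eval₂_at_apply]; exact hB i)
  rwa [hd, hv, leadingCoeff_map] at this

lemma pow_le_of_normalized_bounds {X Y Z V K c C u : ℝ} {n M e₁ e₃ D D' : ℕ} (hn : n ≠ 0)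
    (hX : 0 < X) (hV : 0 ≤ V) (hK : 1 ≤ K) (hc : 1 ≤ c) (hC : 0 < C) (hu : 0 < u)
    (h0 : Z ≤ (K * c ^ M) ^ n) (h1 : 1 ≤ X ^ (e₁ * M) * Z) (hZ : 1 ≤ Z)
    (h2 : V ^ (e₁ * M) * Z ≤ (K * c ^ M) ^ n)
    (h3 : Y ^ (e₃ * M) * Z ≤ (K * C ^ (e₃ * M)) ^ n * V ^ (D * (e₃ * M)))
    (hY : X ^ D' * u ^ n ≤ Y) (hD : D' ≤ D) :
    u ^ (e₁ * e₃ * M) ≤ K ^ e₁ * C ^ (e₁ * e₃ * M) * (K * c ^ M) ^ (2 * D * e₃) := by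
  refine le_of_pow_le_pow_left₀ hn (by positivity) ?_
  set Q := (K * c ^ M) ^ n with hQ
  have hQ1 : 1 ≤ Q := one_le_pow₀ (one_le_mul_of_one_le_of_one_le hK (one_le_pow₀ hc))
  have hY0 : 0 ≤ Y := le_trans (by positivity) hY
  have a1 : 1 ≤ X ^ (e₁ * M) * Q := h1.trans (by gcongr)
  have a2 : V ^ (e₁ * M) ≤ Q :=
    (le_mul_of_one_le_right (by positivity) hZ).trans h2
  have a3 : Y ^ (e₃ * M) ≤ (K * C ^ (e₃ * M)) ^ n * V ^ (D * (e₃ * M)) :=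
    (le_mul_of_one_le_right (by positivity) hZ).trans h3
  have a4 : (X ^ D' * u ^ n) ^ (e₁ * (e₃ * M)) ≤
      ((K * C ^ (e₃ * M)) ^ n) ^ e₁ * Q ^ (D * e₃) := by
    calc (X ^ D' * u ^ n) ^ (e₁ * (e₃ * M)) ≤ Y ^ (e₁ * (e₃ * M)) := by gcongr
      _ = (Y ^ (e₃ * M)) ^ e₁ := by rw [← pow_mul]; ring_nf
      _ ≤ ((K * C ^ (e₃ * M)) ^ n * V ^ (D * (e₃ * M))) ^ e₁ := by gcongr
      _ = ((K * C ^ (e₃ * M)) ^ n) ^ e₁ * (V ^ (e₁ * M)) ^ (D * e₃) := by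
          rw [mul_pow, ← pow_mul V, ← pow_mul V]; ring_nf
      _ ≤ _ := by gcongr
  have a5 : 1 ≤ (X ^ (e₁ * M) * Q) ^ (D' * e₃) := one_le_pow₀ a1
  calc (u ^ (e₁ * e₃ * M)) ^ n = (u ^ n) ^ (e₁ * (e₃ * M)) * 1 := by
        rw [← pow_mul, ← pow_mul]; ring_nf
    _ ≤ (u ^ n) ^ (e₁ * (e₃ * M)) * (X ^ (e₁ * M) * Q) ^ (D' * e₃) := by gcongr
    _ = (X ^ D' * u ^ n) ^ (e₁ * (e₃ * M)) * Q ^ (D' * e₃) := by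
        simp only [mul_pow, ← pow_mul]; ring_nf
    _ ≤ ((K * C ^ (e₃ * M)) ^ n) ^ e₁ * Q ^ (D * e₃) * Q ^ (D * e₃) := by gcongr
    _ = _ := by
        rw [hQ]
        simp only [mul_pow, ← pow_mul]; ring_nf

lemma two_pow_le_of_isPCF {L : Type*} [Field L] [NumberField L] {d : ℕ} (hd : 2 ≤ d) {p R : L[X]}
    (hp : 0 < p.natDegree) (hR : 0 < R.natDegree) {N : ℕ} {t : Fin N → L}
    (htinj : Function.Injective t) (ht : ∀ i, IsPCF d (t i)) (hpt : ∀ i, IsPCF d (p.eval (t i)))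
    {C u : ℝ} {D D' l : ℕ} (hC : 0 < C) (hu : 4 * C ≤ u) (hD : D' ≤ D)
    (hl : 2 * p.natDegree * D ≤ d ^ l)
    (hRt : ∀ (σ : L →ₐ[ℚ] ℂ) i,
      ‖σ (R.eval (t i))‖ ≤ C * max 1 ‖σ p.leadingCoeff‖ ^ D)
    (hRlead : (∏ σ : L →ₐ[ℚ] ℂ, ‖σ p.leadingCoeff‖) ^ D' * u ^ Fintype.card (L →ₐ[ℚ] ℂ) ≤
      ∏ σ : L →ₐ[ℚ] ℂ, ‖σ R.leadingCoeff‖) :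
    (2 : ℝ) ^ (∑ j : Fin N, (j : ℕ) / (p.natDegree * R.natDegree * d ^ l)) ≤
      (N.factorial * 2 ^ (p.natDegree * R.natDegree * d ^ l * N)) ^
        (R.natDegree * d ^ l + 2 * D * (p.natDegree * d ^ l)) := by
  set k := p.natDegree with hk
  set r := R.natDegree with hr
  set a := p.leadingCoeff with ha
  set b := R.leadingCoeff with hb
  set W := k * r * d ^ l with hWdef
  set M := ∑ j : Fin N, (j : ℕ) / W with hM
  set Δ := (Matrix.vandermonde t).det with hΔ
  set K : ℝ := N.factorial * 2 ^ (W * N) with hK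
  have hdl : 0 < d ^ l := by positivity
  have hW : 0 < W := by positivity
  have ha0 : a ≠ 0 := leadingCoeff_ne_zero.2 fun h => by simp [hk, h] at hp
  have hK1 : 1 ≤ K := by
    have h1 : (1 : ℝ) ≤ N.factorial := by
      exact_mod_cast Nat.one_le_iff_ne_zero.2 (Nat.factorial_ne_zero N)
    exact one_le_mul_of_one_le_of_one_le h1 (one_le_pow₀ (by norm_num))
  have htσ : ∀ (σ : L →ₐ[ℚ] ℂ) i, ‖σ (t i)‖ ≤ 2 := fun σ i =>
    ((ht i).map (σ : L →+* ℂ)).norm_le hd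
  have hdet0 : Δ ≠ 0 := Matrix.det_vandermonde_ne_zero_iff.2 htinj
  have hdetint : IsIntegral ℤ Δ := by
    rw [hΔ, Matrix.det_vandermonde]
    exact IsIntegral.prod _ fun i _ => IsIntegral.prod _ fun j _ =>
      ((ht j).isIntegral hd).sub ((ht i).isIntegral hd)
  obtain ⟨hXdeg, hXlead⟩ := criticalOrbit_natDegree_leadingCoeff hd (p := (X : L[X])) (by simp) l
  obtain ⟨hpdeg, hplead⟩ := criticalOrbit_natDegree_leadingCoeff hd hp l
  rw [natDegree_X, one_mul] at hXdeg
  rw [leadingCoeff_X, one_pow] at hXlead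
  set q := criticalOrbit d p (l + 1) ^ r with hq
  have hqdeg : q.natDegree = W := by rw [hq, natDegree_pow, hpdeg]; ring
  have hqlead : q.leadingCoeff = a ^ (r * d ^ l) := by
    rw [hq, leadingCoeff_pow, hplead, ← pow_mul, mul_comm]
  have bound0 : ∀ σ : L →ₐ[ℚ] ℂ, ‖σ Δ‖ ≤ K * (2 ^ (k * r)) ^ M := fun σ => by
    have h1 : (criticalOrbit d (X : L[X]) (l + 1) ^ (k * r)).natDegree = W := by
      rw [natDegree_pow, hXdeg]
    have h2 := norm_embedding_vandermonde_le (σ : L →+* ℂ) h1 hW t (htσ σ) (B := 2 ^ (k * r))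
      (fun i => by
        rw [eval_pow, eval_criticalOrbit, eval_X, map_pow, norm_pow, map_criticalOrbit]
        exact pow_le_pow_left₀ (norm_nonneg _)
          (((ht i).map (σ : L →+* ℂ)).norm_criticalOrbit_le hd _) _)
    rw [leadingCoeff_pow, hXlead, one_pow, map_one, norm_one, one_pow, one_mul] at h2
    exact h2
  have bound1 : ∀ σ : L →ₐ[ℚ] ℂ,
      ‖σ a‖ ^ (r * d ^ l * M) * ‖σ Δ‖ ≤ K * (2 ^ (k * r)) ^ M := fun σ => by
    have h2 := norm_embedding_vandermonde_le (σ : L →+* ℂ) hqdeg hW t (htσ σ) (B := 2 ^ r)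
      (fun i => by
        rw [hq, eval_pow, eval_criticalOrbit, map_pow, norm_pow, map_criticalOrbit]
        exact pow_le_pow_left₀ (norm_nonneg _)
          (((hpt i).map (σ : L →+* ℂ)).norm_criticalOrbit_le hd _) _)
    rw [hqlead, map_pow, norm_pow, ← pow_mul] at h2
    refine h2.trans ?_
    gcongr
    · norm_num
    · exact Nat.le_mul_of_pos_left r hp
  have bound2 : ∀ σ : L →ₐ[ℚ] ℂ,
      (max 1 ‖σ a‖) ^ (r * d ^ l * M) * ‖σ Δ‖ ≤ K * (2 ^ (k * r)) ^ M := fun σ => by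
    rcases max_choice 1 ‖σ a‖ with h | h <;> rw [h]
    · rw [one_pow, one_mul]; exact bound0 σ
    · exact bound1 σ
  have bound3 : ∀ σ : L →ₐ[ℚ] ℂ, ‖σ b‖ ^ (k * d ^ l * M) * ‖σ Δ‖ ≤
      K * C ^ (k * d ^ l * M) * max 1 ‖σ a‖ ^ (D * (k * d ^ l * M)) := fun σ => by
    have h1 : (R ^ (k * d ^ l)).natDegree = W := by rw [natDegree_pow, hWdef]; ring
    have h2 := norm_embedding_vandermonde_le (σ : L →+* ℂ) h1 hW t (htσ σ)
      (B := (C * max 1 ‖σ a‖ ^ D) ^ (k * d ^ l))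
      (fun i => by
        rw [eval_pow, map_pow, norm_pow]
        exact pow_le_pow_left₀ (norm_nonneg _) (hRt σ i) _)
    rw [leadingCoeff_pow, map_pow, norm_pow, ← pow_mul, ← pow_mul, mul_pow, ← pow_mul,
      ← mul_assoc] at h2
    exact h2
  have hInt : IsIntegral ℤ (a ^ (r * d ^ l * M) * Δ) := by
    have h1 := det_eval_powers_eq (q := q) (by rwa [hqdeg]) t
    rw [hqdeg, hqlead, ← pow_mul] at h1
    rw [← h1]
    refine IsIntegral.det fun i j => ?_
    rw [Matrix.of_apply, hq, eval_pow, eval_criticalOrbit]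
    refine IsIntegral.mul (((ht i).isIntegral hd).pow _) ((IsIntegral.pow ?_ _).pow _)
    have h2 : IsIntegral ℤ (p.eval (t i)) := (hpt i).isIntegral hd
    generalize p.eval (t i) = x at h2
    induction l + 1 with
    | zero => exact isIntegral_zero
    | succ n ih => exact (ih.pow _).add h2
  have hnorm1 : 1 ≤ ∏ σ : L →ₐ[ℚ] ℂ, ‖σ Δ‖ := one_le_prod_embeddings_of_isIntegral hdetint hdet0
  have hnorm2 := one_le_prod_embeddings_of_isIntegral hInt (mul_ne_zero (pow_ne_zero _ ha0) hdet0)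
  simp only [map_mul, map_pow, norm_mul, norm_pow, Finset.prod_mul_distrib,
    Finset.prod_pow] at hnorm2
  have hX : 0 < ∏ σ : L →ₐ[ℚ] ℂ, ‖σ a‖ :=
    Finset.prod_pos fun σ _ => norm_pos_iff.2 ((map_ne_zero σ).2 ha0)
  have hV : 0 ≤ ∏ σ : L →ₐ[ℚ] ℂ, max 1 ‖σ a‖ := Finset.prod_nonneg fun σ _ => by positivity
  have P0 := Finset.prod_le_prod (s := Finset.univ) (fun σ _ => norm_nonneg _)
    (fun σ _ => bound0 σ)
  have P2 := Finset.prod_le_prod (s := Finset.univ) (fun σ _ => by positivity)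
    (fun σ _ => bound2 σ)
  have P3 := Finset.prod_le_prod (s := Finset.univ) (fun σ _ => by positivity)
    (fun σ _ => bound3 σ)
  rw [Finset.prod_const, Finset.card_univ] at P0
  rw [Finset.prod_const, Finset.card_univ, Finset.prod_mul_distrib, Finset.prod_pow] at P2
  rw [Finset.prod_mul_distrib, Finset.prod_mul_distrib, Finset.prod_const, Finset.card_univ,
    Finset.prod_pow, Finset.prod_pow] at P3
  have : Nonempty (L →ₐ[ℚ] ℂ) := ⟨IsAlgClosed.lift⟩
  clear_value K
  have main := pow_le_of_normalized_bounds Fintype.card_ne_zero hX hV hK1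
    (one_le_pow₀ (by norm_num)) hC (by linarith) P0 hnorm2 hnorm1 P2 P3 hRlead hD
  set E := r * d ^ l * (k * d ^ l) with hE
  have hE0 : 1 ≤ E := Nat.succ_le_of_lt (by positivity)
  have hexp : ((2 : ℝ) ^ (k * r)) ^ M ^ 1 = 2 ^ (k * r * M) := by rw [pow_one, ← pow_mul]
  rw [pow_one] at hexp
  rw [hexp, mul_pow K, ← pow_mul 2] at main
  have h5 : (2 : ℝ) ^ (k * r * M * (2 * D * (k * d ^ l))) ≤ 2 ^ (E * M) := by
    apply pow_le_pow_right₀ (by norm_num)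
    calc k * r * M * (2 * D * (k * d ^ l)) = (2 * k * D) * (r * (k * d ^ l) * M) := by ring
      _ ≤ d ^ l * (r * (k * d ^ l) * M) := Nat.mul_le_mul_right _ hl
      _ = E * M := by rw [hE]; ring
  have h6 : (4 * C) ^ (E * M) ≤ u ^ (E * M) := by gcongr
  have h7 : (2 : ℝ) ^ (E * M) * (2 ^ (E * M) * C ^ (E * M)) ≤
      K ^ (r * d ^ l + 2 * D * (k * d ^ l)) * (2 ^ (E * M) * C ^ (E * M)) := by
    calc (2 : ℝ) ^ (E * M) * (2 ^ (E * M) * C ^ (E * M)) = (4 * C) ^ (E * M) := by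
          rw [← mul_assoc, ← mul_pow, ← mul_pow]; norm_num
      _ ≤ u ^ (E * M) := h6
      _ ≤ _ := main
      _ ≤ K ^ (r * d ^ l) * C ^ (E * M) *
            (K ^ (2 * D * (k * d ^ l)) * 2 ^ (E * M)) := by gcongr
      _ = _ := by rw [pow_add]; ring
  refine le_trans ?_ (le_of_mul_le_mul_right h7 (by positivity))
  exact pow_le_pow_right₀ (by norm_num) (Nat.le_mul_of_pos_left _ hE0)

lemma map_aevalAeval {S T : Type*} [CommRing S] [CommRing T] [Algebra ℚ S] [Algebra ℚ T]
    (φ : S →+* T) (x y : S) (A : ℚ[X][X]) :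
    φ (aevalAeval x y A) = aevalAeval (φ x) (φ y) A := by
  have : φ.toRatAlgHom.comp (aevalAeval x y) = aevalAeval (R := ℚ) (φ x) (φ y) := by
    ext <;> simp
  exact DFunLike.congr_fun this A

lemma exists_norm_aevalAeval_le (A : ℚ[X][X]) :
    ∃ C : ℝ, 0 < C ∧ ∀ x y : ℂ, ‖x‖ ≤ 2 → ‖y‖ ≤ 2 → ‖aevalAeval x y A‖ ≤ C := by
  have hadd : ∀ A B : ℚ[X][X],
      (∃ C : ℝ, 0 < C ∧ ∀ x y : ℂ, ‖x‖ ≤ 2 → ‖y‖ ≤ 2 → ‖aevalAeval x y A‖ ≤ C) →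
      (∃ C : ℝ, 0 < C ∧ ∀ x y : ℂ, ‖x‖ ≤ 2 → ‖y‖ ≤ 2 → ‖aevalAeval x y B‖ ≤ C) →
      ∃ C : ℝ, 0 < C ∧ ∀ x y : ℂ, ‖x‖ ≤ 2 → ‖y‖ ≤ 2 → ‖aevalAeval x y (A + B)‖ ≤ C := by
    rintro A B ⟨C, hC, hA⟩ ⟨C', hC', hB⟩
    refine ⟨C + C', by positivity, fun x y hx hy => ?_⟩
    rw [map_add]
    exact (norm_add_le _ _).trans (add_le_add (hA x y hx hy) (hB x y hx hy))
  induction A using Polynomial.induction_on' with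
  | add A B hA hB => exact hadd A B hA hB
  | monomial n q =>
    induction q using Polynomial.induction_on' with
    | add p q hp hq => rw [map_add]; exact hadd _ _ hp hq
    | monomial m c =>
      refine ⟨‖(c : ℂ)‖ * 2 ^ m * 2 ^ n + 1, by positivity, fun x y hx hy => ?_⟩
      have : aevalAeval x y (monomial n (monomial m c)) = (c : ℂ) * x ^ m * y ^ n := by
        simp [← C_mul_X_pow_eq_monomial]
      rw [this, norm_mul, norm_mul, norm_pow, norm_pow]
      have : ‖(c : ℂ)‖ * ‖x‖ ^ m * ‖y‖ ^ n ≤ ‖(c : ℂ)‖ * 2 ^ m * 2 ^ n := by gcongr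
      linarith

/-- A polynomial taking sufficiently many pairs of integral points to integral points is defined,
together with those points, over a number field. -/
lemma exists_numberField_lift {h : ℂ[X]} {s : Finset ℂ} (hs : h.natDegree < s.card)
    (hInt : ∀ t ∈ s, IsIntegral ℤ t ∧ IsIntegral ℤ (h.eval t)) :
    ∃ (L : Type) (_ : Field L) (_ : NumberField L) (ψ : L →+* ℂ) (p : L[X]),
      p.map ψ = h ∧ ∀ t ∈ s, ∃ x, ψ x = t := by
  classical
  set S : Set ℂ := ↑(s ∪ s.image fun t => h.eval t) with hS
  have hfin : FiniteDimensional ℚ (IntermediateField.adjoin ℚ S) := by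
    refine IntermediateField.finiteDimensional_adjoin fun x hx => ?_
    rw [hS, Finset.mem_coe, Finset.mem_union, Finset.mem_image] at hx
    rcases hx with hx | ⟨t, ht, rfl⟩
    · exact (hInt x hx).1.tower_top
    · exact (hInt t ht).2.tower_top
  set ψ : IntermediateField.adjoin ℚ S →+* ℂ := algebraMap _ _ with hψ
  have hmem : ∀ t ∈ s, ∃ x, ψ x = t := fun t ht =>
    ⟨⟨t, IntermediateField.subset_adjoin ℚ S (by simp [hS, ht])⟩, rfl⟩
  have hmem' : ∀ t ∈ s, ∃ x, ψ x = h.eval t := fun t ht =>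
    ⟨⟨h.eval t, IntermediateField.subset_adjoin ℚ S
      (by rw [hS]; push_cast; exact Or.inr ⟨t, ht, rfl⟩)⟩, rfl⟩
  have hlift : h ∈ lifts ψ := by
    have hdeg : h.degree < s.card :=
      degree_le_natDegree.trans_lt (by exact_mod_cast hs)
    rw [Lagrange.eq_interpolate (s := s) (v := id) Function.injective_id.injOn hdeg,
      Lagrange.interpolate_apply]
    refine sum_mem fun t ht => mul_mem (C'_mem_lifts (hmem' t ht)) ?_
    refine prod_mem fun y hy => ?_
    obtain ⟨x, hx⟩ := hmem t ht
    obtain ⟨y', hy'⟩ := hmem y (Finset.mem_of_mem_erase hy)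
    refine (mem_lifts _).2 ⟨Lagrange.basisDivisor x y', ?_⟩
    simp [Lagrange.basisDivisor, hx, hy']
  obtain ⟨p, hp⟩ := (mem_lifts _).1 hlift
  exact ⟨_, inferInstance, ⟨⟩, ψ, p, hp, hmem⟩
lemma exists_lt_mul_of_leadingCoeff {d : ℕ} (hd : 2 ≤ d) {h : ℂ[X]} (hh : 0 < h.natDegree)
    (hinf : {t : ℂ | IsPCF d t ∧ IsPCF d (h.eval t)}.Infinite) (A : ℚ[X][X]) :
    ∃ C : ℝ, 0 < C ∧ ∀ (n D D' m v : ℕ) (β : ℂ) (R : ℂ[X]),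
      R = criticalOrbit d h n -
        Polynomial.C (h.leadingCoeff ^ D) * aevalAeval X (criticalOrbit d X n) A →
      0 < R.natDegree → D' ≤ D → 0 < v → IsIntegral ℤ β → β ≠ 0 →
      v * R.leadingCoeff = m * h.leadingCoeff ^ D' * β → (m : ℝ) < C * v := by
  obtain ⟨C, hC, hCA⟩ := exists_norm_aevalAeval_le A
  refine ⟨4 * (2 + C), by positivity, fun n D D' m v β R hR hRdeg hD hv hβ hβ0 hlead => ?_⟩
  by_contra! hcon
  set k := h.natDegree with hk
  obtain ⟨l, hl⟩ : ∃ l, 2 * k * D ≤ d ^ l :=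
    ⟨2 * k * D, (Nat.lt_pow_self (by omega)).le⟩
  have hdl : 0 < d ^ l := by positivity
  obtain ⟨N, hN⟩ := exists_factorial_mul_pow_lt (k * R.natDegree * d ^ l)
    (R.natDegree * d ^ l + 2 * D * (k * d ^ l)) (by positivity)
  obtain ⟨s, hsT, hscard⟩ := hinf.exists_subset_card_eq (N + k + 1)
  obtain ⟨L, _, _, ψ, p, hp, hmem⟩ := exists_numberField_lift (h := h) (s := s) (by omega)
    fun t ht => ⟨(hsT ht).1.isIntegral hd, (hsT ht).2.isIntegral hd⟩
  have hψ := ψ.injective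
  have hpdeg : p.natDegree = k := by rw [hk, ← hp, natDegree_map]
  have hplead : ψ p.leadingCoeff = h.leadingCoeff := by rw [← hp, leadingCoeff_map]
  set Q : L[X] := criticalOrbit d p n -
    Polynomial.C (p.leadingCoeff ^ D) * aevalAeval X (criticalOrbit d X n) A with hQ
  have hQR : Q.map ψ = R := by
    rw [hR, hQ, ← coe_mapRingHom, map_sub, map_mul, map_criticalOrbit, map_aevalAeval,
      map_criticalOrbit]
    simp [hp, hplead]
  have hQdeg : Q.natDegree = R.natDegree := by rw [← hQR, natDegree_map]
  have hQlead : ψ Q.leadingCoeff = R.leadingCoeff := by rw [← hQR, leadingCoeff_map]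
  have hemb : ∀ j : Fin N, ((s.equivFin.symm (Fin.castLE (by omega) j) : s) : ℂ) ∈ s :=
    fun j => Subtype.property _
  choose t ht using fun j => hmem _ (hemb j)
  have htinj : Function.Injective t := fun i j hij => by
    have h1 := (ht i).symm.trans ((congrArg ψ hij).trans (ht j))
    exact Fin.castLE_injective _ (s.equivFin.symm.injective (Subtype.ext h1))
  have htT : ∀ j, IsPCF d (t j) ∧ IsPCF d (p.eval (t j)) := fun j => by
    have h1 := hsT (hemb j)
    rw [← ht j] at h1
    refine ⟨h1.1.of_map ψ hψ, IsPCF.of_map ψ hψ ?_⟩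
    rw [← eval₂_at_apply, ← eval_map, hp]
    exact h1.2
  have hm : 0 < m := by
    rcases Nat.eq_zero_or_pos m with h0 | h0
    · rw [h0, Nat.cast_zero] at hcon
      have : (0 : ℝ) < 4 * (2 + C) * v := by positivity
      linarith
    · exact h0
  have hp0 : p.leadingCoeff ≠ 0 := leadingCoeff_ne_zero.2 fun h0 => by
    rw [h0, natDegree_zero] at hpdeg; omega
  set γ : L := v * Q.leadingCoeff / (m * p.leadingCoeff ^ D') with hγ
  have hγeq : (v : L) * Q.leadingCoeff = m * p.leadingCoeff ^ D' * γ := by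
    have : (m : L) ≠ 0 := by exact_mod_cast hm.ne'
    rw [hγ]; field_simp
  have hγψ : ψ γ = β := by
    have h1 := congrArg ψ hγeq
    simp only [map_mul, map_natCast, map_pow, hQlead, hplead, hlead] at h1
    have h2 : (m : ℂ) * h.leadingCoeff ^ D' ≠ 0 := by
      rw [← hplead]
      exact mul_ne_zero (by exact_mod_cast hm.ne')
        (pow_ne_zero _ ((map_ne_zero ψ).2 hp0))
    exact (mul_left_cancel₀ h2 h1).symm
  have hγ0 : γ ≠ 0 := fun h0 => hβ0 (by rw [← hγψ, h0, map_zero])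
  have hγint : IsIntegral ℤ γ := by
    rw [← hγψ] at hβ
    exact (isIntegral_algHom_iff ψ.toIntAlgHom hψ).1 hβ
  have hnorm := one_le_prod_embeddings_of_isIntegral hγint hγ0
  have key := two_pow_le_of_isPCF hd (p := p) (R := Q) (by omega) (by omega) htinj
    (fun j => (htT j).1) (fun j => (htT j).2) (C := 2 + C) (u := m / v) (D := D) (D' := D')
    (l := l) (by positivity)
    (by rw [le_div_iff₀ (by positivity)]; exact hcon) hD (by rwa [hpdeg])
    (fun σ j => by
      have e1 : σ (Q.eval (t j)) = criticalOrbit d (σ (p.eval (t j))) n -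
          σ p.leadingCoeff ^ D * aevalAeval (σ (t j)) (criticalOrbit d (σ (t j)) n) A := by
        have h1 := map_aevalAeval (evalRingHom (t j)) X (criticalOrbit d (X : L[X]) n) A
        have h2 := map_aevalAeval (σ : L →+* ℂ) (t j) (criticalOrbit d (t j) n) A
        have h3 := map_criticalOrbit (σ : L →+* ℂ) d (t j) n
        have h4 := map_criticalOrbit (σ : L →+* ℂ) d (p.eval (t j)) n
        rw [map_criticalOrbit] at h1
        simp only [coe_evalRingHom, eval_X, RingHom.coe_coe] at h1 h2 h3 h4
        rw [hQ, eval_sub, eval_mul, eval_C, eval_criticalOrbit, h1, map_sub, map_mul, h2, h3, h4,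
          map_pow]
      rw [e1]
      have b1 := ((htT j).2.map (σ : L →+* ℂ)).norm_criticalOrbit_le hd n
      have b2 := hCA _ _ (((htT j).1.map (σ : L →+* ℂ)).norm_le hd)
        (((htT j).1.map (σ : L →+* ℂ)).norm_criticalOrbit_le hd n)
      have b3 : ‖σ p.leadingCoeff‖ ^ D ≤ max 1 ‖σ p.leadingCoeff‖ ^ D := by
        gcongr; exact le_max_right _ _
      have b4 : 1 ≤ max 1 ‖σ p.leadingCoeff‖ ^ D := one_le_pow₀ (le_max_left _ _)
      refine (norm_sub_le _ _).trans ?_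
      rw [norm_mul, norm_pow]
      calc _ ≤ 2 + max 1 ‖σ p.leadingCoeff‖ ^ D * C := by gcongr <;> assumption
        _ ≤ _ := by nlinarith)
    (by
      have e1 : ∀ σ : L →ₐ[ℚ] ℂ, ‖σ Q.leadingCoeff‖ =
          ‖σ p.leadingCoeff‖ ^ D' * ((m : ℝ) / v) * ‖σ γ‖ := fun σ => by
        have h1 := congrArg (fun x => ‖σ x‖) hγeq
        simp only [map_mul, map_natCast, map_pow, norm_mul, norm_pow, RCLike.norm_natCast] at h1
        have : (v : ℝ) ≠ 0 := by positivity
        field_simp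
        linarith
      simp only [e1, Finset.prod_mul_distrib, Finset.prod_pow, Finset.prod_const,
        Finset.card_univ]
      refine le_mul_of_one_le_right ?_ hnorm
      have : 0 ≤ ∏ σ : L →ₐ[ℚ] ℂ, ‖σ p.leadingCoeff‖ := Finset.prod_nonneg fun _ _ => norm_nonneg _
      positivity)
  rw [hpdeg, hQdeg] at key
  exact absurd hN (not_lt.2 key)

lemma isAlgebraic_leadingCoeff {d : ℕ} (hd : 2 ≤ d) {h : ℂ[X]}
    (hinf : {t : ℂ | IsPCF d t ∧ IsPCF d (h.eval t)}.Infinite) (A : ℚ[X][X]) (n D : ℕ) :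
    IsAlgebraic ℤ (criticalOrbit d h n -
      Polynomial.C (h.leadingCoeff ^ D) * aevalAeval X (criticalOrbit d X n) A).leadingCoeff := by
  obtain ⟨s, hsT, hscard⟩ := hinf.exists_subset_card_eq (h.natDegree + 1)
  obtain ⟨L, _, _, ψ, p, hp, -⟩ := exists_numberField_lift (h := h) (s := s) (by omega)
    fun t ht => ⟨(hsT ht).1.isIntegral hd, (hsT ht).2.isIntegral hd⟩
  have hplead : ψ p.leadingCoeff = h.leadingCoeff := by rw [← hp, leadingCoeff_map]
  have hQR : (criticalOrbit d p n - Polynomial.C (p.leadingCoeff ^ D) *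
      aevalAeval X (criticalOrbit d X n) A).map ψ = criticalOrbit d h n -
      Polynomial.C (h.leadingCoeff ^ D) * aevalAeval X (criticalOrbit d X n) A := by
    rw [← coe_mapRingHom, map_sub, map_mul, map_criticalOrbit, map_aevalAeval,
      map_criticalOrbit]
    simp [hp, hplead]
  rw [← hQR, leadingCoeff_map]
  refine IsAlgebraic.algHom ψ.toIntAlgHom ?_
  exact (IsFractionRing.isAlgebraic_iff ℤ ℚ L).2 (IsAlgebraic.of_finite ℚ _)
lemma geom_sum₂_natDegree_le_and_coeff {R : Type*} [CommRing R] {x y : R[X]} {m d : ℕ} {b : R}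
    (hd : 0 < d) (hx : x.natDegree ≤ m) (hy : y.natDegree ≤ m) (hxb : x.coeff m = b)
    (hyb : y.coeff m = b) :
    (∑ i ∈ Finset.range d, x ^ i * y ^ (d - 1 - i)).natDegree ≤ m * (d - 1) ∧
      (∑ i ∈ Finset.range d, x ^ i * y ^ (d - 1 - i)).coeff (m * (d - 1)) = d * b ^ (d - 1) := by
  have hdeg : ∀ i ∈ Finset.range d, i * m + (d - 1 - i) * m = m * (d - 1) := fun i hi => by
    rw [Finset.mem_range] at hi
    rw [← add_mul, mul_comm, show i + (d - 1 - i) = d - 1 by omega]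
  constructor
  · refine natDegree_sum_le_of_forall_le _ _ fun i hi => ?_
    rw [← hdeg i hi]
    exact natDegree_mul_le_of_le (natDegree_pow_le_of_le i hx) (natDegree_pow_le_of_le _ hy)
  · rw [finsetSum_coeff, Finset.sum_congr rfl (g := fun _ => b ^ (d - 1))]
    · simp
    · intro i hi
      rw [← hdeg i hi, coeff_mul_add_eq_of_natDegree_le (natDegree_pow_le_of_le i hx)
        (natDegree_pow_le_of_le _ hy), coeff_pow_of_natDegree_le hx,
        coeff_pow_of_natDegree_le hy, hxb, hyb, ← pow_add]
      rw [Finset.mem_range] at hi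
      congr 1
      omega

lemma degree_lt_of_natDegree_le_of_coeff_eq_zero {R : Type*} [Semiring R] {p : R[X]} {n : ℕ}
    (hp : p.natDegree ≤ n) (hn : p.coeff n = 0) : p.degree < n := by
  refine (degree_lt_iff_coeff_zero _ _).2 fun i hi => ?_
  rcases hi.eq_or_lt with rfl | hi
  · exact hn
  · exact coeff_eq_zero_of_natDegree_lt (hp.trans_lt hi)

/-- For each `k` there is a monic polynomial of degree `k` nearly commuting with `z ↦ z ^ d + c`. -/
lemma exists_monic_degree_comp_sub_pow_lt {R : Type*} [CommRing R] [Algebra ℚ R] [Nontrivial R]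
    {d : ℕ} (hd : 2 ≤ d) (c : R) (k : ℕ) :
    ∃ A : R[X], A.Monic ∧ A.natDegree = k ∧
      (A.comp (X ^ d + Polynomial.C c) - A ^ d).degree < (k * (d - 1) : ℕ) := by
  set f : R[X] := X ^ d + Polynomial.C c with hf
  have hfm : f.Monic := monic_X_pow_add_C c (by omega)
  have hfd : f.natDegree = d := natDegree_X_pow_add_C
  have hcompm : ∀ j, (f ^ j).Monic ∧ (f ^ j).natDegree = j * d := fun j =>
    ⟨hfm.pow j, by rw [hfm.natDegree_pow, hfd]⟩
  suffices H : ∀ i ≤ k, ∃ A : R[X], A.Monic ∧ A.natDegree = k ∧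
      (A.comp f - A ^ d).degree < (k * d - i : ℕ) by
    obtain ⟨A, h1, h2, h3⟩ := H k le_rfl
    exact ⟨A, h1, h2, by rwa [Nat.mul_sub, mul_one]⟩
  intro i
  induction i with
  | zero =>
    intro _
    refine ⟨X ^ k, monic_X_pow k, natDegree_X_pow k, ?_⟩
    rw [X_pow_comp, ← pow_mul]
    refine degree_lt_of_natDegree_le_of_coeff_eq_zero ?_ ?_
    · rw [Nat.sub_zero]
      exact (natDegree_sub_le_of_le (hcompm k).2.le (natDegree_X_pow_le _)).trans (max_self _).le
    · have := (hcompm k).1.coeff_natDegree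
      rw [(hcompm k).2] at this
      simp [this]
  | succ i ih =>
    intro hi
    obtain ⟨A, hA, hAk, hE⟩ := ih (by omega)
    set E := A.comp f - A ^ d with hEdef
    set n := k * d - (i + 1) with hn
    set j := k - (i + 1) with hj
    set e := algebraMap ℚ R (1 / d) * E.coeff n with he
    have hkd : k * d = k * (d - 1) + k := by
      obtain ⟨d', rfl⟩ : ∃ d', d = d' + 1 := ⟨d - 1, by omega⟩
      simp [mul_add]
    have hnj : j + k * (d - 1) = n := by omega
    have hjd : j * d < n := by
      have : j * d + (i + 1) * d = k * d := by rw [← add_mul]; congr 1; omega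
      have h2 : (i + 1) * 2 ≤ (i + 1) * d := Nat.mul_le_mul_left _ hd
      omega
    have hde : (d : R) * e = E.coeff n := by
      have : (d : R) * algebraMap ℚ R (1 / d) = 1 := by
        have hd0 : (d : ℚ) ≠ 0 := by positivity
        rw [← map_natCast (algebraMap ℚ R), ← map_mul, mul_one_div_cancel hd0, map_one]
      rw [he, ← mul_assoc, this, one_mul]
    have hjk : j < k := by omega
    have hlow : (Polynomial.C e * X ^ j).degree < A.degree := by
      refine (degree_C_mul_X_pow_le j e).trans_lt ?_
      rw [degree_eq_natDegree hA.ne_zero, hAk]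
      exact_mod_cast hjk
    set A' := A + Polynomial.C e * X ^ j with hA'
    have hA'm : A'.Monic := hA.add_of_left hlow
    have hA'k : A'.natDegree = k := by
      rw [hA', natDegree_add_eq_left_of_degree_lt hlow, hAk]
    obtain ⟨hS1, hS2⟩ := geom_sum₂_natDegree_le_and_coeff (d := d) (by omega) hA'k.le hAk.le
      (b := 1) (by rw [← hA'k]; exact hA'm) (by rw [← hAk]; exact hA)
    set S := ∑ i ∈ Finset.range d, A' ^ i * A ^ (d - 1 - i) with hS
    have hS3 : S * (A' - A) = A' ^ d - A ^ d := (Commute.all A' A).geom_sum₂_mul d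
    have hE' : A'.comp f - A' ^ d =
        E + Polynomial.C e * f ^ j - Polynomial.C e * (X ^ j * S) := by
      have h1 : A' - A = Polynomial.C e * X ^ j := by rw [hA']; ring
      have h2 : A'.comp f = A.comp f + Polynomial.C e * f ^ j := by simp [hA']
      rw [h2, hEdef]
      rw [h1] at hS3
      linear_combination hS3
    refine ⟨A', hA'm, hA'k, ?_⟩
    rw [hE']
    have hXS : (X ^ j * S).natDegree ≤ n := by
      rw [← hnj]; exact natDegree_mul_le_of_le (natDegree_X_pow_le j) hS1
    have hEn : E.natDegree ≤ n := by
      refine natDegree_le_iff_coeff_eq_zero.2 fun N hN => ?_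
      exact (degree_lt_iff_coeff_zero _ _).1 hE N (by omega)
    refine degree_lt_of_natDegree_le_of_coeff_eq_zero ?_ ?_
    · refine (natDegree_sub_le_of_le (natDegree_add_le_of_degree_le hEn ?_) ?_).trans
        (max_self n).le
      · exact (natDegree_C_mul_le _ _).trans ((hcompm j).2.le.trans hjd.le)
      · exact (natDegree_C_mul_le _ _).trans hXS
    · have h1 : (f ^ j).coeff n = 0 := coeff_eq_zero_of_natDegree_lt ((hcompm j).2.trans_lt hjd)
      have h2 : (X ^ j * S).coeff n = (d : R) := by
        rw [← hnj, add_comm, coeff_X_pow_mul, hS2, one_pow, mul_one]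
      rw [coeff_sub, coeff_add, coeff_C_mul, coeff_C_mul, h1, h2, mul_zero, add_zero,
        mul_comm e, hde, sub_self]

lemma exists_forall_natDegree_coeff_lt {R : Type*} [Semiring R] (B : R[X][X]) :
    ∃ M, ∀ i, (B.coeff i).natDegree < M := by
  refine ⟨B.support.sup (fun i => (B.coeff i).natDegree) + 1, fun i => Nat.lt_succ_of_le ?_⟩
  by_cases hi : i ∈ B.support
  · exact Finset.le_sup (f := fun i => (B.coeff i).natDegree) hi
  · rw [notMem_support_iff.1 hi, natDegree_zero]; exact Nat.zero_le _

lemma degree_eval_lt {R : Type*} [CommRing R] {B : R[X][X]} {P : R[X]} {D m : ℕ}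
    (hB : ∀ i, (B.coeff i).natDegree < D) (hP : P.natDegree ≤ D) (hm : B.degree < m) :
    (B.eval P).degree < (m * D : ℕ) := by
  by_cases hB0 : B = 0
  · rw [hB0, eval_zero, degree_zero]; exact WithBot.bot_lt_coe _
  rw [eval_eq_sum_range' ((natDegree_lt_iff_degree_lt hB0).2 hm), ← mem_degreeLT]
  refine sum_mem fun i hi => mem_degreeLT.2 ?_
  have h1 : (B.coeff i * P ^ i).natDegree ≤ (B.coeff i).natDegree + i * D :=
    natDegree_mul_le_of_le le_rfl (natDegree_pow_le_of_le i hP)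
  refine degree_le_natDegree.trans_lt (Nat.cast_lt.2 ?_)
  have h2 : (i + 1) * D ≤ m * D := Nat.mul_le_mul_right _ (Finset.mem_range.1 hi)
  have := hB i
  rw [add_mul, one_mul] at h2
  omega

lemma eq_zero_of_eval_eq_zero_of_natDegree_lt {R : Type*} [CommRing R] [IsDomain R] {B : R[X][X]}
    {P : R[X]} {D : ℕ} (hB : ∀ i, (B.coeff i).natDegree < D) (hP : P.natDegree = D)
    (h : B.eval P = 0) : B = 0 := by
  by_contra hB0
  have h1 : (B.eraseLead.eval P).degree < (B.natDegree * D : ℕ) := by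
    refine degree_eval_lt (fun i => ?_) hP.le ?_
    · rw [eraseLead_coeff]
      split_ifs
      · rw [natDegree_zero]; exact (Nat.zero_le _).trans_lt (hB 0)
      · exact hB i
    · rw [← degree_eq_natDegree hB0]; exact degree_eraseLead_lt hB0
  have hP0 : P ≠ 0 := fun h0 => by
    have := hB 0
    rw [h0, natDegree_zero] at hP; omega
  have hlead := leadingCoeff_ne_zero.2 hB0
  have h2 : (B.leadingCoeff * P ^ B.natDegree).degree ≥ (B.natDegree * D : ℕ) := by
    rw [degree_eq_natDegree (mul_ne_zero hlead (pow_ne_zero _ hP0)),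
      natDegree_mul hlead (pow_ne_zero _ hP0), natDegree_pow, hP]
    exact_mod_cast Nat.le_add_left _ _
  rw [← eraseLead_add_C_mul_X_pow B] at h
  rw [eval_add, eval_mul, eval_C, eval_pow, eval_X] at h
  rw [← neg_eq_of_add_eq_zero_left h, degree_neg] at h1
  exact absurd h1 (not_lt.2 h2)

lemma natDegree_eval_of_monic {R : Type*} [CommRing R] [Nontrivial R] {B : R[X][X]}
    {P : R[X]} {D : ℕ} (hB : ∀ i, (B.coeff i).natDegree < D) (hP : P.natDegree = D)
    (hPm : P.Monic) (hBm : B.Monic) :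
    (B.eval P).Monic ∧ (B.eval P).natDegree = B.natDegree * D := by
  have h1 : (B.eraseLead.eval P).degree < (P ^ B.natDegree).degree := by
    rw [degree_eq_natDegree (hPm.pow _).ne_zero, hPm.natDegree_pow, hP]
    refine degree_eval_lt (fun i => ?_) hP.le ?_
    · rw [eraseLead_coeff]
      split_ifs
      · rw [natDegree_zero]; exact (Nat.zero_le _).trans_lt (hB 0)
      · exact hB i
    · rw [← degree_eq_natDegree hBm.ne_zero]; exact degree_eraseLead_lt hBm.ne_zero
  have h2 : B.eval P = P ^ B.natDegree + B.eraseLead.eval P := by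
    conv_lhs => rw [← eraseLead_add_C_mul_X_pow B]
    rw [eval_add, eval_mul, eval_C, eval_pow, eval_X, hBm.leadingCoeff, one_mul, add_comm]
  rw [h2]
  exact ⟨(hPm.pow _).add_of_left h1,
    by rw [natDegree_add_eq_left_of_degree_lt h1, hPm.natDegree_pow, hP]⟩
lemma aevalAeval_X_left_eq_eval_map {R S : Type*} [CommSemiring R] [CommSemiring S] [Algebra R S]
    (A : R[X][X]) (P : S[X]) :
    aevalAeval X P A = (A.map (mapRingHom (algebraMap R S))).eval P := by
  have : (aevalAeval X P : R[X][X] →ₐ[R] S[X]).toRingHom =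
      eval₂RingHom (mapRingHom (algebraMap R S)) P := by
    ext <;> simp
  rw [eval_map]
  exact DFunLike.congr_fun this A

/-- The error in approximating `U` by `a ^ D • A(P)` is multiplied by `d a ^ (D (d - 1))` to leading
order under one step of the critical orbit recursion. -/
lemma leadingCoeff_approximation_error_succ {F : Type*} [Field F] [CharZero F] {d k D : ℕ}
    (hd : 2 ≤ d) (hk : 0 < k) (hD : 2 ≤ D) {A : F[X][X]} (hA : A.Monic) (hAk : A.natDegree = k)
    (hε : (A.comp (X ^ d + Polynomial.C X) - A ^ d).degree < (k * (d - 1) : ℕ))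
    (hAD : ∀ i, (A.coeff i).natDegree < D)
    (hεD : ∀ i, ((A.comp (X ^ d + Polynomial.C X) - A ^ d).coeff i).natDegree < D)
    {h U P : F[X]} {a : F} (ha : a ≠ 0) (hh : h.natDegree = k) (hP : P.Monic)
    (hPD : P.natDegree = D) (hU : U.natDegree = k * D) (hUa : U.leadingCoeff = a ^ D)
    (hR : U - Polynomial.C (a ^ D) * A.eval P ≠ 0) :
    0 < (U ^ d + h - Polynomial.C (a ^ (D * d)) * A.eval (P ^ d + X)).natDegree ∧
    (U ^ d + h - Polynomial.C (a ^ (D * d)) * A.eval (P ^ d + X)).leadingCoeff =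
      d * a ^ (D * (d - 1)) * (U - Polynomial.C (a ^ D) * A.eval P).leadingCoeff := by
  set ε := A.comp (X ^ d + Polynomial.C X) - A ^ d with hεdef
  obtain ⟨hV, hVdeg⟩ := natDegree_eval_of_monic hAD hPD hP hA
  rw [hAk] at hVdeg
  set V := A.eval P with hVdef
  set R := U - Polynomial.C (a ^ D) * V with hRdef
  have hVS : A.eval (P ^ d + X) = V ^ d + ε.eval P := by
    simp [hεdef, hVdef, eval_comp]
  have haD : a ^ D ≠ 0 := pow_ne_zero _ ha
  obtain ⟨hS1, hS2⟩ := geom_sum₂_natDegree_le_and_coeff (d := d) (x := U)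
    (y := Polynomial.C (a ^ D) * V) (m := k * D) (b := a ^ D) (by omega) hU.le
    ((natDegree_C_mul_le _ _).trans hVdeg.le) (by rw [← hU]; exact hUa)
    (by rw [coeff_C_mul, ← hVdeg, hV.coeff_natDegree, mul_one])
  have hS3 := (Commute.all U (Polynomial.C (a ^ D) * V)).geom_sum₂_mul d
  set S := ∑ i ∈ Finset.range d, U ^ i * (Polynomial.C (a ^ D) * V) ^ (d - 1 - i) with hS
  have hcoeff : (d : F) * (a ^ D) ^ (d - 1) ≠ 0 :=
    mul_ne_zero (by exact_mod_cast (by omega : d ≠ 0)) (pow_ne_zero _ haD)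
  have hSdeg : S.natDegree = k * D * (d - 1) :=
    natDegree_eq_of_le_of_coeff_ne_zero hS1 (by rwa [hS2])
  have hSlead : S.leadingCoeff = d * a ^ (D * (d - 1)) := by
    rw [leadingCoeff, hSdeg, hS2, pow_mul]
  have hS0 : S ≠ 0 := fun h0 => hcoeff (by rw [← hS2, h0, coeff_zero])
  have heq : U ^ d + h - Polynomial.C (a ^ (D * d)) * A.eval (P ^ d + X) =
      S * R + (h - Polynomial.C (a ^ (D * d)) * ε.eval P) := by
    rw [hRdef, hS3, hVS, mul_pow, ← Polynomial.C_pow, ← pow_mul]; ring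
  have hSR : S * R ≠ 0 := mul_ne_zero hS0 hR
  have hDd : k * D * (d - 1) = (k * (d - 1)) * D := by ring
  have hkd : k < k * D * (d - 1) := by
    calc k < k * D := by nlinarith
      _ ≤ k * D * (d - 1) := Nat.le_mul_of_pos_right _ (by omega)
  have hlow : (h - Polynomial.C (a ^ (D * d)) * ε.eval P).degree < (S * R).degree := by
    have h1 : ((k * D * (d - 1) : ℕ) : WithBot ℕ) ≤ (S * R).degree := by
      rw [degree_eq_natDegree hSR, natDegree_mul hS0 hR, hSdeg]
      exact_mod_cast Nat.le_add_right _ _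
    refine lt_of_lt_of_le ?_ h1
    refine (degree_sub_le _ _).trans_lt (max_lt ?_ ?_)
    · exact degree_le_natDegree.trans_lt (by rw [hh]; exact_mod_cast hkd)
    · rw [degree_C_mul (pow_ne_zero _ ha), hDd]
      exact degree_eval_lt hεD hPD.le hε
  rw [heq]
  constructor
  · rw [natDegree_add_eq_left_of_degree_lt hlow, natDegree_mul hS0 hR, hSdeg]
    omega
  · rw [leadingCoeff_add_of_degree_lt' hlow, leadingCoeff_mul, hSlead]

lemma exists_criticalOrbit_eq_eval {d : ℕ} (hd : 2 ≤ d) {h : ℂ[X]} (hh : 0 < h.natDegree)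
    (hinf : {t : ℂ | IsPCF d t ∧ IsPCF d (h.eval t)}.Infinite) :
    ∃ A : ℂ[X][X], A.Monic ∧ A.natDegree = h.natDegree ∧
      (A.comp (X ^ d + Polynomial.C X) - A ^ d).degree < (h.natDegree * (d - 1) : ℕ) ∧
      ∃ n₀, ∀ n ≥ n₀, criticalOrbit d h (n + 1) =
        Polynomial.C (h.leadingCoeff ^ d ^ n) * A.eval (criticalOrbit d X (n + 1)) := by
  set k := h.natDegree with hk
  set a := h.leadingCoeff with ha
  have ha0 : a ≠ 0 := leadingCoeff_ne_zero.2 fun h0 => by simp [hk, h0] at hh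
  obtain ⟨A₀, hA₀, hA₀k, hε₀⟩ := exists_monic_degree_comp_sub_pow_lt hd (X : ℚ[X]) k
  set φ : ℚ[X] →+* ℂ[X] := mapRingHom (algebraMap ℚ ℂ) with hφ
  set A := A₀.map φ with hAdef
  have hA : A.Monic := hA₀.map _
  have hAk : A.natDegree = k := by rw [hAdef, hA₀.natDegree_map, hA₀k]
  have hεmap : A.comp (X ^ d + Polynomial.C X) - A ^ d =
      (A₀.comp (X ^ d + Polynomial.C X) - A₀ ^ d).map φ := by
    simp [hAdef, map_comp, hφ]
  have hε : (A.comp (X ^ d + Polynomial.C X) - A ^ d).degree < (k * (d - 1) : ℕ) := by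
    rw [hεmap]; exact degree_map_le.trans_lt hε₀
  have heval : ∀ P : ℂ[X], aevalAeval X P A₀ = A.eval P := aevalAeval_X_left_eq_eval_map A₀
  refine ⟨A, hA, hAk, hε, ?_⟩
  obtain ⟨M₁, hM₁⟩ := exists_forall_natDegree_coeff_lt A
  obtain ⟨M₂, hM₂⟩ := exists_forall_natDegree_coeff_lt (A.comp (X ^ d + Polynomial.C X) - A ^ d)
  obtain ⟨C, hC, hkey⟩ := exists_lt_mul_of_leadingCoeff hd hh hinf A₀
  refine ⟨M₁ + M₂ + 1, fun n hn => ?_⟩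
  set R : ℕ → ℂ[X] := fun j => criticalOrbit d h (n + j + 1) -
    Polynomial.C (a ^ d ^ (n + j)) * A.eval (criticalOrbit d X (n + j + 1)) with hR
  by_contra hne
  have hR0 : R 0 ≠ 0 := fun h0 => hne (sub_eq_zero.1 h0)
  have hstep : ∀ j, R j ≠ 0 → 0 < (R (j + 1)).natDegree ∧
      (R (j + 1)).leadingCoeff = d * a ^ (d ^ (n + j) * (d - 1)) * (R j).leadingCoeff := by
    intro j hj
    have hlt : n + j < d ^ (n + j) := Nat.lt_pow_self (by omega)
    have hX := criticalOrbit_natDegree_leadingCoeff hd (p := (X : ℂ[X])) (by simp) (n + j)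
    rw [natDegree_X, one_mul, leadingCoeff_X, one_pow] at hX
    have hU := criticalOrbit_natDegree_leadingCoeff hd hh (n + j)
    exact leadingCoeff_approximation_error_succ hd hh (le_trans (by omega) hlt) hA hAk hε
      (fun i => (hM₁ i).trans_le ((by omega : M₁ ≤ n + j).trans hlt.le))
      (fun i => (hM₂ i).trans_le ((by omega : M₂ ≤ n + j).trans hlt.le))
      ha0 hk.symm hX.2 hX.1
      hU.1 hU.2 hj
  have hlead : ∀ j, (R j) ≠ 0 ∧
      (R j).leadingCoeff = d ^ j * a ^ (d ^ (n + j) - d ^ n) * (R 0).leadingCoeff := by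
    intro j
    induction j with
    | zero => exact ⟨hR0, by simp⟩
    | succ j ih =>
      obtain ⟨h1, h2⟩ := hstep j ih.1
      refine ⟨fun h0 => by simp [h0] at h1, ?_⟩
      have hle : d ^ n ≤ d ^ (n + j) := Nat.pow_le_pow_right (by omega) (by omega)
      have hexp : d ^ (n + (j + 1)) - d ^ n =
          d ^ (n + j) * (d - 1) + (d ^ (n + j) - d ^ n) := by
        have : d ^ (n + (j + 1)) = d ^ (n + j) * (d - 1) + d ^ (n + j) := by
          obtain ⟨e, rfl⟩ : ∃ e, d = e + 1 := ⟨d - 1, by omega⟩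
          rw [← add_assoc, pow_succ, Nat.add_sub_cancel, mul_add, mul_one]
        omega
      rw [h2, ih.2, hexp, pow_add, pow_succ]
      ring
  have halg := isAlgebraic_leadingCoeff hd hinf A₀ (n + 1) (d ^ n)
  rw [heval] at halg
  obtain ⟨y, hy0, hy⟩ := halg.exists_integral_multiple
  set v := y.natAbs with hv
  have hv0 : 0 < v := Int.natAbs_pos.2 hy0
  have hInt : IsIntegral ℤ ((v : ℂ) * (R 0).leadingCoeff) := by
    rw [zsmul_eq_mul] at hy
    have hvy : (v : ℂ) = ((v : ℤ) : ℂ) := (Int.cast_natCast v).symm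
    rcases Int.natAbs_eq y with h1 | h1
    · rwa [hvy, hv, ← h1]
    · rw [hvy, show (v : ℤ) = -y by omega, Int.cast_neg, neg_mul]
      exact hy.neg
  obtain ⟨j, hj⟩ := exists_nat_gt (C * v)
  have hj' : (j : ℝ) ≤ (d ^ (j + 1) : ℕ) := by
    exact_mod_cast (Nat.le_succ j).trans (Nat.lt_pow_self (by omega)).le
  have hlt := hkey (n + (j + 1) + 1) (d ^ (n + (j + 1))) (d ^ (n + (j + 1)) - d ^ n) (d ^ (j + 1)) v
    _ (R (j + 1)) (by rw [heval]) (hstep j (hlead j).1).1 (Nat.sub_le _ _) hv0 hInt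
    (mul_ne_zero (by exact_mod_cast hv0.ne') (leadingCoeff_ne_zero.2 hR0))
    (by rw [(hlead (j + 1)).2]; push_cast; ring)
  linarith

lemma le_one_of_X_pow_add_one_pow_eq {F : Type*} [Field F] [CharZero F] {d k : ℕ} (hd : 2 ≤ d)
    {B : F[X]} {γ : F} (hγ : γ ≠ 0) (h : (X ^ d + 1) ^ k = B ^ d + Polynomial.C γ) : k ≤ 1 := by
  rcases Nat.eq_zero_or_pos k with rfl | hk
  · exact Nat.zero_le _
  have hunit : (Polynomial.C γ⁻¹ : F[X]) * Polynomial.C γ = 1 := by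
    rw [← Polynomial.C_mul, inv_mul_cancel₀ hγ, Polynomial.C_1]
  have hcop : IsCoprime B (X ^ d + 1) := by
    refine ⟨-Polynomial.C γ⁻¹ * B ^ (d - 1), Polynomial.C γ⁻¹ * (X ^ d + 1) ^ (k - 1), ?_⟩
    rw [mul_assoc, mul_assoc, pow_sub_one_mul (by omega), pow_sub_one_mul (by omega), h, ← hunit]
    ring
  have hBdeg : B.natDegree = k := by
    have h1 : (B ^ d + Polynomial.C γ).natDegree = d * B.natDegree := by
      rw [natDegree_add_C, natDegree_pow]
    have h2 : (X ^ d + 1 : F[X]).natDegree = d := natDegree_X_pow_add_C (r := (1 : F))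
    rw [← h, natDegree_pow, h2, mul_comm] at h1
    exact (Nat.eq_of_mul_eq_mul_left (by omega) h1).symm
  have hder : (k : F[X]) * (X ^ d + 1) ^ (k - 1) * ((d : F[X]) * X ^ (d - 1)) =
      (d : F[X]) * B ^ (d - 1) * derivative B := by
    have := congrArg derivative h
    simpa [derivative_pow] using this
  have hdvd : B ^ (d - 1) ∣ (Polynomial.C (k * d : F) * X ^ (d - 1)) := by
    refine (IsCoprime.pow (m := d - 1) (n := k - 1) hcop).dvd_of_dvd_mul_left
      ⟨d * derivative B, ?_⟩
    simp only [Polynomial.C_mul, map_natCast]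
    linear_combination hder
  have hkd : (k * d : F) ≠ 0 := mul_ne_zero (by exact_mod_cast hk.ne')
    (by exact_mod_cast (by omega : d ≠ 0))
  have hne : (Polynomial.C (k * d : F) * X ^ (d - 1)) ≠ 0 :=
    mul_ne_zero (by simpa using hkd) (pow_ne_zero _ X_ne_zero)
  have hle := natDegree_le_of_dvd hdvd hne
  rw [natDegree_pow, natDegree_C_mul_X_pow _ _ hkd, hBdeg] at hle
  have : d - 1 ≠ 0 := by omega
  exact Nat.le_of_mul_le_mul_left (by omega : (d - 1) * k ≤ (d - 1) * 1) (by omega)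

lemma aevalAeval_comp {R S : Type*} [CommSemiring R] [CommSemiring S] [Algebra R S] (x y : S)
    (A B : R[X][X]) : aevalAeval x y (A.comp B) = aevalAeval x (aevalAeval x y B) A := by
  induction A using Polynomial.induction_on' with
  | add p q hp hq => rw [add_comp, map_add, map_add, hp, hq]
  | monomial n q => simp [← C_mul_X_pow_eq_monomial]

lemma aevalAeval_monomial_monomial {R S : Type*} [CommSemiring R] [CommSemiring S] [Algebra R S]
    (x y : S) (n m : ℕ) (c : R) :
    aevalAeval x y (monomial n (monomial m c)) = algebraMap R S c * x ^ m * y ^ n := by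
  simp [← C_mul_X_pow_eq_monomial]

lemma coeff_coeff_aevalAeval_X_pow {R : Type*} [CommRing R] {d : ℕ} (hd : 0 < d) (A : R[X][X])
    (i j : ℕ) :
    ((aevalAeval (X ^ d : R[X][X]) (Polynomial.C X * X) A).coeff (d * i + j)).coeff j =
      (A.coeff j).coeff i := by
  induction A using Polynomial.induction_on' with
  | add p q hp hq => simp only [map_add, coeff_add, hp, hq]
  | monomial n q =>
    induction q using Polynomial.induction_on' with
    | add p q hp hq => simp only [map_add, coeff_add, hp, hq]
    | monomial m c =>
      have h1 : aevalAeval (X ^ d : R[X][X]) (Polynomial.C X * X) (monomial n (monomial m c)) =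
          Polynomial.C (Polynomial.C c * X ^ n) * X ^ (d * m + n) := by
        rw [aevalAeval_monomial_monomial, Polynomial.algebraMap_apply, algebraMap_eq]
        simp only [Polynomial.C_mul, Polynomial.C_pow]
        ring
      rw [h1, coeff_C_mul_X_pow, coeff_monomial]
      by_cases hn : n = j
      · subst hn
        by_cases hm : m = i
        · subst hm; simp
        · have : ¬ d * i + n = d * m + n := fun h => hm
            (Nat.eq_of_mul_eq_mul_left hd (by omega)).symm
          rw [if_neg this, coeff_zero, if_pos rfl, coeff_monomial_of_ne _ (Ne.symm hm)]
      · split_ifs <;> simp [coeff_C_mul, coeff_X_pow, Ne.symm hn]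

lemma coeff_aevalAeval_X_pow_mul {R : Type*} [CommRing R] {d : ℕ} (hd : 0 < d) (A : R[X][X])
    (q : R[X]) (w : ℕ) :
    (aevalAeval (X ^ d : R[X][X]) (Polynomial.C q * X ^ d) A).coeff (d * w) =
      ∑ j ∈ Finset.range (w + 1), Polynomial.C ((A.coeff j).coeff (w - j)) * q ^ j := by
  induction A using Polynomial.induction_on' with
  | add p q hp hq =>
    simp only [map_add, coeff_add, hp, hq, add_mul, Finset.sum_add_distrib]
  | monomial n r =>
    induction r using Polynomial.induction_on' with
    | add p q hp hq =>
      simp only [map_add, coeff_add, hp, hq, add_mul, Finset.sum_add_distrib]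
    | monomial m c =>
      have h1 : aevalAeval (X ^ d : R[X][X]) (Polynomial.C q * X ^ d) (monomial n (monomial m c)) =
          Polynomial.C (Polynomial.C c * q ^ n) * X ^ (d * (m + n)) := by
        rw [aevalAeval_monomial_monomial, Polynomial.algebraMap_apply, algebraMap_eq]
        simp only [Polynomial.C_mul, Polynomial.C_pow]
        ring
      rw [h1, coeff_C_mul_X_pow]
      by_cases hw : w = m + n
      · rw [if_pos (by rw [hw]), Finset.sum_eq_single n]
        · simp [hw]
        · intro j _ hj
          simp [coeff_monomial, Ne.symm hj]
        · intro hn; simp at hn; omega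
      · rw [if_neg fun h => hw (Nat.eq_of_mul_eq_mul_left hd h)]
        refine (Finset.sum_eq_zero fun j hj => ?_).symm
        rw [Finset.mem_range] at hj
        by_cases hn : n = j
        · simp [coeff_monomial, hn, show m ≠ w - j by omega]
        · simp [coeff_monomial, hn]

lemma natDegree_le_one_of_comp_sub_pow_eq_C {F : Type*} [Field F] [CharZero F] {d : ℕ}
    (hd : 2 ≤ d) {A : F[X][X]} (hA : A.Monic) {g : F[X]} (hg : g.natDegree = A.natDegree)
    (h : A.comp (X ^ d + Polynomial.C X) - A ^ d = Polynomial.C g) : A.natDegree ≤ 1 := by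
  rcases Nat.eq_zero_or_pos A.natDegree with h0 | hk
  · omega
  set k := A.natDegree with hkdef
  set ψ : F[X][X] →ₐ[F] F[X][X] := aevalAeval (X ^ d) (Polynomial.C X * X) with hψ
  set w := (ψ A).natDegree with hw
  have hsupp : ∀ i j, w < d * i + j → (A.coeff j).coeff i = 0 := fun i j hij => by
    rw [← coeff_coeff_aevalAeval_X_pow (by omega : 0 < d), ← hψ, coeff_eq_zero_of_natDegree_lt hij,
      coeff_zero]
  have hkw : k ≤ w := by
    by_contra! hcon
    have := hsupp 0 k (by omega)
    rw [hA.coeff_natDegree, coeff_one_zero] at this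
    exact one_ne_zero this
  have hψ0 : ψ A ≠ 0 := fun h0 => by rw [hw, h0, natDegree_zero] at hkw; omega
  have hB : (ψ A).coeff w ≠ 0 := leadingCoeff_ne_zero.2 hψ0
  have hcomp : ψ (A.comp (X ^ d + Polynomial.C X)) =
      aevalAeval (X ^ d) (Polynomial.C (X ^ d + 1) * X ^ d) A := by
    rw [hψ, aevalAeval_comp]
    congr 2
    simp only [map_add, map_pow, aevalAeval_Y, aevalAeval_X, Polynomial.C_1]
    ring
  have hgψ : (ψ (Polynomial.C g)).coeff (d * w) = Polynomial.C (g.coeff w) := by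
    have h1 : ψ (Polynomial.C g) = expand F[X] d (g.map Polynomial.C) := by
      rw [hψ, aevalAeval_C, expand_eq_comp_X_pow, comp, eval₂_map]
      rfl
    rw [h1, mul_comm, coeff_expand_mul (by omega), coeff_map]
  have hmain := congrArg (fun P => (ψ P).coeff (d * w)) h
  have hpow : (ψ A ^ d).coeff (d * w) = (ψ A).coeff w ^ d :=
    coeff_pow_of_natDegree_le hw.ge
  simp only [map_sub, map_pow, coeff_sub] at hmain
  rw [hcomp, coeff_aevalAeval_X_pow_mul (by omega), hgψ,
    hpow, Finset.sum_range_succ, Finset.sum_eq_zero, zero_add,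
    Nat.sub_self] at hmain
  · rcases hkw.eq_or_lt with hkw | hkw
    · rw [← hkw, hA.coeff_natDegree, coeff_one_zero, Polynomial.C_1, one_mul] at hmain
      refine le_one_of_X_pow_add_one_pow_eq hd (γ := g.coeff k) ?_ (sub_eq_iff_eq_add'.1 hmain)
      rw [← hg, coeff_natDegree]
      exact leadingCoeff_ne_zero.2 fun h0 => by rw [h0, natDegree_zero] at hg; omega
    · rw [coeff_eq_zero_of_natDegree_lt (p := A) hkw, coeff_zero,
        coeff_eq_zero_of_natDegree_lt (hg.trans_lt hkw), Polynomial.C_0, zero_mul, zero_sub,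
        neg_eq_zero] at hmain
      exact absurd hmain (pow_ne_zero _ hB)
  · intro j hj
    rw [Finset.mem_range] at hj
    rw [hsupp (w - j) j, Polynomial.C_0, zero_mul]
    have : 2 * (w - j) ≤ d * (w - j) := Nat.mul_le_mul_right _ hd
    omega

lemma eq_X_of_comp_sub_pow_eq_C {F : Type*} [Field F] [CharZero F] {d : ℕ}
    (hd : 2 ≤ d) {A : F[X][X]} (hA : A.Monic) {g : F[X]} (hg : g.natDegree = A.natDegree)
    (hk : 0 < A.natDegree)
    (h : A.comp (X ^ d + Polynomial.C X) - A ^ d = Polynomial.C g) : g = X := by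
  have hk1 : A.natDegree = 1 := le_antisymm (natDegree_le_one_of_comp_sub_pow_eq_C hd hA hg h) hk
  set c := A.coeff 0 with hc
  have hAc : A = X + Polynomial.C c := hA.eq_X_add_C hk1
  have hAcomp : A.comp (X ^ d + Polynomial.C X) = X ^ d + Polynomial.C X + Polynomial.C c := by
    rw [hAc]; simp
  have hcoeff := congrArg (fun P => P.coeff (d - 1)) h
  have hd1 : d - 1 ≠ 0 := by omega
  have hc0 : c = 0 := by
    simp only [hAcomp] at hcoeff
    rw [hAc] at hcoeff
    simp only [coeff_sub, coeff_add, coeff_X_add_C_pow, coeff_C, hd1, if_false, coeff_X_pow,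
      show d - 1 ≠ d by omega, show d - (d - 1) = 1 by omega, pow_one, add_zero, zero_sub,
      neg_eq_zero] at hcoeff
    refine (mul_eq_zero.1 hcoeff).resolve_right ?_
    have : d.choose (d - 1) ≠ 0 := (Nat.choose_pos (Nat.sub_le _ _)).ne'
    exact_mod_cast this
  rw [hAcomp, hAc, hc0] at h
  simpa using h.symm

theorem dynamical_andre_oort_graph_case (d : ℕ) (hd : 2 ≤ d) (h : Polynomial ℂ)
    (hnc : 0 < h.natDegree)
    (hinf : {t : ℂ | Preperiodic (fun z => z ^ d + t) 0 ∧
      Preperiodic (fun z => z ^ d + h.eval t) 0}.Infinite) :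
    ∃ ζ : ℂ, ζ ^ (d - 1) = 1 ∧ h = Polynomial.C ζ * Polynomial.X := by
  simp only [preperiodic_iff_isPCF] at hinf
  obtain ⟨A, hA, hAk, -, n₀, hn₀⟩ := exists_criticalOrbit_eq_eval hd hnc hinf
  obtain ⟨M, hM⟩ := exists_forall_natDegree_coeff_lt
    (A.comp (X ^ d + Polynomial.C X) - A ^ d)
  set k := h.natDegree with hk
  set a := h.leadingCoeff with ha
  have ha0 : a ≠ 0 := leadingCoeff_ne_zero.2 fun h0 => by simp [hk, h0] at hnc
  have key : ∀ n, n₀ + M + k ≤ n → h = Polynomial.C (a ^ d ^ (n + 1)) * X := by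
    intro n hn
    set ε := A.comp (X ^ d + Polynomial.C X) - A ^ d with hε
    set b := a ^ d ^ (n + 1) with hb
    have hb0 : b ≠ 0 := pow_ne_zero _ ha0
    have hnd : n < d ^ n := Nat.lt_pow_self (by omega)
    have hX := criticalOrbit_natDegree_leadingCoeff hd (p := (X : ℂ[X])) (by simp) n
    rw [natDegree_X, one_mul] at hX
    have h1 := hn₀ n (by omega)
    have h2 := hn₀ (n + 1) (by omega)
    have e1 : criticalOrbit d h (n + 1 + 1) = criticalOrbit d h (n + 1) ^ d + h := rfl
    have e2 : criticalOrbit d (X : ℂ[X]) (n + 1 + 1) = criticalOrbit d X (n + 1) ^ d + X := rfl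
    set P := criticalOrbit d (X : ℂ[X]) (n + 1) with hP
    have e3 : A.eval (P ^ d + X) = A.eval P ^ d + ε.eval P := by
      simp [hε, eval_comp]
    rw [e1, e2, e3, h1, mul_pow, ← Polynomial.C_pow, ← pow_mul, ← pow_succ, ← hb, mul_add,
      add_right_inj] at h2
    have h3 : ε - Polynomial.C (Polynomial.C b⁻¹ * h) = 0 := by
      refine eq_zero_of_eval_eq_zero_of_natDegree_lt (P := P) (D := d ^ n) (fun i => ?_) hX.1 ?_
      · rw [coeff_sub]
        refine (natDegree_sub_le _ _).trans_lt (max_lt ((hM i).trans (by omega)) ?_)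
        rw [coeff_C]
        split_ifs
        · exact (natDegree_C_mul_le _ _).trans_lt (by omega)
        · rw [natDegree_zero]; omega
      · rw [eval_sub, eval_C, h2, ← mul_assoc, ← Polynomial.C_mul, inv_mul_cancel₀ hb0,
          Polynomial.C_1, one_mul, sub_self]
    have h4 := eq_X_of_comp_sub_pow_eq_C hd hA
      (by rw [natDegree_C_mul (inv_ne_zero hb0), hAk]) (by omega) (sub_eq_zero.1 h3)
    rw [← h4, ← mul_assoc, ← Polynomial.C_mul, mul_inv_cancel₀ hb0, Polynomial.C_1, one_mul]
  have hlead : ∀ n, n₀ + M + k ≤ n → a = a ^ d ^ (n + 1) := fun n hn => by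
    conv_lhs => rw [ha, key n hn]
    simp
  have h1 := hlead _ le_rfl
  have h2 := hlead (n₀ + M + k + 1) (by omega)
  rw [pow_succ, pow_mul, ← h1] at h2
  refine ⟨a, ?_, ?_⟩
  · refine mul_right_cancel₀ ha0 ?_
    rw [pow_sub_one_mul (by omega), one_mul, ← h2]
  · conv_rhs => rw [h1]
    exact key _ le_rfl
end

section
/- Let f ∈ ℂ[z] be a polynomial of degree d ≥ 2 all of whose coefficients are algebraic over ℚ, and let P, Q ∈ ℂ[z] be nonconstant polynomials all of whose coefficients are algebraic over ℚ. For t ∈ ℂ define f_t(z) = f(z) + P(t) and g_t(z) = f(z) + Q(t). Let a, b ∈ ℂ be algebraic over ℚ. If there exist infinitely many algebraic numbers t ∈ ℂ such that a is preperiodic under f_t and b is preperiodic under g_t, then for every algebraic number t ∈ ℂ, a is preperiodic under f_t if and only if b is preperiodic under g_t. -/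
open Polynomial IntermediateField

theorem exists_comp_sub_pow_degree_lt {R : Type*} [CommRing R] (F : R[X]) (d q : ℕ)
    (hd : 2 ≤ d) (hF : F.natDegree ≤ d) (w : R) (hw : w ^ d = w * F.coeff d ^ q)
    (hu : IsUnit (d * w ^ (d - 1))) :
    ∃ W : R[X], W.natDegree ≤ q ∧ W.coeff q = w ∧
      (W.comp F - W ^ d).degree < ((d - 1) * q : ℕ) := by
  suffices h : ∀ i ≤ q, ∃ W : R[X], W.natDegree ≤ q ∧ W.coeff q = w ∧
      (W.comp F - W ^ d).degree < (d * q - i : ℕ) by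
    obtain ⟨W, h1, h2, h3⟩ := h q le_rfl
    exact ⟨W, h1, h2, by rwa [Nat.sub_mul, one_mul]⟩
  intro i
  induction i with
  | zero =>
    intro _
    refine ⟨C w * X ^ q, natDegree_C_mul_X_pow_le _ _, by simp, ?_⟩
    rw [degree_lt_iff_coeff_zero]
    intro m hm
    simp only [Nat.sub_zero] at hm
    have e1 : (C w * X ^ q : R[X]).comp F = C w * F ^ q := by simp
    have e2 : (C w * X ^ q : R[X]) ^ d = C (w ^ d) * X ^ (d * q) := by
      rw [mul_pow, ← C_pow, ← pow_mul, mul_comm q d]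
    rw [e1, e2, coeff_sub, coeff_C_mul, coeff_C_mul, coeff_X_pow]
    rcases hm.eq_or_lt with rfl | hm
    · have : (F ^ q).coeff (d * q) = F.coeff d ^ q := by
        rw [mul_comm]; exact coeff_pow_of_natDegree_le hF
      simp [this, hw]
    · have : (F ^ q).coeff m = 0 := by
        apply coeff_eq_zero_of_natDegree_lt
        calc (F ^ q).natDegree ≤ q * F.natDegree := natDegree_pow_le
          _ ≤ q * d := by gcongr
          _ < m := by rwa [mul_comm]
      simp [this, hm.ne']
  | succ i ih =>
    intro hi
    obtain ⟨W, h1, h2, h3⟩ := ih (by omega)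
    obtain ⟨u, hu⟩ := hu
    set E := W.comp F - W ^ d with hE
    set v : R := ↑u⁻¹ * E.coeff (d * q - (i + 1)) with hv
    set V : R[X] := C v * X ^ (q - (i + 1)) with hV
    have hVd : V.natDegree ≤ q - (i + 1) := natDegree_C_mul_X_pow_le _ _
    have hWV : (W + V).natDegree ≤ q := natDegree_add_le_of_degree_le h1 (by omega)
    have hc : (W + V).coeff q = w := by
      rw [coeff_add, h2, coeff_eq_zero_of_natDegree_lt (p := V) (by omega), add_zero]
    refine ⟨W + V, hWV, hc, ?_⟩
    set T : R[X] := ∑ j ∈ Finset.range d, (W + V) ^ j * W ^ (d - 1 - j) with hT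
    have hterm : ∀ j ∈ Finset.range d,
        ((W + V) ^ j * W ^ (d - 1 - j)).natDegree ≤ (d - 1) * q ∧
        ((W + V) ^ j * W ^ (d - 1 - j)).coeff ((d - 1) * q) = w ^ (d - 1) := by
      intro j hj
      rw [Finset.mem_range] at hj
      have hs : (d - 1) * q = j * q + (d - 1 - j) * q := by
        rw [← add_mul]; congr 1; omega
      have a1 := natDegree_pow_le_of_le j hWV
      have a2 := natDegree_pow_le_of_le (d - 1 - j) h1
      refine ⟨by rw [hs]; exact natDegree_mul_le_of_le a1 a2, ?_⟩
      rw [hs, coeff_mul_add_eq_of_natDegree_le a1 a2, coeff_pow_of_natDegree_le hWV,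
        coeff_pow_of_natDegree_le h1, hc, h2, ← pow_add]
      congr 1; omega
    have hTd : T.natDegree ≤ (d - 1) * q := natDegree_sum_le_of_forall_le _ _ fun j hj => (hterm j hj).1
    have hTc : T.coeff ((d - 1) * q) = u := by
      rw [hT, finsetSum_coeff, Finset.sum_congr rfl fun j hj => (hterm j hj).2]
      simp [hu]
    have hpow : (W + V) ^ d - W ^ d = V * T := by
      have := (Commute.all (W + V) W).mul_geom_sum₂ d
      rw [← this, hT]; ring
    have hcomp : (W + V).comp F - (W + V) ^ d = E + C v * F ^ (q - (i + 1)) - V * T := by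
      rw [← hpow, hE, add_comp]
      have : V.comp F = C v * F ^ (q - (i + 1)) := by simp [hV]
      rw [this]; ring
    have hsum : d * q - (i + 1) = (q - (i + 1)) + (d - 1) * q := by
      have : d * q = q + (d - 1) * q := by
        conv_lhs => rw [show d = 1 + (d - 1) by omega]
        ring
      omega
    have hFd : ∀ m, d * q - (i + 1) ≤ m → (F ^ (q - (i + 1))).coeff m = 0 := by
      intro m hm
      apply coeff_eq_zero_of_natDegree_lt
      calc _ ≤ (q - (i + 1)) * F.natDegree := natDegree_pow_le
        _ ≤ (q - (i + 1)) * d := by gcongr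
        _ < m := by
          refine lt_of_lt_of_le ?_ hm
          rw [Nat.sub_mul, mul_comm q d]
          have : 2 * (i + 1) ≤ (i + 1) * d := by nlinarith
          have : (i + 1) * d ≤ d * q := by rw [mul_comm]; gcongr
          omega
    rw [degree_lt_iff_coeff_zero] at h3 ⊢
    intro m hm
    rw [hcomp, coeff_sub, coeff_add, coeff_C_mul, hFd m hm, mul_zero, add_zero]
    rcases hm.eq_or_lt with rfl | hm
    · have hVc : V.coeff (q - (i + 1)) = v := by simp [hV]
      have : (V * T).coeff (d * q - (i + 1)) = v * u := by
        rw [hsum, coeff_mul_add_eq_of_natDegree_le hVd hTd, hVc, hTc]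
      rw [this, hv, mul_right_comm, Units.inv_mul, one_mul, sub_self]
    · rw [h3 m (by omega), coeff_eq_zero_of_natDegree_lt, sub_zero]
      exact (natDegree_mul_le_of_le hVd hTd).trans_lt (by omega)

/-- The iterates of the constant polynomial `a` under `u ↦ f ∘ u + P`; the value at `t` of the
`n`-th one is the `n`-th iterate of `a` under `z ↦ f z + P t`. -/
noncomputable def orbitPoly {k : Type*} [CommRing k] (f P : k[X]) (a : k) (n : ℕ) : k[X] :=
  (fun u => f.comp u + P)^[n] (C a)

theorem orbitPoly_succ {k : Type*} [CommRing k] (f P : k[X]) (a : k) (n : ℕ) :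
    orbitPoly f P a (n + 1) = f.comp (orbitPoly f P a n) + P := by
  simp [orbitPoly, Function.iterate_succ_apply']

theorem eval_orbitPoly {k : Type*} [CommRing k] (f P : k[X]) (a t : k) (n : ℕ) :
    (orbitPoly f P a n).eval t = (fun z => f.eval z + P.eval t)^[n] a := by
  induction n with
  | zero => simp [orbitPoly]
  | succ n ih => rw [orbitPoly_succ, Function.iterate_succ_apply', ← ih]; simp [eval_comp]

theorem natDegree_orbitPoly_succ {k : Type*} [CommRing k] [IsDomain k] {f P : k[X]} (a : k)
    (hf : 2 ≤ f.natDegree) (hP : 0 < P.natDegree) (n : ℕ) :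
    (orbitPoly f P a (n + 1)).natDegree = P.natDegree * f.natDegree ^ n := by
  induction n with
  | zero => rw [orbitPoly_succ]; simp [orbitPoly]
  | succ n ih =>
    rw [orbitPoly_succ, natDegree_add_eq_left_of_natDegree_lt]
    · rw [natDegree_comp, ih]; ring
    · rw [natDegree_comp, ih]
      have := Nat.one_le_pow n f.natDegree (by omega)
      nlinarith

theorem exists_degree_eval_lt {k : Type*} [CommRing k] [IsDomain k] (V : k[X][X]) {m : ℕ}
    (hV : V.degree < m) :
    ∃ K : ℕ, ∀ u : k[X], K < u.natDegree → (V.eval u).degree < (m * u.natDegree : ℕ) := by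
  obtain ⟨K, hK⟩ : ∃ K : ℕ, ∀ i ∈ Finset.range m, (V.coeff i).natDegree ≤ K :=
    ⟨(Finset.range m).sup fun i => (V.coeff i).natDegree, fun i hi =>
      Finset.le_sup (f := fun i => (V.coeff i).natDegree) hi⟩
  refine ⟨K, fun u hu => ?_⟩
  by_cases h0 : V = 0
  · rw [h0, eval_zero, degree_zero]
    exact WithBot.bot_lt_coe _
  rw [eval_eq_sum_range' ((natDegree_lt_iff_degree_lt h0).2 hV), ← mem_degreeLT]
  refine Submodule.sum_mem _ fun i hi => ?_
  rw [mem_degreeLT]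
  refine (degree_le_natDegree).trans_lt ?_
  rw [Nat.cast_lt]
  have h1 := hK i hi
  have h2 : (V.coeff i * u ^ i).natDegree ≤ K + i * u.natDegree :=
    natDegree_mul_le_of_le h1 natDegree_pow_le
  rw [Finset.mem_range] at hi
  have : (i + 1) * u.natDegree ≤ m * u.natDegree := by gcongr; omega
  rw [add_mul] at this
  omega

theorem exists_natDegree_eval_eq {k : Type*} [CommRing k] [IsDomain k] (W : k[X][X]) {q : ℕ}
    {w : k} (hw : w ≠ 0) (hW : W.natDegree ≤ q) (hWq : W.coeff q = C w) :
    ∃ K : ℕ, ∀ u : k[X], K < u.natDegree → (W.eval u).natDegree = q * u.natDegree := by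
  have hlt : (W - C (C w) * X ^ q).degree < (q : WithBot ℕ) := by
    rw [degree_lt_iff_coeff_zero]
    intro m hm
    rcases hm.eq_or_lt with rfl | hm
    · simp [hWq]
    · rw [coeff_sub, coeff_eq_zero_of_natDegree_lt (by omega), coeff_C_mul, coeff_X_pow,
        if_neg hm.ne', mul_zero, sub_zero]
  obtain ⟨K, hK⟩ := exists_degree_eval_lt _ hlt
  refine ⟨K, fun u hu => ?_⟩
  have hu0 : u ≠ 0 := by rintro rfl; simp at hu
  have h1 := hK u hu
  have h2 : (C w * u ^ q).degree = (q * u.natDegree : ℕ) := by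
    rw [degree_mul, degree_C hw, degree_pow, degree_eq_natDegree hu0, zero_add]
    simp
  have h3 : W.eval u = (W - C (C w) * X ^ q).eval u + C w * u ^ q := by simp
  rw [h3]
  apply natDegree_eq_of_degree_eq_some
  rw [degree_add_eq_right_of_degree_lt (by rw [h2]; exact h1), h2]

theorem exists_normalized_orbitPoly {k : Type*} [Field k] [CharZero k] [IsAlgClosed k]
    {f P : k[X]} (a : k) {d q p : ℕ} (hd : 2 ≤ d) (hf : f.natDegree = d) (hP : P.natDegree = p)
    (hp : 0 < p) :
    ∃ (W : k[X][X]) (w : k) (n₀ : ℕ), w ≠ 0 ∧ W.natDegree ≤ q ∧ W.coeff q = C w ∧ ∀ n ≥ n₀,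
      (W.eval (orbitPoly f P a (n + 1))).natDegree = q * p * d ^ n ∧
      (W.eval (orbitPoly f P a (n + 2)) - (W.eval (orbitPoly f P a (n + 1))) ^ d).degree <
        ((d - 1) * (q * p * d ^ n) : ℕ) := by
  have hl : f.coeff d ≠ 0 := by
    rw [← hf]; exact leadingCoeff_ne_zero.2 (by rintro rfl; simp at hf; omega)
  obtain ⟨w, hw⟩ := IsAlgClosed.exists_pow_nat_eq (f.coeff d ^ q) (n := d - 1) (by omega)
  have hw0 : w ≠ 0 := by
    rintro rfl
    rw [zero_pow (by omega)] at hw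
    exact pow_ne_zero q hl hw.symm
  set F : k[X][X] := f.map C + C P with hF
  have hFe : ∀ u, F.eval u = f.comp u + P := by
    intro u; simp [hF, eval_map, comp]
  have hFd : F.natDegree ≤ d :=
    natDegree_add_le_of_degree_le (natDegree_map_le.trans hf.le) (by simp)
  have hFc : F.coeff d = C (f.coeff d) := by
    rw [hF, coeff_add, coeff_map, coeff_C_of_ne_zero (by omega), add_zero]
  have hd0 : (d : k) ≠ 0 := by exact_mod_cast (by omega : d ≠ 0)
  obtain ⟨W, h1, h2, h3⟩ := exists_comp_sub_pow_degree_lt F d q hd hFd (C w)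
    (by rw [hFc, ← C_pow, ← C_pow, ← hw, ← C_mul, ← pow_succ']; congr 2; omega)
    (by
      rw [← C_pow, ← C_eq_natCast, ← C_mul]
      exact (IsUnit.mk0 _ (mul_ne_zero hd0 (pow_ne_zero _ hw0))).map C)
  obtain ⟨K₁, hK₁⟩ := exists_natDegree_eval_eq W hw0 h1 h2
  obtain ⟨K₂, hK₂⟩ := exists_degree_eval_lt _ h3
  refine ⟨W, w, K₁ + K₂, hw0, h1, h2, fun n hn => ?_⟩
  have hdeg : (orbitPoly f P a (n + 1)).natDegree = p * d ^ n := by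
    rw [natDegree_orbitPoly_succ a (by omega) (by omega), hf, hP]
  have hlt : n < p * d ^ n :=
    (Nat.lt_pow_self (by omega)).trans_le (Nat.le_mul_of_pos_left _ hp)
  have e1 := hK₁ (orbitPoly f P a (n + 1)) (by omega)
  have e2 := hK₂ (orbitPoly f P a (n + 1)) (by omega)
  refine ⟨by rw [e1, hdeg, mul_assoc], ?_⟩
  rw [eval_sub, eval_comp, eval_pow, hFe, ← orbitPoly_succ, hdeg] at e2
  convert e2 using 2
  ring_nf

/-- A family of algebraic numbers with a common denominator and with uniformly bounded
conjugates. -/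
def BoundedFamily {ι k : Type*} [Field k] (x : ι → k) : Prop :=
  (∃ M : ℕ, 0 < M ∧ ∀ i, IsIntegral ℤ ((M : k) * x i)) ∧
    ∃ C : ℝ, ∀ i (σ : k →+* ℂ), ‖σ (x i)‖ ≤ C

theorem exists_nat_mul_isIntegral {k : Type*} [Field k] [CharZero k] [Algebra.IsAlgebraic ℚ k]
    (c : k) : ∃ M : ℕ, 0 < M ∧ IsIntegral ℤ ((M : k) * c) := by
  have h : IsAlgebraic ℤ c :=
    (IsFractionRing.isAlgebraic_iff ℤ ℚ k).2 (Algebra.IsAlgebraic.isAlgebraic c)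
  obtain ⟨y, hy, hi⟩ := h.exists_integral_multiple
  refine ⟨y.natAbs, by omega, ?_⟩
  rcases Int.natAbs_eq y with h | h
  · rw [h] at hi; simpa using hi
  · rw [h] at hi; simpa using hi.neg

namespace BoundedFamily

variable {ι κ k : Type*} [Field k]

theorem comp {x : ι → k} (hx : BoundedFamily x) (g : κ → ι) : BoundedFamily fun i => x (g i) := by
  obtain ⟨⟨M, h0, hM⟩, C, hC⟩ := hx
  exact ⟨⟨M, h0, fun i => hM _⟩, C, fun i => hC _⟩

theorem const [CharZero k] [Algebra.IsAlgebraic ℚ k] (c : k) :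
    BoundedFamily fun _ : ι => c := by
  obtain ⟨M, h0, hM⟩ := exists_nat_mul_isIntegral c
  refine ⟨⟨M, h0, fun _ => hM⟩, ?_⟩
  have hfin : ((fun z : ℂ => ‖z‖) '' ((minpoly ℚ c).rootSet ℂ)).Finite :=
    (rootSet_finite _ _).image _
  obtain ⟨C, hC⟩ := hfin.bddAbove
  refine ⟨C, fun _ σ => hC ⟨σ c, ?_, rfl⟩⟩
  rw [mem_rootSet]
  refine ⟨minpoly.ne_zero (Algebra.IsIntegral.isIntegral c), ?_⟩
  have := aeval_algHom_apply σ.toRatAlgHom c (minpoly ℚ c)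
  simpa using this

theorem add {x y : ι → k} (hx : BoundedFamily x) (hy : BoundedFamily y) :
    BoundedFamily fun i => x i + y i := by
  obtain ⟨⟨M, h0, hM⟩, C, hC⟩ := hx
  obtain ⟨⟨M', h0', hM'⟩, C', hC'⟩ := hy
  refine ⟨⟨M * M', by positivity, fun i => ?_⟩, C + C', fun i σ => ?_⟩
  · have e : ((M * M' : ℕ) : k) * (x i + y i) = M' * (M * x i) + M * (M' * y i) := by
      push_cast; ring
    rw [e]
    exact ((isIntegral_natCast M').mul (hM i)).add ((isIntegral_natCast M).mul (hM' i))
  · rw [map_add]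
    exact (norm_add_le _ _).trans (add_le_add (hC i σ) (hC' i σ))

theorem mul {x y : ι → k} (hx : BoundedFamily x) (hy : BoundedFamily y) :
    BoundedFamily fun i => x i * y i := by
  obtain ⟨⟨M, h0, hM⟩, C, hC⟩ := hx
  obtain ⟨⟨M', h0', hM'⟩, C', hC'⟩ := hy
  refine ⟨⟨M * M', by positivity, fun i => ?_⟩, C * C', fun i σ => ?_⟩
  · have e : ((M * M' : ℕ) : k) * (x i * y i) = (M * x i) * (M' * y i) := by
      push_cast; ring
    rw [e]
    exact (hM i).mul (hM' i)
  · rw [map_mul, norm_mul]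
    exact mul_le_mul (hC i σ) (hC' i σ) (norm_nonneg _) ((norm_nonneg _).trans (hC i σ))

variable [CharZero k] [Algebra.IsAlgebraic ℚ k]

theorem pow {x : ι → k} (hx : BoundedFamily x) (n : ℕ) : BoundedFamily fun i => x i ^ n := by
  induction n with
  | zero => simpa using const 1
  | succ n ih => simpa only [pow_succ] using ih.mul hx

theorem sub {x y : ι → k} (hx : BoundedFamily x) (hy : BoundedFamily y) :
    BoundedFamily fun i => x i - y i := by
  simpa [sub_eq_add_neg] using hx.add ((const (-1)).mul hy)

theorem eval {x : ι → k} (hx : BoundedFamily x) (p : k[X]) :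
    BoundedFamily fun i => p.eval (x i) := by
  induction p using Polynomial.induction_on' with
  | add p q hp hq => simpa using hp.add hq
  | monomial n a => simpa using (const a).mul (hx.pow n)

theorem eval_eval {t : ι → k} {u : ι → k[X]} (ht : BoundedFamily t)
    (hu : BoundedFamily fun i => (u i).eval (t i)) (W : k[X][X]) :
    BoundedFamily fun i => (W.eval (u i)).eval (t i) := by
  induction W using Polynomial.induction_on' with
  | add p q hp hq => simpa using hp.add hq
  | monomial n a => simpa using (ht.eval a).mul (hu.pow n)

end BoundedFamily

theorem isIntegral_of_pow_mem_span {J R K : Type*} [Fintype J] [CommRing R] [Field K]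
    [Algebra R K] (y : J → K) {d : ℕ}
    (h : ∀ j, y j ^ d ∈
      Submodule.span R {x | ∃ u : J → ℕ, ∑ i, u i < d ∧ x = ∏ i, y i ^ u i}) (j : J) :
    IsIntegral R (y j) := by
  classical
  set T : Submodule R K :=
    Submodule.span R (Set.range fun e : J → Fin d => ∏ i, y i ^ (e i : ℕ)) with hT
  have mem : ∀ n, ∀ u : J → ℕ, ∑ i, u i = n → ∏ i, y i ^ u i ∈ T := by
    intro n
    induction n using Nat.strong_induction_on with
    | _ n ih =>
      intro u hu
      by_cases hbox : ∀ i, u i < d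
      · exact Submodule.subset_span ⟨fun i => ⟨u i, hbox i⟩, rfl⟩
      push Not at hbox
      obtain ⟨j, hj⟩ := hbox
      set u' : J → ℕ := Function.update u j (u j - d) with hu'
      have hprod : ∏ i, y i ^ u i = (∏ i, y i ^ u' i) * y j ^ d := by
        rw [← Finset.mul_prod_erase _ _ (Finset.mem_univ j),
          ← Finset.mul_prod_erase _ (fun i => y i ^ u' i) (Finset.mem_univ j)]
        have : ∏ i ∈ Finset.univ.erase j, y i ^ u' i = ∏ i ∈ Finset.univ.erase j, y i ^ u i :=
          Finset.prod_congr rfl fun i hi => by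
            rw [hu', Function.update_of_ne (Finset.ne_of_mem_erase hi)]
        rw [this, mul_right_comm, ← pow_add, hu', Function.update_self, Nat.sub_add_cancel hj]
      have hsum : ∑ i, u' i + d = n := by
        rw [← hu, ← Finset.add_sum_erase _ _ (Finset.mem_univ j),
          ← Finset.add_sum_erase _ (fun i => u i) (Finset.mem_univ j)]
        have : ∑ i ∈ Finset.univ.erase j, u' i = ∑ i ∈ Finset.univ.erase j, u i :=
          Finset.sum_congr rfl fun i hi => by
            rw [hu', Function.update_of_ne (Finset.ne_of_mem_erase hi)]
        rw [this, hu', Function.update_self]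
        omega
      rw [hprod]
      have key : ∀ x ∈ Submodule.span R {x | ∃ u : J → ℕ, ∑ i, u i < d ∧ x = ∏ i, y i ^ u i},
          (∏ i, y i ^ u' i) * x ∈ T := by
        intro x hx
        induction hx using Submodule.span_induction with
        | mem x hx =>
          obtain ⟨v, hv, rfl⟩ := hx
          rw [← Finset.prod_mul_distrib]
          simp only [← pow_add]
          refine ih (∑ i, (u' i + v i)) ?_ (fun i => u' i + v i) rfl
          rw [Finset.sum_add_distrib]
          omega
        | zero => simp
        | add x y _ _ hx hy => rw [mul_add]; exact T.add_mem hx hy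
        | smul a x _ hx => rw [mul_smul_comm]; exact T.smul_mem _ hx
      exact key _ (h j)
  have h1 : (1 : K) ∈ T := by simpa using mem _ (fun _ => 0) rfl
  refine isIntegral_of_smul_mem_submodule T ?_ (Submodule.fg_span (Set.finite_range _)) (y j) ?_
  · intro h0; rw [h0] at h1; simp at h1
  · intro x hx
    induction hx using Submodule.span_induction with
    | mem x hx =>
      obtain ⟨e, rfl⟩ := hx
      have := mem _ (fun i => (e i : ℕ) + if i = j then 1 else 0) rfl
      have e1 : ∏ i, y i ^ (if i = j then 1 else 0) = y j := by
        rw [Finset.prod_eq_single_of_mem j (Finset.mem_univ j) fun i _ hi => by simp [hi]]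
        simp
      simp only [pow_add, Finset.prod_mul_distrib] at this
      rwa [e1, mul_comm] at this
    | zero => simp
    | add x y _ _ hx hy => rw [smul_add]; exact T.add_mem hx hy
    | smul a x _ hx => rw [smul_comm]; exact T.smul_mem _ hx

theorem IsIntegral.natCast_mul_of_dvd {k : Type*} [CommRing k] {c : k} {m n : ℕ}
    (h : IsIntegral ℤ ((m : k) * c)) (hmn : m ∣ n) : IsIntegral ℤ ((n : k) * c) := by
  obtain ⟨e, rfl⟩ := hmn
  rw [Nat.cast_mul, mul_comm (m : k), mul_assoc]
  exact (isIntegral_natCast e).mul h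

theorem isIntegral_mul_of_eval_mem_span {k J : Type*} [Field k] [Fintype J] (f : k[X])
    (hf : 0 < f.natDegree) {M : ℕ}
    (hM : ∀ i < f.natDegree, IsIntegral ℤ ((M : k) * (f.leadingCoeff⁻¹ * f.coeff i)))
    (z : J → k)
    (h : ∀ j, (M : k) ^ f.natDegree * (f.leadingCoeff⁻¹ * f.eval (z j)) ∈
      Submodule.span (integralClosure ℤ k)
        {x | ∃ u : J → ℕ, ∑ i, u i < f.natDegree ∧ x = ∏ i, ((M : k) * z i) ^ u i}) (j : J) :
    IsIntegral ℤ ((M : k) * z j) := by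
  classical
  have hl : f.leadingCoeff ≠ 0 := leadingCoeff_ne_zero.2 (by rintro rfl; simp at hf)
  suffices IsIntegral (integralClosure ℤ k) ((M : k) * z j) from isIntegral_trans _ this
  refine isIntegral_of_pow_mem_span (d := f.natDegree) (fun i => (M : k) * z i) (fun j => ?_) j
  have e : ((M : k) * z j) ^ f.natDegree =
      (M : k) ^ f.natDegree * (f.leadingCoeff⁻¹ * f.eval (z j)) -
      ∑ i ∈ Finset.range f.natDegree, ((M : k) ^ (f.natDegree - 1 - i) *
        ((M : k) * (f.leadingCoeff⁻¹ * f.coeff i))) * ((M : k) * z j) ^ i := by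
    rw [eval_eq_sum_range, Finset.sum_range_succ, mul_add, mul_add, coeff_natDegree,
      inv_mul_cancel_left₀ hl, mul_pow, add_sub_right_comm, right_eq_add, Finset.mul_sum,
      Finset.mul_sum, ← Finset.sum_sub_distrib]
    refine Finset.sum_eq_zero fun i hi => ?_
    rw [Finset.mem_range] at hi
    obtain ⟨m, hm⟩ : ∃ m, f.natDegree = m + 1 + i := ⟨f.natDegree - 1 - i, by omega⟩
    rw [hm, show m + 1 + i - 1 - i = m by omega]
    ring
  rw [e]
  refine Submodule.sub_mem _ (h j) (Submodule.sum_mem _ fun i hi => ?_)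
  rw [Finset.mem_range] at hi
  have hintegral : IsIntegral ℤ ((M : k) ^ (f.natDegree - 1 - i) *
        ((M : k) * (f.leadingCoeff⁻¹ * f.coeff i))) :=
    ((isIntegral_natCast M).pow _).mul (hM i hi)
  have := Submodule.smul_mem (Submodule.span (integralClosure ℤ k)
        {x | ∃ u : J → ℕ, ∑ i, u i < f.natDegree ∧ x = ∏ i, ((M : k) * z i) ^ u i})
      (⟨_, hintegral⟩ : integralClosure ℤ k)
      (Submodule.subset_span ⟨fun i' => if i' = j then i else 0, by simpa using hi, rfl⟩)
  rw [Finset.prod_eq_single_of_mem j (Finset.mem_univ j) fun i' _ hi' => by simp [hi']] at this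
  simpa [Algebra.smul_def] using this

section

variable {k : Type*} [Field k] [CharZero k] [Algebra.IsAlgebraic ℚ k]

theorem exists_common_denominator (s : Finset k) :
    ∃ M : ℕ, 0 < M ∧ ∀ c ∈ s, IsIntegral ℤ ((M : k) * c) := by
  choose m h0 hm using exists_nat_mul_isIntegral (k := k)
  refine ⟨∏ c ∈ s, m c, Finset.prod_pos fun c _ => h0 c, fun c hc => ?_⟩
  exact (hm c).natCast_mul_of_dvd (Finset.dvd_prod_of_mem m hc)

theorem exists_norm_le_of_norm_eval_le (f : k[X]) (hf : 0 < f.natDegree) :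
    ∃ c A : ℝ, 0 ≤ c ∧ ∀ (σ : k →+* ℂ) (z : k) (B : ℝ), 1 ≤ ‖σ z‖ →
      ‖σ (f.eval z)‖ ≤ B * ‖σ z‖ ^ (f.natDegree - 1) → ‖σ z‖ ≤ c * B + A := by
  have hl : f.leadingCoeff ≠ 0 := leadingCoeff_ne_zero.2 (by rintro rfl; simp at hf)
  obtain ⟨c, hc⟩ := (BoundedFamily.const (ι := Unit) f.leadingCoeff⁻¹).2
  choose A hA using fun i : ℕ =>
    (BoundedFamily.const (ι := Unit) (f.leadingCoeff⁻¹ * f.coeff i)).2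
  refine ⟨|c|, ∑ i ∈ Finset.range f.natDegree, |A i|, abs_nonneg _, fun σ z B hz hB => ?_⟩
  set r := ‖σ z‖
  have hr : 0 < r := by linarith
  have hB0 : 0 ≤ B := by
    by_contra! h
    have : B * r ^ (f.natDegree - 1) < 0 := mul_neg_of_neg_of_pos h (by positivity)
    linarith [norm_nonneg (σ (f.eval z))]
  have e : z ^ f.natDegree = f.leadingCoeff⁻¹ * f.eval z -
      ∑ i ∈ Finset.range f.natDegree, (f.leadingCoeff⁻¹ * f.coeff i) * z ^ i := by
    rw [eval_eq_sum_range, Finset.sum_range_succ, mul_add, coeff_natDegree,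
      inv_mul_cancel_left₀ hl, Finset.mul_sum]
    simp only [mul_assoc]
    ring
  have h1 : r ^ f.natDegree ≤ |c| * (B * r ^ (f.natDegree - 1)) +
      ∑ i ∈ Finset.range f.natDegree, |A i| * r ^ (f.natDegree - 1) := by
    have e1 : r ^ f.natDegree = ‖σ (z ^ f.natDegree)‖ := by rw [map_pow, norm_pow]
    rw [e1, e, map_sub, map_mul, map_sum]
    refine (norm_sub_le _ _).trans (add_le_add ?_ ((norm_sum_le _ _).trans
      (Finset.sum_le_sum fun i hi => ?_)))
    · rw [norm_mul]
      exact mul_le_mul ((hc () σ).trans (le_abs_self _)) hB (norm_nonneg _) (abs_nonneg _)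
    · rw [map_mul, map_pow, norm_mul, norm_pow]
      rw [Finset.mem_range] at hi
      exact mul_le_mul ((hA i () σ).trans (le_abs_self _))
        (pow_le_pow_right₀ hz (by omega)) (by positivity) (abs_nonneg _)
  rw [← Finset.sum_mul, ← mul_assoc, ← add_mul] at h1
  have h2 : r ^ f.natDegree = r * r ^ (f.natDegree - 1) := by
    rw [← pow_succ']; congr 1; omega
  rw [h2] at h1
  exact le_of_mul_le_mul_right h1 (by positivity)

theorem BoundedFamily.of_eval {ι : Type*} {x : ι → k} {f : k[X]} (hf : 0 < f.natDegree)
    (h : BoundedFamily fun i => f.eval (x i)) : BoundedFamily x := by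
  classical
  constructor
  · obtain ⟨M₁, h1, hM₁⟩ := ((const f.leadingCoeff⁻¹).mul h).1
    obtain ⟨M₂, h2, hM₂⟩ := exists_common_denominator
      ((Finset.range f.natDegree).image fun i => f.leadingCoeff⁻¹ * f.coeff i)
    refine ⟨M₁ * M₂, by positivity, fun i => ?_⟩
    refine isIntegral_mul_of_eval_mem_span (J := Unit) f hf (fun j hj => ?_) (fun _ => x i)
      (fun _ => ?_) ()
    · exact (hM₂ _ (Finset.mem_image_of_mem _ (Finset.mem_range.2 hj))).natCast_mul_of_dvd
        (dvd_mul_left _ _)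
    · have hintegral : IsIntegral ℤ
          (((M₁ * M₂ : ℕ) : k) ^ f.natDegree * (f.leadingCoeff⁻¹ * f.eval (x i))) := by
        rw [← Nat.cast_pow]
        exact (hM₁ i).natCast_mul_of_dvd ((dvd_mul_right _ _).trans (dvd_pow_self _ hf.ne'))
      have := Submodule.smul_mem (Submodule.span (integralClosure ℤ k)
          {y | ∃ u : Unit → ℕ, ∑ i, u i < f.natDegree ∧
            y = ∏ j, (((M₁ * M₂ : ℕ) : k) * x i) ^ u j})
        (⟨_, hintegral⟩ : integralClosure ℤ k)
        (Submodule.subset_span ⟨fun _ => 0, by simpa using hf, rfl⟩)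
      simpa [Algebra.smul_def] using this
  · obtain ⟨C, hC⟩ := h.2
    obtain ⟨c, A, hc, hA⟩ := exists_norm_le_of_norm_eval_le f hf
    refine ⟨max 1 (c * |C| + A), fun i σ => ?_⟩
    rcases le_total ‖σ (x i)‖ 1 with h1 | h1
    · exact h1.trans (le_max_left _ _)
    · refine (hA σ (x i) |C| h1 ?_).trans (le_max_right _ _)
      exact ((hC i σ).trans (le_abs_self _)).trans
        (le_mul_of_one_le_right (abs_nonneg _) (one_le_pow₀ h1))

theorem boundedFamily_orbit (f : k[X]) (hf : 2 ≤ f.natDegree) (a : k) :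
    BoundedFamily fun i : {c : k // (Set.range fun n => (fun z => f.eval z + c)^[n] a).Finite} × ℕ =>
      (fun z => f.eval z + i.1.1)^[i.2] a := by
  classical
  have hstep : ∀ (c : k) (n : ℕ), f.eval ((fun z => f.eval z + c)^[n] a) =
      (fun z => f.eval z + c)^[n + 1] a - ((fun z => f.eval z + c)^[1] a - f.eval a) := by
    intro c n
    rw [Function.iterate_succ_apply']
    simp
  constructor
  · obtain ⟨M, h0, hM⟩ := exists_common_denominator
      (insert (f.leadingCoeff⁻¹) (insert (f.leadingCoeff⁻¹ * f.eval a)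
        ((Finset.range f.natDegree).image fun i => f.leadingCoeff⁻¹ * f.coeff i)))
    refine ⟨M, h0, ?_⟩
    rintro ⟨⟨c, hc⟩, n⟩
    have : Fintype (Set.range fun n => (fun z => f.eval z + c)^[n] a) := hc.fintype
    refine isIntegral_mul_of_eval_mem_span
      (J := Set.range fun n => (fun z => f.eval z + c)^[n] a) f (by omega) (fun j hj => ?_)
      (fun j => j.1) ?_ ⟨_, n, rfl⟩
    · exact hM _ (Finset.mem_insert_of_mem (Finset.mem_insert_of_mem
        (Finset.mem_image_of_mem _ (Finset.mem_range.2 hj))))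
    rintro ⟨_, m, rfl⟩
    set T := Submodule.span (integralClosure ℤ k)
        {x | ∃ u : (Set.range fun n => (fun z => f.eval z + c)^[n] a) → ℕ,
          ∑ i, u i < f.natDegree ∧ x = ∏ i, ((M : k) * i.1) ^ u i} with hT
    have hsmul : ∀ r x : k, IsIntegral ℤ r → x ∈ T → r * x ∈ T := by
      intro r x hr hx
      exact T.smul_mem (⟨r, hr⟩ : integralClosure ℤ k) hx
    have hone : (1 : k) ∈ T :=
      Submodule.subset_span ⟨fun _ => 0, by rw [Finset.sum_const_zero]; omega, by simp⟩
    have hmem : ∀ n, (M : k) * (fun z => f.eval z + c)^[n] a ∈ T := by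
      intro n
      refine Submodule.subset_span
        ⟨fun i => if i = ⟨_, n, rfl⟩ then 1 else 0, ?_, ?_⟩
      · rw [Finset.sum_ite_eq' Finset.univ]
        rw [if_pos (Finset.mem_univ _)]; omega
      · rw [Finset.prod_eq_single_of_mem
          (⟨_, n, rfl⟩ : Set.range fun n => (fun z => f.eval z + c)^[n] a) (Finset.mem_univ _)
          fun i _ hi => by simp [hi]]
        simp
    have hl1 : IsIntegral ℤ ((M : k) * f.leadingCoeff⁻¹) := hM _ (Finset.mem_insert_self _ _)
    have hl2 : IsIntegral ℤ ((M : k) * (f.leadingCoeff⁻¹ * f.eval a)) :=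
      hM _ (Finset.mem_insert_of_mem (Finset.mem_insert_self _ _))
    obtain ⟨e, he⟩ : ∃ e, f.natDegree = e + 2 := ⟨f.natDegree - 2, by omega⟩
    have hpow : ∀ m, IsIntegral ℤ ((M : k) ^ m) := fun m => (isIntegral_natCast M).pow m
    have hr1 := (hpow e).mul hl1
    have hr2 := (hpow (e + 1)).mul hl2
    have heq : (M : k) ^ f.natDegree * (f.leadingCoeff⁻¹ *
          f.eval ((fun z => f.eval z + c)^[m] a)) =
        ((M : k) ^ e * (M * f.leadingCoeff⁻¹)) * (M * (fun z => f.eval z + c)^[m + 1] a) -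
        ((M : k) ^ e * (M * f.leadingCoeff⁻¹)) * (M * (fun z => f.eval z + c)^[1] a) +
        ((M : k) ^ (e + 1) * (M * (f.leadingCoeff⁻¹ * f.eval a))) * 1 := by
      rw [hstep, he]; ring
    change (M : k) ^ f.natDegree * (f.leadingCoeff⁻¹ *
          f.eval ((fun z => f.eval z + c)^[m] a)) ∈ T
    rw [heq]
    exact T.add_mem (T.sub_mem (hsmul _ _ hr1 (hmem _)) (hsmul _ _ hr1 (hmem _)))
      (hsmul _ _ hr2 hone)
  · obtain ⟨c₀, A, hc₀, hA⟩ := exists_norm_le_of_norm_eval_le f (by omega)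
    obtain ⟨C, hC⟩ := (BoundedFamily.const (ι := Unit) (f.eval a)).2
    refine ⟨max 1 (c₀ * (2 + |C|) + A), ?_⟩
    rintro ⟨⟨c, hc⟩, n⟩ σ
    obtain ⟨_, ⟨⟨m, rfl⟩, hm⟩⟩ := Set.exists_max_image _ (fun z => ‖σ z‖) hc ⟨_, 0, rfl⟩
    have hm' : ∀ n, ‖σ ((fun z => f.eval z + c)^[n] a)‖ ≤ ‖σ ((fun z => f.eval z + c)^[m] a)‖ :=
      fun n => hm _ ⟨n, rfl⟩
    refine (hm' n).trans ?_
    rcases le_total ‖σ ((fun z => f.eval z + c)^[m] a)‖ 1 with h1 | h1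
    · exact h1.trans (le_max_left _ _)
    · refine (hA σ _ (2 + |C|) h1 ?_).trans (le_max_right _ _)
      rw [hstep, map_sub, map_sub]
      have h2 := norm_sub_le (σ ((fun z => f.eval z + c)^[m + 1] a))
        (σ ((fun z => f.eval z + c)^[1] a) - σ (f.eval a))
      have h3 := norm_sub_le (σ ((fun z => f.eval z + c)^[1] a)) (σ (f.eval a))
      have h4 := hm' (m + 1)
      have h5 := hm' 1
      have h6 := (hC () σ).trans (le_abs_self _)
      have h7 : ‖σ ((fun z => f.eval z + c)^[m] a)‖ ≤
          ‖σ ((fun z => f.eval z + c)^[m] a)‖ ^ (f.natDegree - 1) :=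
        le_self_pow₀ h1 (by omega)
      nlinarith [abs_nonneg C]

end

theorem det_pow_mul_eval_pow {k : Type*} [Field k] (G : k[X]) (hG : 0 < G.natDegree) {N : ℕ}
    (v : Fin N → k) :
    (Matrix.of fun i j : Fin N => v i ^ ((j : ℕ) % G.natDegree) *
      G.eval (v i) ^ ((j : ℕ) / G.natDegree)).det =
    G.leadingCoeff ^ (∑ j ∈ Finset.range N, j / G.natDegree) * (Matrix.vandermonde v).det := by
  have hl : G.leadingCoeff ≠ 0 := leadingCoeff_ne_zero.2 (by rintro rfl; simp at hG)
  set G' : k[X] := C G.leadingCoeff⁻¹ * G with hG'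
  have hmon : G'.Monic := by
    rw [hG', Monic, leadingCoeff_mul, leadingCoeff_C, inv_mul_cancel₀ hl]
  have hdeg : G'.natDegree = G.natDegree := by
    rw [hG', natDegree_C_mul (inv_ne_zero hl)]
  set p : Fin N → k[X] := fun j => X ^ ((j : ℕ) % G.natDegree) * G' ^ ((j : ℕ) / G.natDegree)
    with hp
  have hpmon : ∀ j, (p j).Monic := fun j => (monic_X_pow _).mul (hmon.pow _)
  have hpdeg : ∀ j, (p j).natDegree = j := by
    intro j
    rw [hp, (monic_X_pow _).natDegree_mul (hmon.pow _), natDegree_X_pow, hmon.natDegree_pow, hdeg,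
      mul_comm, Nat.mod_add_div]
  have hv := Matrix.det_eval_matrixOfPolynomials_eq_det_vandermonde v p hpdeg hpmon
  rw [hv, Finset.sum_range fun j => j / G.natDegree, ← Finset.prod_pow_eq_pow_sum,
    ← Matrix.det_mul_row]
  congr 1
  ext i j
  simp only [Matrix.of_apply, hp, hG', eval_mul, eval_pow, eval_X, eval_C]
  rw [mul_left_comm, ← mul_pow, mul_inv_cancel_left₀ hl]

theorem norm_det_le_factorial_mul_prod {n : ℕ} (A : Matrix (Fin n) (Fin n) ℂ) (b : Fin n → ℝ)
    (h : ∀ i j, ‖A i j‖ ≤ b j) : ‖A.det‖ ≤ n.factorial * ∏ j, b j := by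
  rw [Matrix.det_apply]
  refine (norm_sum_le _ _).trans ?_
  calc ∑ s : Equiv.Perm (Fin n), ‖Equiv.Perm.sign s • ∏ i, A (s i) i‖
      ≤ ∑ s : Equiv.Perm (Fin n), ∏ j, b j := Finset.sum_le_sum fun s _ => by
        have : ‖Equiv.Perm.sign s • ∏ i, A (s i) i‖ = ∏ i, ‖A (s i) i‖ := by
          rcases Int.units_eq_one_or (Equiv.Perm.sign s) with h | h <;> simp [h]
        rw [this]
        exact Finset.prod_le_prod (fun _ _ => norm_nonneg _) fun i _ => h _ _
    _ = n.factorial * ∏ j, b j := by simp [Fintype.card_perm]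

theorem isIntegral_pow_mul_vandermonde {k : Type*} [Field k] {G : k[X]} (hG : 0 < G.natDegree)
    {N M : ℕ} {v : Fin N → k} (hv : ∀ i, IsIntegral ℤ ((M : k) * v i))
    (hGv : ∀ i, IsIntegral ℤ ((M : k) * G.eval (v i))) :
    IsIntegral ℤ ((M : k) ^ ((G.natDegree + N / G.natDegree) * N) *
      (G.leadingCoeff ^ (∑ j ∈ Finset.range N, j / G.natDegree) *
        (Matrix.vandermonde v).det)) := by
  rw [← det_pow_mul_eval_pow G hG, pow_mul]
  have hdet := Matrix.det_smul (Matrix.of fun i j : Fin N => v i ^ ((j : ℕ) % G.natDegree) *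
      G.eval (v i) ^ ((j : ℕ) / G.natDegree)) ((M : k) ^ (G.natDegree + N / G.natDegree))
  rw [Fintype.card_fin] at hdet
  rw [← hdet]
  refine IsIntegral.det fun i j => ?_
  rw [Matrix.smul_apply, Matrix.of_apply, smul_eq_mul]
  have h1 : (j : ℕ) % G.natDegree ≤ G.natDegree := (Nat.mod_lt _ hG).le
  have h2 : (j : ℕ) / G.natDegree ≤ N / G.natDegree := Nat.div_le_div_right j.2.le
  obtain ⟨e, he⟩ := Nat.exists_eq_add_of_le (add_le_add h1 h2)
  have : (M : k) ^ (G.natDegree + N / G.natDegree) *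
      (v i ^ ((j : ℕ) % G.natDegree) * G.eval (v i) ^ ((j : ℕ) / G.natDegree)) =
      (M : k) ^ e * ((M * v i) ^ ((j : ℕ) % G.natDegree) *
        (M * G.eval (v i)) ^ ((j : ℕ) / G.natDegree)) := by
    rw [he]; ring
  rw [this]
  exact ((isIntegral_natCast M).pow e).mul (((hv i).pow _).mul ((hGv i).pow _))

theorem norm_pow_mul_vandermonde_le {k : Type*} [Field k] {G : k[X]} (hG : 0 < G.natDegree)
    {N : ℕ} {v : Fin N → k} (σ : k →+* ℂ) {A B : ℝ} (hA : 1 ≤ A) (hv : ∀ i, ‖σ (v i)‖ ≤ A)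
    (hGv : ∀ i, ‖σ (G.eval (v i))‖ ≤ B) :
    ‖σ (G.leadingCoeff ^ (∑ j ∈ Finset.range N, j / G.natDegree) *
        (Matrix.vandermonde v).det)‖ ≤
      N.factorial * (A ^ (G.natDegree * N) *
        B ^ (∑ j ∈ Finset.range N, j / G.natDegree)) := by
  rw [← det_pow_mul_eval_pow G hG, RingHom.map_det]
  refine (norm_det_le_factorial_mul_prod _
    (fun j => A ^ G.natDegree * B ^ ((j : ℕ) / G.natDegree)) fun i j => ?_).trans ?_
  · simp only [RingHom.mapMatrix_apply, Matrix.map_apply, Matrix.of_apply, map_mul, map_pow,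
      norm_mul, norm_pow]
    refine mul_le_mul ?_ (pow_le_pow_left₀ (norm_nonneg _) (hGv i) _) (by positivity)
      (by positivity)
    exact (pow_le_pow_left₀ (norm_nonneg _) (hv i) _).trans
      (pow_le_pow_right₀ hA (Nat.mod_lt _ hG).le)
  · rw [Finset.prod_mul_distrib, Finset.prod_const, Finset.card_univ, Fintype.card_fin, ← pow_mul,
      Finset.prod_pow_eq_pow_sum, Finset.sum_range fun j => j / G.natDegree]

theorem sq_le_sum_div (N : ℕ) {g : ℕ} (hg : 0 < g) :
    N * N ≤ 2 * g * (∑ j ∈ Finset.range N, j / g) + (2 * g + 1) * N := by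
  induction N with
  | zero => simp
  | succ N ih =>
    rw [Finset.sum_range_succ]
    have h1 := Nat.div_add_mod N g
    have h2 := Nat.mod_lt N hg
    nlinarith

theorem exists_ringHom_extension {K k : Type*} [Field K] [Field k] [Algebra K k]
    [Algebra.IsAlgebraic K k] (φ : K →+* ℂ) : ∃ σ : k →+* ℂ, ∀ x, σ (algebraMap K k x) = φ x := by
  let _ := φ.toAlgebra
  let τ : k →ₐ[K] ℂ := IsAlgClosed.lift
  exact ⟨τ, fun x => τ.commutes x⟩

theorem exists_one_le_norm_conj {k : Type*} [Field k] [CharZero k] [Algebra.IsAlgebraic ℚ k]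
    {x : k} (hx : IsIntegral ℤ x) (h0 : x ≠ 0) : ∃ σ : k →+* ℂ, 1 ≤ ‖σ x‖ := by
  by_contra! h
  have hxQ : IsIntegral ℚ x := Algebra.IsIntegral.isIntegral x
  have : FiniteDimensional ℚ ℚ⟮x⟯ := adjoin.finiteDimensional hxQ
  have : NumberField ℚ⟮x⟯ := {}
  set y : ℚ⟮x⟯ := AdjoinSimple.gen ℚ x with hy
  have hyx : algebraMap ℚ⟮x⟯ k y = x := AdjoinSimple.algebraMap_gen ℚ x
  have hlt : ∀ φ : ℚ⟮x⟯ →+* ℂ, ‖φ y‖ < 1 := by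
    intro φ
    obtain ⟨σ, hσ⟩ := exists_ringHom_extension (k := k) φ
    rw [← hσ, hyx]
    exact h σ
  have hyint : IsIntegral ℤ y :=
    (isIntegral_algebraMap_iff (algebraMap ℚ⟮x⟯ k).injective).1 (by rwa [hyx])
  have hy0 : y ≠ 0 := by
    intro h; rw [h, map_zero] at hyx; exact h0 hyx.symm
  obtain ⟨n, hn, hn1⟩ := NumberField.Embeddings.pow_eq_one_of_norm_le_one ℚ⟮x⟯ ℂ hy0 hyint
    fun φ => (hlt φ).le
  obtain ⟨φ⟩ : Nonempty (ℚ⟮x⟯ →+* ℂ) := inferInstance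
  have h1 : ‖φ y‖ ^ n < 1 := pow_lt_one₀ (norm_nonneg _) (hlt φ) hn.ne'
  rw [← norm_pow, ← map_pow, hn1] at h1
  simp at h1

theorem mulHeight₁_div_le {K : Type*} [Field K] [NumberField K] {x y : K} (hx : IsIntegral ℤ x)
    (hy : IsIntegral ℤ y) (hy0 : y ≠ 0) {B : ℝ} (hxB : ∀ φ : K →+* ℂ, ‖φ x‖ ≤ B)
    (hyB : ∀ φ : K →+* ℂ, ‖φ y‖ ≤ B) :
    Height.mulHeight₁ (x / y) ≤ B ^ Module.finrank ℚ K := by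
  rw [Height.mulHeight₁_div_eq_mulHeight, NumberField.mulHeight_eq (by
    intro h; exact hy0 (congrFun h 1))]
  have hfin : ∀ z : K, IsIntegral ℤ z → ∀ v : NumberField.FinitePlace K, v z ≤ 1 := by
    intro z hz v
    rw [← NumberField.FinitePlace.norm_embedding_eq]
    exact NumberField.FinitePlace.norm_le_one (R := NumberField.RingOfIntegers K) K _ ⟨z, hz⟩
  have h2 : ∏ᶠ v : NumberField.FinitePlace K, ⨆ i, v (![x, y] i) ≤ 1 := by
    refine (finprod_induction (fun r : ℝ => 0 ≤ r ∧ r ≤ 1) ⟨zero_le_one, le_rfl⟩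
      (fun a b ha hb => ⟨mul_nonneg ha.1 hb.1, mul_le_one₀ ha.2 hb.1 hb.2⟩) fun v => ?_).2
    refine ⟨Real.iSup_nonneg fun i => apply_nonneg v _, ciSup_le fun i => ?_⟩
    fin_cases i
    · exact hfin x hx v
    · exact hfin y hy v
  have h3 : ∏ v : NumberField.InfinitePlace K, (⨆ i, v (![x, y] i)) ^ v.mult ≤
      B ^ Module.finrank ℚ K := by
    rw [← NumberField.InfinitePlace.sum_mult_eq, ← Finset.prod_pow_eq_pow_sum]
    refine Finset.prod_le_prod (fun v _ => pow_nonneg (Real.iSup_nonneg fun i =>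
      apply_nonneg v _) _) fun v _ => ?_
    refine pow_le_pow_left₀ (Real.iSup_nonneg fun i => apply_nonneg v _) (ciSup_le fun i => ?_) _
    rw [← NumberField.InfinitePlace.norm_embedding_eq]
    fin_cases i
    · exact hxB _
    · exact hyB _
  have h4 : 0 ≤ B ^ Module.finrank ℚ K :=
    le_trans (Finset.prod_nonneg fun v _ => pow_nonneg (Real.iSup_nonneg fun i =>
      apply_nonneg v _) _) h3
  calc _ ≤ B ^ Module.finrank ℚ K * 1 := mul_le_mul h3 h2 (finprod_nonneg fun v =>
        Real.iSup_nonneg fun i => apply_nonneg v _) h4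
    _ = _ := mul_one _

theorem norm_conj_algebraNorm_le {K L k : Type*} [Field K] [CharZero K] [Field L] [Field k]
    [Algebra K L] [FiniteDimensional K L] [Algebra L k] [Algebra.IsAlgebraic L k] (x : L) {B : ℝ}
    (hB : ∀ σ : k →+* ℂ, ‖σ (algebraMap L k x)‖ ≤ B) (φ : K →+* ℂ) :
    ‖φ (Algebra.norm K x)‖ ≤ B ^ Module.finrank K L := by
  let _ := φ.toAlgebra
  have h : φ (Algebra.norm K x) = ∏ τ : L →ₐ[K] ℂ, τ x := Algebra.norm_eq_prod_embeddings K ℂ x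
  rw [h, norm_prod, ← AlgHom.card K L ℂ]
  calc ∏ τ : L →ₐ[K] ℂ, ‖τ x‖ ≤ ∏ _τ : L →ₐ[K] ℂ, B :=
        Finset.prod_le_prod (fun _ _ => norm_nonneg _) fun τ _ => by
          obtain ⟨σ, hσ⟩ := exists_ringHom_extension (k := k) (τ : L →+* ℂ)
          have := hB σ
          rw [hσ] at this
          exact this
    _ = B ^ Fintype.card (L →ₐ[K] ℂ) := by rw [Finset.prod_const, Finset.card_univ]

theorem mulHeight₁_pow_le {K k : Type*} [Field K] [NumberField K] [Field k] [Algebra K k]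
    [Algebra.IsAlgebraic K k] (y : K) {w : k} {s : ℕ} {B : ℝ}
    (hw : IsIntegral ℤ w) (hw0 : w ≠ 0) (hyw : IsIntegral ℤ (algebraMap K k y ^ s * w))
    (hB0 : 0 ≤ B) (hwB : ∀ σ : k →+* ℂ, ‖σ w‖ ≤ B)
    (hywB : ∀ σ : k →+* ℂ, ‖σ (algebraMap K k y ^ s * w)‖ ≤ B) :
    Height.mulHeight₁ y ^ s ≤ B ^ Module.finrank ℚ K := by
  have hwK : IsIntegral K w := Algebra.IsIntegral.isIntegral w
  have : FiniteDimensional K K⟮w⟯ := adjoin.finiteDimensional hwK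
  set r := Module.finrank K K⟮w⟯ with hr
  have hr0 : r ≠ 0 := (Module.finrank_pos (R := K) (M := K⟮w⟯)).ne'
  set v : K⟮w⟯ := AdjoinSimple.gen K w with hv
  have hvw : algebraMap K⟮w⟯ k v = w := AdjoinSimple.algebraMap_gen K w
  set u : K⟮w⟯ := algebraMap K K⟮w⟯ (y ^ s) * v with hu
  have huw : algebraMap K⟮w⟯ k u = algebraMap K k y ^ s * w := by
    rw [hu, map_mul, hvw, ← IsScalarTower.algebraMap_apply, map_pow]
  have hvint : IsIntegral ℤ v :=
    (isIntegral_algebraMap_iff (algebraMap K⟮w⟯ k).injective).1 (by rwa [hvw])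
  have huint : IsIntegral ℤ u :=
    (isIntegral_algebraMap_iff (algebraMap K⟮w⟯ k).injective).1 (by rwa [huw])
  have hv0 : v ≠ 0 := by
    intro h; rw [h, map_zero] at hvw; exact hw0 hvw.symm
  have hnu : Algebra.norm K u = (y ^ s) ^ r * Algebra.norm K v := by
    rw [hu, map_mul, Algebra.norm_algebraMap]
  have hnv : Algebra.norm K v ≠ 0 := Algebra.norm_ne_zero_iff.2 hv0
  have : Algebra.IsAlgebraic K⟮w⟯ k := Algebra.IsAlgebraic.tower_top (K := K) K⟮w⟯
  have key := mulHeight₁_div_le (Algebra.isIntegral_norm K huint) (Algebra.isIntegral_norm K hvint)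
    hnv (B := B ^ r)
    (norm_conj_algebraNorm_le (k := k) u (by rwa [huw]))
    (norm_conj_algebraNorm_le (k := k) v (by rwa [hvw]))
  rw [hnu, mul_div_cancel_right₀ _ hnv, Height.mulHeight₁_pow, Height.mulHeight₁_pow, pow_right_comm B]
    at key
  exact (pow_le_pow_iff_left₀ (pow_nonneg (Height.mulHeight₁_nonneg _) _)
    (pow_nonneg hB0 _) hr0).1 key

theorem exists_pow_eq_one_of_mulHeight₁ {K : Type*} [Field K] [NumberField K] {y : K}
    (hy0 : y ≠ 0) (h : Height.mulHeight₁ y = 1) : ∃ n, 0 < n ∧ y ^ n = 1 := by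
  obtain ⟨a, -, b, -, hab, he⟩ := Set.infinite_univ.exists_ne_map_eq_of_mapsTo
    (f := fun n : ℕ => y ^ n) (t := {x : K | Height.mulHeight₁ x ≤ 1})
    (fun n _ => by simp [Height.mulHeight₁_pow, h])
    (NumberField.finite_setOfPred_mulHeight₁_le K 1)
  wlog hlt : a < b generalizing a b
  · exact this b a hab.symm he.symm (by omega)
  refine ⟨b - a, by omega, ?_⟩
  have he' : y ^ a = y ^ b := he
  have h1 : y ^ a * y ^ (b - a) = y ^ a * 1 := by
    rw [← pow_add, Nat.add_sub_cancel' hlt.le, mul_one, he']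
  exact mul_left_cancel₀ (pow_ne_zero _ hy0) h1

/-- Polynomials of degree `N * d ^ n` that satisfy `X (n + 1) = X n ^ d` up to an error of low
degree. -/
structure NearPower {k : Type*} [Field k] (d N : ℕ) (X : ℕ → k[X]) : Prop where
  natDegree_eq : ∀ n, (X n).natDegree = N * d ^ n
  degree_lt : ∀ n, (X (n + 1) - X n ^ d).degree < ((d - 1) * (N * d ^ n) : ℕ)

namespace NearPower

variable {k : Type*} [Field k] {d N : ℕ} {X Y : ℕ → k[X]}

theorem natDegree_pos (h : NearPower d N X) (hd : 2 ≤ d) (hN : 0 < N) (n : ℕ) :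
    0 < (X n).natDegree := by
  rw [h.natDegree_eq]; positivity

theorem ne_zero (h : NearPower d N X) (hd : 2 ≤ d) (hN : 0 < N) (n : ℕ) : X n ≠ 0 :=
  ne_zero_of_natDegree_gt (h.natDegree_pos hd hN n)

theorem leadingCoeff_eq (h : NearPower d N X) (hd : 2 ≤ d) (hN : 0 < N) (n : ℕ) :
    (X n).leadingCoeff = (X 0).leadingCoeff ^ d ^ n := by
  induction n with
  | zero => simp
  | succ n ih =>
    have hdeg : (X n ^ d).degree = ((d * (N * d ^ n) : ℕ) : WithBot ℕ) := by
      rw [degree_eq_natDegree (pow_ne_zero _ (h.ne_zero hd hN n)), natDegree_pow, h.natDegree_eq]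
    have hlt : (X (n + 1) - X n ^ d).degree < (X n ^ d).degree := by
      refine (h.degree_lt n).trans_le ?_
      rw [hdeg]
      exact_mod_cast Nat.mul_le_mul_right _ (Nat.sub_le _ _)
    have := leadingCoeff_add_of_degree_lt hlt
    rw [sub_add_cancel] at this
    rw [this, leadingCoeff_pow, ih, ← pow_mul, pow_succ]

theorem comp_C_mul_X (h : NearPower d N X) {u : k} (hu : u ≠ 0) :
    NearPower d N fun n => (X n).comp (C u * Polynomial.X) where
  natDegree_eq n := by
    rw [natDegree_comp, natDegree_C_mul_X _ hu, mul_one, h.natDegree_eq]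
  degree_lt n := by
    rw [← pow_comp, ← sub_comp]
    refine lt_of_le_of_lt ?_ (h.degree_lt n)
    by_cases h0 : X (n + 1) - X n ^ d = 0
    · simp [h0]
    rw [degree_eq_natDegree h0]
    refine degree_le_natDegree.trans ?_
    rw [natDegree_comp, natDegree_C_mul_X _ hu, mul_one]

theorem C_pow_mul (h : NearPower d N X) {c : k} (hc : c ≠ 0) :
    NearPower d N fun n => C (c ^ d ^ n) * X n where
  natDegree_eq n := by
    rw [natDegree_C_mul (pow_ne_zero _ hc), h.natDegree_eq]
  degree_lt n := by
    have : C (c ^ d ^ (n + 1)) * X (n + 1) - (C (c ^ d ^ n) * X n) ^ d =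
        C (c ^ d ^ (n + 1)) * (X (n + 1) - X n ^ d) := by
      rw [mul_pow, ← C_pow, ← pow_mul, ← pow_succ, mul_sub]
    rw [this, degree_C_mul (pow_ne_zero _ hc)]
    exact h.degree_lt n

end NearPower

theorem sum_div_le_cube (D : ℕ) : ∑ j ∈ Finset.range (D ^ 2), j / D ≤ D ^ 3 := by
  calc ∑ j ∈ Finset.range (D ^ 2), j / D ≤ ∑ _j ∈ Finset.range (D ^ 2), D :=
        Finset.sum_le_sum fun j hj => by
          rw [Finset.mem_range, sq] at hj
          exact (Nat.div_lt_of_lt_mul hj).le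
    _ = D ^ 3 := by simp; ring

theorem factorial_sq_le (D : ℕ) : ((D ^ 2).factorial : ℝ) ≤ 2 ^ (2 * D ^ 3) := by
  have h : (D ^ 2).factorial ≤ 2 ^ (2 * D ^ 3) := by
    calc (D ^ 2).factorial ≤ (D ^ 2) ^ D ^ 2 := Nat.factorial_le_pow _
      _ ≤ ((2 ^ D) ^ 2) ^ D ^ 2 := by gcongr; exact Nat.lt_two_pow_self.le
      _ = 2 ^ (2 * D ^ 3) := by rw [← pow_mul, ← pow_mul]; congr 1; ring
  exact_mod_cast h

theorem exists_le_two_pow (x : ℝ) : ∃ c₀ : ℕ, ∀ c ≥ c₀, x ≤ 2 ^ c := by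
  obtain ⟨n, hn⟩ := pow_unbounded_of_one_lt x (one_lt_two (α := ℝ))
  exact ⟨n, fun c hc => hn.le.trans (pow_le_pow_right₀ one_le_two hc)⟩

theorem BoundedFamily.exists_vandermonde_bound {ι κ k : Type*} [Field k] {t : ι → k}
    {G : κ → k[X]} (ht : BoundedFamily t)
    (hG : BoundedFamily fun i : ι × κ => (G i.2).eval (t i.1)) :
    ∃ M₀ : ℕ, 0 < M₀ ∧ ∀ M : ℕ, M₀ ∣ M → ∃ c : ℕ, ∀ n D, (G n).natDegree = D → 0 < D →
      ∀ v : Fin (D ^ 2) → ι,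
      let w : k := (M : k) ^ (2 * D ^ 3) * ((G n).leadingCoeff ^
        (∑ j ∈ Finset.range (D ^ 2), j / D) * (Matrix.vandermonde fun i => t (v i)).det)
      IsIntegral ℤ w ∧ ∀ σ : k →+* ℂ, ‖σ w‖ ≤ 2 ^ (c * D ^ 3) := by
  obtain ⟨⟨M₁, hM₁, hi₁⟩, C₁, hC₁⟩ := ht
  obtain ⟨⟨M₂, hM₂, hi₂⟩, C₂, hC₂⟩ := hG
  refine ⟨M₁ * M₂, Nat.mul_pos hM₁ hM₂, fun M hM => ?_⟩
  obtain ⟨a₁, h₁⟩ := exists_le_two_pow C₁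
  obtain ⟨a₂, h₂⟩ := exists_le_two_pow C₂
  obtain ⟨a₃, h₃⟩ := exists_le_two_pow M
  set c := max a₁ (max a₂ a₃)
  have hc₁ := h₁ c (by simp [c])
  have hc₂ := h₂ c (by simp [c])
  have hc₃ := h₃ c (by simp [c])
  refine ⟨4 * c + 2, fun n D hD hD0 v => ?_⟩
  have hn : 0 < (G n).natDegree := by rwa [hD]
  refine ⟨?_, fun σ => ?_⟩
  · have := isIntegral_pow_mul_vandermonde (M := M) hn (v := fun i => t (v i))
      (fun i => (hi₁ (v i)).natCast_mul_of_dvd ((Dvd.intro _ rfl).trans hM))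
      (fun i => (hi₂ (v i, n)).natCast_mul_of_dvd ((Dvd.intro_left _ rfl).trans hM))
    rw [hD] at this
    convert this using 3
    rw [sq, Nat.mul_div_cancel _ hD0]
    ring
  · have hA : (1 : ℝ) ≤ 2 ^ c := one_le_pow₀ one_le_two
    have := norm_pow_mul_vandermonde_le hn σ hA (v := fun i => t (v i))
      (fun i => (hC₁ (v i) σ).trans hc₁) (fun i => (hC₂ (v i, n) σ).trans hc₂)
    rw [hD] at this
    rw [map_mul, norm_mul, map_pow, norm_pow, map_natCast, Complex.norm_natCast]
    calc _ ≤ ((2 : ℝ) ^ c) ^ (2 * D ^ 3) * (2 ^ (2 * D ^ 3) * ((2 ^ c) ^ (D * D ^ 2) *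
          (2 ^ c) ^ D ^ 3)) := by
          gcongr
          refine this.trans ?_
          gcongr
          · exact factorial_sq_le D
          · exact sum_div_le_cube D
      _ = 2 ^ ((4 * c + 2) * D ^ 3) := by
          simp only [← pow_mul, ← pow_add]
          congr 1
          ring

theorem NearPower.exists_pow_leadingCoeff_eq_one {ι k : Type*} [Infinite ι] [Field k] [CharZero k]
    [Algebra.IsAlgebraic ℚ k] {d N : ℕ} {X Y : ℕ → k[X]} (hX : NearPower d N X)
    (hY : NearPower d N Y) (hd : 2 ≤ d) (hN : 0 < N) (hX1 : (X 0).leadingCoeff = 1) {t : ι → k}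
    (htinj : Function.Injective t) (ht : BoundedFamily t)
    (hXt : BoundedFamily fun i : ι × ℕ => (X i.2).eval (t i.1))
    (hYt : BoundedFamily fun i : ι × ℕ => (Y i.2).eval (t i.1)) :
    ∃ m, 0 < m ∧ (Y 0).leadingCoeff ^ m = 1 := by
  set y := (Y 0).leadingCoeff with hy
  have hy0 : y ≠ 0 := leadingCoeff_ne_zero.2 (hY.ne_zero hd hN 0)
  have : FiniteDimensional ℚ ℚ⟮y⟯ :=
    adjoin.finiteDimensional (Algebra.IsIntegral.isIntegral y)
  have : NumberField ℚ⟮y⟯ := {}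
  have : Algebra.IsAlgebraic ℚ⟮y⟯ k := Algebra.IsAlgebraic.tower_top (K := ℚ) ℚ⟮y⟯
  set z : ℚ⟮y⟯ := AdjoinSimple.gen ℚ y
  have hzy : algebraMap ℚ⟮y⟯ k z = y := AdjoinSimple.algebraMap_gen ℚ y
  have hz0 : z ≠ 0 := by
    intro h; rw [h, map_zero] at hzy; exact hy0 hzy.symm
  suffices hH : Height.mulHeight₁ z = 1 by
    obtain ⟨m, hm, h⟩ := exists_pow_eq_one_of_mulHeight₁ hz0 hH
    exact ⟨m, hm, by rw [← hzy, ← map_pow, h, map_one]⟩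
  by_contra hH
  have hH1 : 1 < Height.mulHeight₁ z :=
    lt_of_le_of_ne (Height.one_le_mulHeight₁ z) (Ne.symm hH)
  obtain ⟨M₁, hM₁, h₁⟩ := ht.exists_vandermonde_bound hXt
  obtain ⟨M₂, hM₂, h₂⟩ := ht.exists_vandermonde_bound hYt
  set M := M₁ * M₂
  have hM : M ≠ 0 := (Nat.mul_pos hM₁ hM₂).ne'
  obtain ⟨c₁, h₁⟩ := h₁ M (Dvd.intro _ rfl)
  obtain ⟨c₂, h₂⟩ := h₂ M (Dvd.intro_left _ rfl)
  set c := max c₁ c₂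
  set H := Height.mulHeight₁ z
  set r := Module.finrank ℚ ℚ⟮y⟯
  obtain ⟨i, hi⟩ := pow_unbounded_of_one_lt (H ^ 3 * 2 ^ (c * r * (2 * N))) hH1
  refine hi.not_ge ?_
  set D := N * d ^ i with hD
  have hiD : i ≤ D := calc
    i ≤ d ^ i := (Nat.lt_pow_self (by omega)).le
    _ ≤ D := Nat.le_mul_of_pos_left _ hN
  have hD0 : 0 < D := by positivity
  refine (pow_le_pow_right₀ hH1.le hiD).trans ?_
  set v : Fin (D ^ 2) → ι := fun j => Infinite.natEmbedding ι j
  have hv : Function.Injective fun j => t (v j) :=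
    htinj.comp ((Infinite.natEmbedding ι).injective.comp Fin.val_injective)
  set V := (Matrix.vandermonde fun j => t (v j)).det with hV
  have hV0 : V ≠ 0 := Matrix.det_vandermonde_ne_zero_iff.2 hv
  set s := ∑ j ∈ Finset.range (D ^ 2), j / D with hs
  have hXD : (X i).natDegree = D := hX.natDegree_eq i
  have hYD : (Y i).natDegree = D := hY.natDegree_eq i
  have e₁ := h₁ i D hXD hD0
  have e₂ := h₂ i D hYD hD0
  rw [hX.leadingCoeff_eq hd hN, hX1] at e₁
  rw [hY.leadingCoeff_eq hd hN] at e₂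
  obtain ⟨i₁, n₁⟩ := e₁ v
  obtain ⟨i₂, n₂⟩ := e₂ v
  simp only [one_pow, one_mul] at i₁ n₁
  have hw : (M : k) ^ (2 * D ^ 3) * ((y ^ d ^ i) ^ s * V) =
      algebraMap ℚ⟮y⟯ k z ^ (d ^ i * s) * ((M : k) ^ (2 * D ^ 3) * V) := by
    rw [hzy, pow_mul]; ring
  rw [← hs, ← hV, hw] at i₂ n₂
  have hmono : ∀ c' ≤ c, (2 : ℝ) ^ (c' * D ^ 3) ≤ 2 ^ (c * D ^ 3) := fun c' h =>
    pow_le_pow_right₀ one_le_two (Nat.mul_le_mul_right _ h)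
  have key : H ^ (d ^ i * s) ≤ (2 ^ (c * D ^ 3)) ^ r :=
    mulHeight₁_pow_le (k := k) z i₁
      (mul_ne_zero (pow_ne_zero _ (Nat.cast_ne_zero.2 hM)) hV0) i₂ (by positivity)
      (fun σ => (n₁ σ).trans (hmono _ (le_max_left _ _)))
      (fun σ => (n₂ σ).trans (hmono _ (le_max_right _ _)))
  have hsq := sq_le_sum_div (D ^ 2) hD0
  have hexp : D * D ^ 3 ≤ 3 * D ^ 3 + d ^ i * s * (2 * N) := by
    have h2 : d ^ i * s * (2 * N) = 2 * D * s := by rw [hD]; ring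
    have h3 : (2 * D + 1) * D ^ 2 ≤ 3 * D ^ 3 := by
      calc (2 * D + 1) * D ^ 2 ≤ (2 * D + D) * D ^ 2 := by gcongr; omega
        _ = 3 * D ^ 3 := by ring
    rw [h2]
    calc D * D ^ 3 = D ^ 2 * D ^ 2 := by ring
      _ ≤ _ := by rw [← hs] at hsq; omega
  rw [← pow_le_pow_iff_left₀ (by positivity) (by positivity) (pow_pos hD0 3).ne', ← pow_mul]
  calc H ^ (D * D ^ 3) ≤ H ^ (3 * D ^ 3 + d ^ i * s * (2 * N)) := pow_le_pow_right₀ hH1.le hexp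
    _ = H ^ (3 * D ^ 3) * (H ^ (d ^ i * s)) ^ (2 * N) := by rw [pow_add, pow_mul _ (d ^ i * s)]
    _ ≤ H ^ (3 * D ^ 3) * ((2 ^ (c * D ^ 3)) ^ r) ^ (2 * N) := by gcongr
    _ = (H ^ 3 * 2 ^ (c * r * (2 * N))) ^ D ^ 3 := by
      rw [mul_pow]
      simp only [← pow_mul]
      ring

theorem exists_pos_le_norm_conj {k : Type*} [Field k] [CharZero k] [Algebra.IsAlgebraic ℚ k]
    {x : k} (hx : x ≠ 0) : ∃ ε : ℝ, 0 < ε ∧ ∀ σ : k →+* ℂ, ε ≤ ‖σ x‖ := by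
  obtain ⟨-, C, hC⟩ := BoundedFamily.const (ι := Unit) x⁻¹
  refine ⟨(max C 1)⁻¹, by positivity, fun σ => ?_⟩
  have h := (hC () σ).trans (le_max_left C 1)
  rw [map_inv₀, norm_inv] at h
  have h0 : 0 < ‖σ x‖ := norm_pos_iff.2 ((map_ne_zero σ).2 hx)
  exact inv_le_of_inv_le₀ h0 h

theorem BoundedFamily.of_pow_eq_one {ι k : Type*} [Field k] {x : ι → k} {m : ℕ} (hm : 0 < m)
    (h : ∀ i, x i ^ m = 1) : BoundedFamily x := by
  refine ⟨⟨1, one_pos, fun i => ?_⟩, 1, fun i σ => ?_⟩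
  · rw [Nat.cast_one, one_mul]
    exact IsIntegral.of_pow hm (by rw [h]; exact isIntegral_one)
  · refine (pow_le_one_iff_of_nonneg (norm_nonneg _) hm.ne').1 ?_
    rw [← norm_pow, ← map_pow, h, map_one, norm_one]

theorem natDegree_leadingCoeff_geom_sum {k : Type*} [Field k] [CharZero k] {A B : k[X]}
    {d : ℕ} (hd : 0 < d) (hA : A.Monic) (hB : B.Monic) (hAB : A.natDegree = B.natDegree) :
    (∑ i ∈ Finset.range d, A ^ i * B ^ (d - 1 - i)).natDegree = (d - 1) * A.natDegree ∧
    (∑ i ∈ Finset.range d, A ^ i * B ^ (d - 1 - i)).leadingCoeff = d := by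
  have hm : ∀ i ∈ Finset.range d, (A ^ i * B ^ (d - 1 - i)).Monic ∧
      (A ^ i * B ^ (d - 1 - i)).natDegree = (d - 1) * A.natDegree := by
    intro i hi
    rw [Finset.mem_range] at hi
    refine ⟨(hA.pow i).mul (hB.pow _), ?_⟩
    rw [(hA.pow i).natDegree_mul (hB.pow _), hA.natDegree_pow, hB.natDegree_pow, ← hAB,
      ← add_mul]
    congr 1
    omega
  have hle : (∑ i ∈ Finset.range d, A ^ i * B ^ (d - 1 - i)).natDegree ≤
      (d - 1) * A.natDegree :=
    natDegree_sum_le_of_forall_le _ _ fun i hi => (hm i hi).2.le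
  have hc : (∑ i ∈ Finset.range d, A ^ i * B ^ (d - 1 - i)).coeff ((d - 1) * A.natDegree) =
      (d : k) := by
    rw [finsetSum_coeff, Finset.sum_congr rfl (g := fun _ => (1 : k)) fun i hi => by
      rw [← (hm i hi).2]
      exact (hm i hi).1.coeff_natDegree]
    simp
  have heq := le_antisymm hle (le_natDegree_of_ne_zero (by
    rw [hc]; exact Nat.cast_ne_zero.2 hd.ne'))
  exact ⟨heq, by rw [leadingCoeff, heq, hc]⟩

namespace NearPower

variable {k : Type*} [Field k] [CharZero k] {d N : ℕ} {X Y : ℕ → k[X]}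

theorem sub_succ (hX : NearPower d N X) (hY : NearPower d N Y) (hd : 2 ≤ d) (hN : 0 < N)
    (hX1 : (X 0).leadingCoeff = 1) (hY1 : (Y 0).leadingCoeff = 1) {n : ℕ} (h : X n - Y n ≠ 0) :
    X (n + 1) - Y (n + 1) ≠ 0 ∧
      (X (n + 1) - Y (n + 1)).leadingCoeff = d * (X n - Y n).leadingCoeff ∧
      0 < (X (n + 1) - Y (n + 1)).natDegree := by
  have hXm : (X n).Monic := by rw [Monic, hX.leadingCoeff_eq hd hN, hX1, one_pow]
  have hYm : (Y n).Monic := by rw [Monic, hY.leadingCoeff_eq hd hN, hY1, one_pow]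
  obtain ⟨hg, hl⟩ := natDegree_leadingCoeff_geom_sum (d := d) (by omega) hXm hYm
    ((hX.natDegree_eq n).trans (hY.natDegree_eq n).symm)
  have hgeom := geom_sum₂_mul (X n) (Y n) d
  set Γ := ∑ i ∈ Finset.range d, X n ^ i * Y n ^ (d - 1 - i)
  have hΓ : Γ ≠ 0 := by
    rw [← leadingCoeff_ne_zero, hl]
    exact Nat.cast_ne_zero.2 (by omega)
  have hΓh : Γ * (X n - Y n) ≠ 0 := mul_ne_zero hΓ h
  have hdeg : (((d - 1) * (N * d ^ n) : ℕ) : WithBot ℕ) ≤ (Γ * (X n - Y n)).degree := by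
    rw [degree_eq_natDegree hΓh, natDegree_mul hΓ h, hg, hX.natDegree_eq]
    exact_mod_cast Nat.le_add_right _ _
  have hlt : (X (n + 1) - X n ^ d - (Y (n + 1) - Y n ^ d)).degree <
      (Γ * (X n - Y n)).degree :=
    (lt_of_le_of_lt (degree_sub_le _ _) (max_lt (hX.degree_lt n) (hY.degree_lt n))).trans_le hdeg
  have heq : X (n + 1) - Y (n + 1) =
      (X (n + 1) - X n ^ d - (Y (n + 1) - Y n ^ d)) + Γ * (X n - Y n) := by
    rw [hgeom]; ring
  have hd' : (X (n + 1) - Y (n + 1)).degree = (Γ * (X n - Y n)).degree := by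
    rw [heq, degree_add_eq_right_of_degree_lt hlt]
  refine ⟨?_, ?_, ?_⟩
  · rw [← degree_ne_bot, hd', degree_ne_bot]; exact hΓh
  · rw [heq, leadingCoeff_add_of_degree_lt hlt, leadingCoeff_mul, hl]
  · rw [natDegree_eq_of_degree_eq hd', natDegree_mul hΓ h, hg, hX.natDegree_eq]
    have : 0 < (d - 1) * (N * d ^ n) := by
      have : 0 < d - 1 := by omega
      positivity
    omega

theorem eq_of_leadingCoeff_eq_one [Algebra.IsAlgebraic ℚ k] {ι : Type*} [Infinite ι]
    (hX : NearPower d N X) (hY : NearPower d N Y) (hd : 2 ≤ d) (hN : 0 < N)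
    (hX1 : (X 0).leadingCoeff = 1) (hY1 : (Y 0).leadingCoeff = 1) {t : ι → k}
    (htinj : Function.Injective t) (ht : BoundedFamily t)
    (hXt : BoundedFamily fun i : ι × ℕ => (X i.2).eval (t i.1))
    (hYt : BoundedFamily fun i : ι × ℕ => (Y i.2).eval (t i.1)) (n : ℕ) : X n = Y n := by
  by_contra hne
  have h0 : X n - Y n ≠ 0 := sub_ne_zero.2 hne
  have hiter : ∀ j, X (n + j) - Y (n + j) ≠ 0 ∧
      (X (n + j) - Y (n + j)).leadingCoeff = d ^ j * (X n - Y n).leadingCoeff := by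
    intro j
    induction j with
    | zero => simpa using h0
    | succ j ih =>
      obtain ⟨h1, h2, -⟩ := hX.sub_succ hY hd hN hX1 hY1 ih.1
      refine ⟨h1, h2.trans ?_⟩
      rw [ih.2, pow_succ]; ring
  obtain ⟨M, hM, hMX⟩ := ht.exists_vandermonde_bound hXt
  obtain ⟨b, hMX⟩ := hMX M dvd_rfl
  have hM' : (M : k) ≠ 0 := Nat.cast_ne_zero.2 hM.ne'
  obtain ⟨-, C₁, hC₁⟩ := id ht
  obtain ⟨-, C₂, hC₂⟩ := hXt.sub hYt
  obtain ⟨a₁, h₁⟩ := exists_le_two_pow C₁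
  obtain ⟨a₂, h₂⟩ := exists_le_two_pow C₂
  obtain ⟨a₃, h₃⟩ := exists_le_two_pow M
  set c := max a₁ (max a₂ a₃)
  have hc₁ := h₁ c (by simp [c])
  have hc₂ := h₂ c (by simp [c])
  have hc₃ := h₃ c (by simp [c])
  have hA : (1 : ℝ) ≤ 2 ^ c := one_le_pow₀ one_le_two
  obtain ⟨ε, hε, hεσ⟩ := exists_pos_le_norm_conj (leadingCoeff_ne_zero.2 h0)
  obtain ⟨j, hj⟩ := pow_unbounded_of_one_lt (2 * 2 ^ c / ε)
    (show (1 : ℝ) < d by exact_mod_cast (by omega : 1 < d))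
  obtain ⟨-, hG2, hG3⟩ := hX.sub_succ hY hd hN hX1 hY1 (hiter j).1
  set G := X (n + j + 1) - Y (n + j + 1) with hG
  set g := G.natDegree with hg
  have hlead : ∀ σ : k →+* ℂ, 2 * 2 ^ c ≤ ‖σ G.leadingCoeff‖ := by
    intro σ
    rw [hG2, (hiter j).2]
    simp only [map_mul, map_pow, map_natCast, norm_mul, norm_pow, Complex.norm_natCast]
    rw [div_lt_iff₀ hε] at hj
    calc 2 * 2 ^ c ≤ (d : ℝ) ^ j * ε := hj.le
      _ ≤ 1 * ((d : ℝ) ^ j * ‖σ (X n - Y n).leadingCoeff‖) := by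
        rw [one_mul]; gcongr; exact hεσ σ
      _ ≤ _ := by gcongr; exact_mod_cast (by omega : 1 ≤ d)
  set κ := 2 * c + 2 + c * g
  set i := 2 * g * κ + (2 * g + 1) + 1
  set D := N * d ^ i with hD
  have hiD : i ≤ D := calc
    i ≤ d ^ i := (Nat.lt_pow_self (by omega)).le
    _ ≤ D := Nat.le_mul_of_pos_left _ hN
  have hD0 : 0 < D := by positivity
  set v : Fin (D ^ 2) → ι := fun j => Infinite.natEmbedding ι j
  have hv : Function.Injective fun j => t (v j) :=
    htinj.comp ((Infinite.natEmbedding ι).injective.comp Fin.val_injective)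
  set V := (Matrix.vandermonde fun j => t (v j)).det with hV
  have hV0 : V ≠ 0 := Matrix.det_vandermonde_ne_zero_iff.2 hv
  set s := ∑ j ∈ Finset.range (D ^ 2), j / g with hs
  obtain ⟨hintegral, -⟩ := hMX i D (hX.natDegree_eq i) hD0 v
  rw [hX.leadingCoeff_eq hd hN, hX1, one_pow, one_pow, one_mul, ← hV] at hintegral
  obtain ⟨σ, hσ⟩ := exists_one_le_norm_conj hintegral (mul_ne_zero (pow_ne_zero _ hM') hV0)
  rw [map_mul, map_pow, map_natCast, norm_mul, norm_pow, Complex.norm_natCast] at hσ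
  have hup := norm_pow_mul_vandermonde_le hG3 σ hA (v := fun i => t (v i))
      (fun i => (hC₁ (v i) σ).trans hc₁) (B := 2 ^ c) (fun i => by
        rw [hG, eval_sub]; exact (hC₂ (v i, n + j + 1) σ).trans hc₂)
  rw [← hs, ← hV, ← hg, map_mul, map_pow, norm_mul, norm_pow] at hup
  have hup2 : (2 : ℝ) ^ s * ‖σ V‖ ≤ (D ^ 2).factorial * (2 ^ c) ^ (g * D ^ 2) := by
    have hpos : (0 : ℝ) < (2 ^ c) ^ s := by positivity
    refine le_of_mul_le_mul_right ?_ hpos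
    calc (2 : ℝ) ^ s * ‖σ V‖ * (2 ^ c) ^ s = (2 * 2 ^ c) ^ s * ‖σ V‖ := by rw [mul_pow]; ring
      _ ≤ ‖σ G.leadingCoeff‖ ^ s * ‖σ V‖ := by gcongr; exact hlead σ
      _ ≤ _ := by rw [mul_assoc]; exact hup
  have hexp : (2 : ℝ) ^ s ≤ 2 ^ (κ * D ^ 3) := by
    calc (2 : ℝ) ^ s = 2 ^ s * 1 := (mul_one _).symm
      _ ≤ 2 ^ s * ((M : ℝ) ^ (2 * D ^ 3) * ‖σ V‖) := by gcongr
      _ = (M : ℝ) ^ (2 * D ^ 3) * (2 ^ s * ‖σ V‖) := by ring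
      _ ≤ (2 ^ c) ^ (2 * D ^ 3) * (2 ^ (2 * D ^ 3) * (2 ^ c) ^ (g * D ^ 3)) := by
        refine mul_le_mul (by gcongr) (hup2.trans ?_) (by positivity) (by positivity)
        have := factorial_sq_le D
        have h23 : D ^ 2 ≤ D ^ 3 := Nat.pow_le_pow_right hD0 (by norm_num)
        gcongr
      _ = 2 ^ (κ * D ^ 3) := by
        simp only [← pow_mul, ← pow_add]
        congr 1
        ring
  have hsκ : s ≤ κ * D ^ 3 := (pow_le_pow_iff_right₀ one_lt_two).1 hexp
  have hsq := sq_le_sum_div (D ^ 2) hG3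
  rw [← hs] at hsq
  have hfin : D * D ^ 3 ≤ (2 * g * κ + (2 * g + 1)) * D ^ 3 := by
    calc D * D ^ 3 = D ^ 2 * D ^ 2 := by ring
      _ ≤ 2 * g * s + (2 * g + 1) * D ^ 2 := hsq
      _ ≤ 2 * g * (κ * D ^ 3) + (2 * g + 1) * D ^ 3 := by
        have h23 : D ^ 2 ≤ D ^ 3 := Nat.pow_le_pow_right hD0 (by norm_num)
        gcongr
      _ = _ := by ring
  have := Nat.le_of_mul_le_mul_right hfin (pow_pos hD0 3)
  omega

theorem exists_finite_range_eq_C_mul [IsAlgClosed k] [Algebra.IsAlgebraic ℚ k] {ι : Type*}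
    [Infinite ι] (hX : NearPower d N X) (hY : NearPower d N Y) (hd : 2 ≤ d) (hN : 0 < N)
    {t : ι → k} (htinj : Function.Injective t) (ht : BoundedFamily t)
    (hXt : BoundedFamily fun i : ι × ℕ => (X i.2).eval (t i.1))
    (hYt : BoundedFamily fun i : ι × ℕ => (Y i.2).eval (t i.1)) :
    ∃ c : ℕ → k, (Set.range c).Finite ∧ ∀ n, c n ≠ 0 ∧ X n = C (c n) * Y n := by
  have hx0 : (X 0).leadingCoeff ≠ 0 := leadingCoeff_ne_zero.2 (hX.ne_zero hd hN 0)
  obtain ⟨u, hu⟩ := IsAlgClosed.exists_pow_nat_eq (X 0).leadingCoeff⁻¹ hN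
  have hu0 : u ≠ 0 := by
    rintro rfl
    rw [zero_pow hN.ne'] at hu
    exact inv_ne_zero hx0 hu.symm
  have hX' := hX.comp_C_mul_X hu0
  have hY' := hY.comp_C_mul_X hu0
  have hX1 : ((X 0).comp (C u * Polynomial.X)).leadingCoeff = 1 := by
    rw [leadingCoeff_comp (by rw [natDegree_C_mul_X _ hu0]; exact one_ne_zero),
      hX.natDegree_eq, leadingCoeff_C_mul_X, pow_zero, mul_one, hu, mul_inv_cancel₀ hx0]
  have ht' : BoundedFamily fun i => u⁻¹ * t i := (BoundedFamily.const u⁻¹).mul ht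
  have htinj' : Function.Injective fun i => u⁻¹ * t i :=
    (mul_right_injective₀ (inv_ne_zero hu0)).comp htinj
  have hev : ∀ (p : k[X]) i, (p.comp (C u * Polynomial.X)).eval (u⁻¹ * t i) = p.eval (t i) := by
    intro p i
    rw [eval_comp, eval_C_mul, eval_X, mul_inv_cancel_left₀ hu0]
  have hXt' : BoundedFamily fun i : ι × ℕ =>
      ((X i.2).comp (C u * Polynomial.X)).eval (u⁻¹ * t i.1) := by
    simpa only [hev] using hXt
  have hYt' : BoundedFamily fun i : ι × ℕ =>
      ((Y i.2).comp (C u * Polynomial.X)).eval (u⁻¹ * t i.1) := by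
    simpa only [hev] using hYt
  obtain ⟨m, hm, hym⟩ :=
    hX'.exists_pow_leadingCoeff_eq_one hY' hd hN hX1 htinj' ht' hXt' hYt'
  set y := ((Y 0).comp (C u * Polynomial.X)).leadingCoeff with hy
  have hy0 : y ≠ 0 := leadingCoeff_ne_zero.2 (hY'.ne_zero hd hN 0)
  have hroot : ∀ n, (y⁻¹ ^ d ^ n) ^ m = 1 := fun n => by
    rw [← pow_mul, mul_comm, pow_mul, inv_pow, hym, inv_one, one_pow]
  refine ⟨fun n => y⁻¹ ^ d ^ n, ?_, fun n => ⟨pow_ne_zero _ (inv_ne_zero hy0), ?_⟩⟩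
  · classical
    refine ((nthRoots m (1 : k)).toFinset.finite_toSet).subset ?_
    rintro _ ⟨n, rfl⟩
    simpa [mem_nthRoots hm] using hroot n
  have key := hX'.eq_of_leadingCoeff_eq_one (hY'.C_pow_mul (inv_ne_zero hy0)) hd hN hX1
    (by rw [pow_zero, pow_one, leadingCoeff_mul, leadingCoeff_C, inv_mul_cancel₀ hy0])
    htinj' ht' hXt' (by
      simp only [eval_C_mul]
      exact ((BoundedFamily.of_pow_eq_one hm hroot).comp Prod.snd).mul hYt') n
  have hcomp : (C u * Polynomial.X : k[X]).comp (C u⁻¹ * Polynomial.X) = Polynomial.X := by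
    rw [mul_comp, C_comp, X_comp, ← mul_assoc, ← C_mul, mul_inv_cancel₀ hu0, C_1, one_mul]
  have := congrArg (fun p : k[X] => p.comp (C u⁻¹ * Polynomial.X)) key
  simpa only [mul_comp, C_comp, comp_assoc, hcomp, comp_X] using this

end NearPower

theorem finite_range_iterate_iff {α : Type*} (f : α → α) (a : α) :
    (Set.range fun n => f^[n] a).Finite ↔ ∃ m n, 0 < n ∧ f^[m + n] a = f^[m] a := by
  constructor
  · intro h
    have hinj : ¬ Function.Injective fun n => f^[n] a := fun hi =>
      Set.infinite_range_of_injective hi h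
    obtain ⟨i, j, hij, hne⟩ := Function.not_injective_iff.1 hinj
    wlog hlt : i < j generalizing i j
    · exact this j i hij.symm hne.symm (by omega)
    exact ⟨i, j - i, by omega, by rw [Nat.add_sub_cancel' hlt.le]; exact hij.symm⟩
  · rintro ⟨m, n, hn, h⟩
    have hp : Function.IsPeriodicPt f n (f^[m] a) := by
      rw [Function.IsPeriodicPt, Function.IsFixedPt, ← Function.iterate_add_apply, add_comm, h]
    refine ((Finset.range (m + n)).finite_toSet.image fun i => f^[i] a).subset ?_
    rintro _ ⟨i, rfl⟩
    by_cases hi : i < m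
    · exact ⟨i, by simp; omega, rfl⟩
    · refine ⟨(i - m) % n + m, ?_, ?_⟩
      · have := Nat.mod_lt (i - m) hn
        simp; omega
      · simp only
        rw [Function.iterate_add_apply, hp.iterate_mod_apply, ← Function.iterate_add_apply,
          Nat.sub_add_cancel (by omega)]

theorem nearPower_shift {k : Type*} [Field k] {W : k[X][X]} {A : ℕ → k[X]} {d m n₀ j : ℕ}
    (h : ∀ n ≥ n₀, (W.eval (A (n + 1))).natDegree = m * d ^ n ∧
      (W.eval (A (n + 2)) - W.eval (A (n + 1)) ^ d).degree < ((d - 1) * (m * d ^ n) : ℕ))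
    (hj : n₀ ≤ j) : NearPower d (m * d ^ j) fun n => W.eval (A (n + j + 1)) where
  natDegree_eq n := by
    rw [(h (n + j) (by omega)).1, pow_add]; ring
  degree_lt n := by
    have := (h (n + j) (by omega)).2
    rw [show n + 1 + j + 1 = n + j + 2 by omega,
      show m * d ^ j * d ^ n = m * d ^ (n + j) by rw [pow_add]; ring]
    exact this

theorem finite_range_of_eval_eval {k : Type*} [Field k] {W : k[X][X]} {w : k} {q : ℕ}
    (hw : w ≠ 0) (hq : 0 < q) (hWq : W.coeff q = C w) {x : ℕ → k} {t : k}
    (h : (Set.range fun n => (W.map (evalRingHom t)).eval (x n)).Finite) :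
    (Set.range x).Finite := by
  refine ((h.biUnion fun y _ => (((W.map (evalRingHom t)) - C y).rootSet_finite k))).subset ?_
  rintro _ ⟨n, rfl⟩
  refine Set.mem_biUnion ⟨n, rfl⟩ ?_
  rw [mem_rootSet]
  refine ⟨fun h0 => hw ?_, by simp⟩
  have := congrArg (fun p : k[X] => p.coeff q) h0
  simpa [coeff_C, hq.ne', hWq] using this

section

variable {k : Type*} [Field k] [CharZero k]

theorem boundedFamily_orbitPoly [Algebra.IsAlgebraic ℚ k] {f P : k[X]} (hf : 2 ≤ f.natDegree)
    (a : k) {S : Set k}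
    (hS : ∀ t ∈ S, (Set.range fun n => (fun z => f.eval z + P.eval t)^[n] a).Finite) :
    BoundedFamily fun i : S × ℕ => (orbitPoly f P a i.2).eval (i.1 : k) := by
  have := (boundedFamily_orbit f hf a).comp fun i : S × ℕ => (⟨P.eval (i.1 : k), hS _ i.1.2⟩, i.2)
  simpa only [eval_orbitPoly] using this

theorem finite_orbit_of_finite_orbit [IsAlgClosed k] [Algebra.IsAlgebraic ℚ k] {f P Q : k[X]}
    (hf : 2 ≤ f.natDegree) (hP : 0 < P.natDegree) (hQ : 0 < Q.natDegree) {a b : k}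
    (hinf : {t | (Set.range fun n => (fun z => f.eval z + P.eval t)^[n] a).Finite ∧
      (Set.range fun n => (fun z => f.eval z + Q.eval t)^[n] b).Finite}.Infinite) {t₀ : k}
    (h : (Set.range fun n => (fun z => f.eval z + P.eval t₀)^[n] a).Finite) :
    (Set.range fun n => (fun z => f.eval z + Q.eval t₀)^[n] b).Finite := by
  obtain ⟨U, u, m, -, -, -, hU⟩ :=
    exists_normalized_orbitPoly a (q := Q.natDegree) hf rfl (P := P) rfl hP
  obtain ⟨W, w, n, hw, -, hWw, hW⟩ :=
    exists_normalized_orbitPoly b (q := P.natDegree) hf rfl (P := Q) rfl hQ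
  rw [mul_comm Q.natDegree] at hU
  set j := max m n
  set S := {t | (Set.range fun n => (fun z => f.eval z + P.eval t)^[n] a).Finite ∧
      (Set.range fun n => (fun z => f.eval z + Q.eval t)^[n] b).Finite}
  have : Infinite S := hinf.to_subtype
  have hA := boundedFamily_orbitPoly hf a (S := S) (P := P) fun t ht => ht.1
  have hB := boundedFamily_orbitPoly hf b (S := S) (P := Q) fun t ht => ht.2
  have ht : BoundedFamily fun i : S => (i : k) := by
    refine BoundedFamily.of_eval hP ?_
    have := (hA.comp fun i : S => (i, 1)).sub (.const (f.eval a))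
    simpa [eval_orbitPoly] using this
  obtain ⟨c, hc, hXY⟩ := (nearPower_shift hU (le_max_left m n)).exists_finite_range_eq_C_mul
    (nearPower_shift hW (le_max_right m n)) hf (by positivity) Subtype.val_injective ht
    ((ht.comp Prod.fst).eval_eval (hA.comp fun i : S × ℕ => (i.1, i.2 + j + 1)) U)
    ((ht.comp Prod.fst).eval_eval (hB.comp fun i : S × ℕ => (i.1, i.2 + j + 1)) W)
  have hev : ∀ (V : k[X][X]) (p : k[X]),
      (V.map (evalRingHom t₀)).eval (p.eval t₀) = (V.eval p).eval t₀ := fun V p => by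
    rw [← coe_evalRingHom t₀, coe_evalRingHom, eval_map, ← coe_evalRingHom t₀, eval₂_at_apply]
  have hX : (Set.range fun n => (U.eval (orbitPoly f P a (n + j + 1))).eval t₀).Finite := by
    refine (h.image (U.map (evalRingHom t₀)).eval).subset ?_
    rintro _ ⟨n, rfl⟩
    exact ⟨_, ⟨n + j + 1, rfl⟩, by simp only [← hev, eval_orbitPoly]⟩
  have hY : (Set.range fun n => (W.eval (orbitPoly f Q b (n + j + 1))).eval t₀).Finite := by
    refine (Set.Finite.image2 (fun c x => c⁻¹ * x) hc hX).subset ?_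
    rintro _ ⟨n, rfl⟩
    refine ⟨c n, ⟨n, rfl⟩, _, ⟨n, rfl⟩, ?_⟩
    have e := congrArg (eval t₀) (hXY n).2
    rw [eval_C_mul] at e
    exact (inv_mul_eq_iff_eq_mul₀ (hXY n).1).2 e
  have hB' : (Set.range fun n => (orbitPoly f Q b (n + j + 1)).eval t₀).Finite :=
    finite_range_of_eval_eval hw hP hWw (t := t₀) (by simpa only [hev] using hY)
  refine (hB'.union ((Finset.range (j + 1)).finite_toSet.image
    fun n => (fun z => f.eval z + Q.eval t₀)^[n] b)).subset ?_
  rintro _ ⟨n, rfl⟩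
  by_cases hn : n < j + 1
  · exact .inr ⟨n, by simpa using hn, rfl⟩
  · exact .inl ⟨n - (j + 1), by
      simp only [eval_orbitPoly]
      rw [show n - (j + 1) + j + 1 = n by omega]⟩

end

theorem preperiodic_map_iff {k : Type*} [Field k] (φ : k →+* ℂ) (f P : k[X]) (a t : k) :
    Preperiodic (fun z => (f.map φ).eval z + (P.map φ).eval (φ t)) (φ a) ↔
      (Set.range fun n => (fun z => f.eval z + P.eval t)^[n] a).Finite := by
  have h : ∀ n, (fun z => (f.map φ).eval z + (P.map φ).eval (φ t))^[n] (φ a) =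
      φ ((fun z => f.eval z + P.eval t)^[n] a) := by
    intro n
    refine ((Function.Semiconj.iterate_right (f := φ) (fun z => ?_) n) a).symm
    simp [eval_map_apply]
  rw [Preperiodic, finite_range_iterate_iff]
  simp only [h, φ.injective.eq_iff]

theorem exists_map_eq_of_isAlgebraic {p : ℂ[X]} (hp : ∀ i, IsAlgebraic ℚ (p.coeff i)) :
    ∃ q : (algebraicClosure ℚ ℂ)[X], q.map (algebraMap (algebraicClosure ℚ ℂ) ℂ) = p := by
  rw [← mem_lifts, lifts_iff_coeff_lifts]
  exact fun i => ⟨⟨p.coeff i, mem_algebraicClosure_iff.2 (hp i)⟩, rfl⟩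

theorem unlikely_intersections_families (f P Q : Polynomial ℂ) (d : ℕ) (hd : 2 ≤ d)
    (hfdeg : f.natDegree = d) (hfalg : ∀ i : ℕ, IsAlgebraic ℚ (f.coeff i))
    (hPdeg : 0 < P.natDegree) (hPalg : ∀ i : ℕ, IsAlgebraic ℚ (P.coeff i))
    (hQdeg : 0 < Q.natDegree) (hQalg : ∀ i : ℕ, IsAlgebraic ℚ (Q.coeff i))
    (a b : ℂ) (ha : IsAlgebraic ℚ a) (hb : IsAlgebraic ℚ b)
    (hinf : {t : ℂ | IsAlgebraic ℚ t ∧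
      Preperiodic (fun z => f.eval z + P.eval t) a ∧
      Preperiodic (fun z => f.eval z + Q.eval t) b}.Infinite) :
    ∀ t : ℂ, IsAlgebraic ℚ t →
      (Preperiodic (fun z => f.eval z + P.eval t) a ↔
        Preperiodic (fun z => f.eval z + Q.eval t) b) := by
  obtain ⟨f, rfl⟩ := exists_map_eq_of_isAlgebraic hfalg
  obtain ⟨P, rfl⟩ := exists_map_eq_of_isAlgebraic hPalg
  obtain ⟨Q, rfl⟩ := exists_map_eq_of_isAlgebraic hQalg
  lift a to algebraicClosure ℚ ℂ using mem_algebraicClosure_iff.2 ha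
  lift b to algebraicClosure ℚ ℂ using mem_algebraicClosure_iff.2 hb
  rw [natDegree_map] at hfdeg hPdeg hQdeg
  rw [← hfdeg] at hd
  have : IsAlgClosed (algebraicClosure ℚ ℂ) := (algebraicClosure.isAlgClosure ℚ ℂ).isAlgClosed
  have : Algebra.IsAlgebraic ℚ (algebraicClosure ℚ ℂ) := by
    rw [Subsingleton.elim (DivisionRing.toRatAlgebra (R := algebraicClosure ℚ ℂ))
      (algebraicClosure ℚ ℂ).algebra']
    exact algebraicClosure.isAlgebraic ℚ ℂ
  have hA := preperiodic_map_iff (algebraMap (algebraicClosure ℚ ℂ) ℂ) f P a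
  have hB := preperiodic_map_iff (algebraMap (algebraicClosure ℚ ℂ) ℂ) f Q b
  have hinf' : {t | (Set.range fun n => (fun z => f.eval z + P.eval t)^[n] a).Finite ∧
      (Set.range fun n => (fun z => f.eval z + Q.eval t)^[n] b).Finite}.Infinite := by
    refine Set.Infinite.of_image (algebraMap (algebraicClosure ℚ ℂ) ℂ) (hinf.mono ?_)
    rintro t ⟨ht, h₁, h₂⟩
    lift t to algebraicClosure ℚ ℂ using mem_algebraicClosure_iff.2 ht
    exact ⟨t, ⟨(hA t).1 h₁, (hB t).1 h₂⟩, rfl⟩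
  intro t ht
  lift t to algebraicClosure ℚ ℂ using mem_algebraicClosure_iff.2 ht
  exact (hA t).trans (Iff.trans ⟨finite_orbit_of_finite_orbit hd hPdeg hQdeg hinf',
    finite_orbit_of_finite_orbit hd hQdeg hPdeg (by simpa only [and_comm] using hinf')⟩
    (hB t).symm)
end

section
/- (Bang) Let a ≥ 2 be an integer. There exists a positive integer M such that for every integer m > M, the number a^m - 1 has a primitive prime divisor; that is, there is a prime p such that p divides a^m - 1 and p does not divide a^k - 1 for any integer k with 1 ≤ k < m. -/
open Polynomial in
/-- A lower bound for cyclotomic values that is uniform in the index. -/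
theorem pow_totient_le_exp_two_mul_cyclotomic_eval {q : ℝ} (hq : 2 ≤ q) {n : ℕ} (hn : 0 < n) :
    q ^ n.totient ≤ Real.exp 2 * (cyclotomic n ℝ).eval q := by
  have hpos (i : ℕ) : 0 < (cyclotomic i ℝ).eval q := cyclotomic_pos' i (by linarith)
  have hq0 : 0 < q := by linarith
  have hsum : ∀ n > 0, ∑ i ∈ n.divisors,
      (Real.log ((cyclotomic i ℝ).eval q) - i.totient * Real.log q) =
        Real.log (1 - (q ^ n)⁻¹) := by
    intro n hn
    have h1 : 1 < q ^ n := one_lt_pow₀ (by linarith) hn.ne'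
    rw [Finset.sum_sub_distrib, ← Real.log_prod (fun i _ => (hpos i).ne'), ← eval_prod,
      prod_cyclotomic_eq_X_pow_sub_one hn, ← Finset.sum_mul, ← Nat.cast_sum, Nat.sum_totient,
      ← Real.log_pow, ← Real.log_div (by simp; linarith) (by positivity)]
    congr 1
    simp only [eval_sub, eval_pow, eval_X, eval_one]
    field_simp
  have hinv := ArithmeticFunction.sum_eq_iff_sum_mul_moebius_eq.1 hsum n hn
  have hterm (m : ℕ) (hm : 0 < m) : |Real.log (1 - (q ^ m)⁻¹)| ≤ 2 * (1 / 2) ^ m := by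
    have h2 : (q ^ m)⁻¹ ≤ (1 / 2) ^ m := by
      rw [← inv_pow]
      exact pow_le_pow_left₀ (by positivity) (by
        rw [one_div]; exact inv_anti₀ (by norm_num) hq) m
    have h3 : ((1 : ℝ) / 2) ^ m ≤ 1 / 2 :=
      pow_le_of_le_one (by norm_num) (by norm_num) hm.ne'
    have h4 : 0 < (q ^ m)⁻¹ := by positivity
    set t := (q ^ m)⁻¹
    rw [abs_of_nonpos (Real.log_nonpos (by linarith) (by linarith))]
    have h5 := Real.one_sub_inv_le_log_of_pos (show 0 < 1 - t by linarith)
    have h6 : (1 - t)⁻¹ ≤ 1 + 2 * t := by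
      rw [inv_le_iff_one_le_mul₀ (by linarith)]
      nlinarith
    linarith
  have hbound : |∑ x ∈ n.divisorsAntidiagonal,
      (ArithmeticFunction.moebius x.1 : ℝ) * Real.log (1 - (q ^ x.2)⁻¹)| ≤ 2 := by
    calc
      _ ≤ ∑ x ∈ n.divisorsAntidiagonal,
          |(ArithmeticFunction.moebius x.1 : ℝ) * Real.log (1 - (q ^ x.2)⁻¹)| :=
        Finset.abs_sum_le_sum_abs _ _
      _ ≤ ∑ x ∈ n.divisorsAntidiagonal, 2 * (1 / 2 : ℝ) ^ x.2 := by
        refine Finset.sum_le_sum fun x hx => ?_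
        have hx2 : 0 < x.2 := by
          obtain ⟨h, h0⟩ := Nat.mem_divisorsAntidiagonal.1 hx
          exact Nat.pos_of_ne_zero fun h' => h0 (by rw [← h, h', mul_zero])
        rw [abs_mul]
        have hμ : |(ArithmeticFunction.moebius x.1 : ℝ)| ≤ 1 := by
          exact_mod_cast ArithmeticFunction.abs_moebius_le_one
        exact (mul_le_of_le_one_left (abs_nonneg _) hμ).trans (hterm _ hx2)
      _ = ∑ d ∈ n.divisors, 2 * (1 / 2 : ℝ) ^ d :=
        Nat.sum_divisorsAntidiagonal' (f := fun _ d => 2 * (1 / 2 : ℝ) ^ d)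
      _ ≤ ∑ d ∈ Finset.Ico 1 (n + 1), 2 * (1 / 2 : ℝ) ^ d :=
        Finset.sum_le_sum_of_subset_of_nonneg (Finset.filter_subset _ _)
          fun _ _ _ => by positivity
      _ = ∑ d ∈ Finset.range n, (1 / 2 : ℝ) ^ d := by
        rw [Finset.sum_Ico_eq_sum_range]
        refine Finset.sum_congr (by simp) fun d _ => ?_
        ring
      _ ≤ 2 := sum_geometric_two_le n
  rw [hinv] at hbound
  have h := (abs_le.1 hbound).1
  rw [← Real.log_le_log_iff (by positivity) (mul_pos (Real.exp_pos 2) (hpos n)),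
    Real.log_mul (Real.exp_pos 2).ne' (hpos n).ne', Real.log_exp, Real.log_pow]
  linarith

open Polynomial in
theorem pow_totient_lt_eight_mul_natAbs_cyclotomic_eval {a n : ℕ} (ha : 2 ≤ a) (hn : 0 < n) :
    a ^ n.totient < 8 * ((cyclotomic n ℤ).eval (a : ℤ)).natAbs := by
  have hq : (2 : ℝ) ≤ a := by exact_mod_cast ha
  have h := pow_totient_le_exp_two_mul_cyclotomic_eval hq hn
  have hpos : 0 < (cyclotomic n ℝ).eval (a : ℝ) := cyclotomic_pos' n (by linarith)
  have he : Real.exp 2 < 8 := by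
    rw [show (2 : ℝ) = 1 + 1 by norm_num, Real.exp_add]
    nlinarith [Real.exp_one_lt_d9, Real.exp_pos 1]
  have hcast : (((cyclotomic n ℤ).eval (a : ℤ)).natAbs : ℝ) = (cyclotomic n ℝ).eval (a : ℝ) := by
    have h0 := cyclotomic.eval_apply (a : ℤ) n (algebraMap ℤ ℝ)
    simp only [algebraMap_int_eq, eq_intCast, Int.cast_natCast] at h0
    rw [Nat.cast_natAbs, Int.cast_abs, ← h0, abs_of_pos hpos]
  have : (a : ℝ) ^ n.totient < 8 * (((cyclotomic n ℤ).eval (a : ℤ)).natAbs : ℝ) := by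
    rw [hcast]
    nlinarith
  exact_mod_cast this

open Polynomial in
/-- A prime divisor `p` of `Φₘ(a)` determines `m` up to a power of `p`
and the multiplicative order of `a` modulo `p`. -/
theorem exists_isPrimitiveRoot_of_prime_dvd_cyclotomic_eval {a m p : ℕ} (hm : 0 < m)
    (hp : p.Prime) (h : (p : ℤ) ∣ (cyclotomic m ℤ).eval (a : ℤ)) :
    ∃ k d : ℕ, m = p ^ k * d ∧ d < p ∧ IsPrimitiveRoot (a : ZMod p) d := by
  have := Fact.mk hp
  obtain ⟨k, d, hd, rfl⟩ := Nat.exists_eq_pow_mul_and_not_dvd hm.ne' p hp.ne_one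
  have : NeZero (d : ZMod p) := ⟨by rwa [Ne, ZMod.natCast_eq_zero_iff]⟩
  have hroot : (cyclotomic (p ^ k * d) (ZMod p)).IsRoot (a : ZMod p) := by
    have h0 := cyclotomic.eval_apply (a : ℤ) (p ^ k * d) (Int.castRingHom (ZMod p))
    simp only [eq_intCast, Int.cast_natCast] at h0
    rw [IsRoot.def, h0]
    exact (ZMod.intCast_zmod_eq_zero_iff_dvd _ _).2 h
  have hprim := isRoot_cyclotomic_prime_pow_mul_iff_of_charP.1 hroot
  refine ⟨k, d, rfl, ?_, hprim⟩
  have hd0 : d ≠ 0 := by rintro rfl; simp at hd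
  have ha0 : (a : ZMod p) ≠ 0 := (hprim.isUnit hd0).ne_zero
  have hdvd := hprim.dvd_of_pow_eq_one _ (ZMod.pow_card_sub_one_eq_one ha0)
  have := Nat.le_of_dvd (Nat.sub_pos_of_lt hp.one_lt) hdvd
  have := hp.pos
  omega

/-- For an odd prime `p ∤ x` with `x ≡ 1`, the sum `1 + x + ⋯ + x ^ (p - 1)` has `p`-adic
valuation one. -/
theorem not_sq_dvd_geom_sum_of_odd {p : ℕ} (hp : p.Prime) (hodd : Odd p) {x : ℤ}
    (hx : (p : ℤ) ∣ x - 1) : ¬ (p : ℤ) ^ 2 ∣ ∑ i ∈ Finset.range p, x ^ i := by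
  have hp' : Prime (p : ℤ) := Nat.prime_iff_prime_int.1 hp
  have hpx : ¬ (p : ℤ) ∣ x := fun h => hp'.not_dvd_one (by simpa using dvd_sub h hx)
  have h := emultiplicity_geom_sum₂_eq_one hp' hodd hx hpx
  simp only [one_pow, mul_one] at h
  intro hdvd
  have h2 := le_emultiplicity_of_pow_dvd hdvd
  rw [h] at h2
  exact absurd h2 (by norm_num)

open Polynomial in
theorem cyclotomic_eval_dvd_geom_sum {x : ℤ} {n p : ℕ} (hx : 1 < x) (hn : 0 < n) (hp : 1 < p) :
    (cyclotomic (p * n) ℤ).eval x ∣ ∑ i ∈ Finset.range p, (x ^ n) ^ i := by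
  have hmem : n ∈ (p * n).properDivisors :=
    Nat.mem_properDivisors.2 ⟨dvd_mul_left _ _, by nlinarith⟩
  have h := eval_dvd (x := x) (X_pow_sub_one_mul_cyclotomic_dvd_X_pow_sub_one_of_dvd ℤ hmem)
  simp only [eval_mul, eval_sub, eval_pow, eval_X, eval_one] at h
  rw [mul_comm p n, pow_mul, ← mul_geom_sum (x ^ n) p, mul_comm n p] at h
  have h1 : 1 < x ^ n := one_lt_pow₀ hx hn.ne'
  exact (mul_dvd_mul_iff_left (sub_ne_zero.2 h1.ne')).1 h

open Polynomial in
theorem not_sq_dvd_cyclotomic_eval {a m p : ℕ} (ha : 2 ≤ a) (hm : 2 < m) (hp : p.Prime)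
    (hpm : p ∣ m) (h : (p : ℤ) ∣ (cyclotomic m ℤ).eval (a : ℤ)) :
    ¬ (p : ℤ) ^ 2 ∣ (cyclotomic m ℤ).eval (a : ℤ) := by
  have := Fact.mk hp
  obtain ⟨k, d, hmd, hdp, hprim⟩ :=
    exists_isPrimitiveRoot_of_prime_dvd_cyclotomic_eval (by omega) hp h
  obtain ⟨n, rfl⟩ := hpm
  have hn : 0 < n := Nat.pos_of_ne_zero (by rintro rfl; simp at hm)
  have hgeom := cyclotomic_eval_dvd_geom_sum (x := a) (by exact_mod_cast ha) hn hp.one_lt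
  intro hsq
  have hsq := hsq.trans hgeom
  rcases hp.eq_two_or_odd' with rfl | hodd
  · have hd : d = 1 := by
      have : d ≠ 0 := by rintro rfl; simp at hmd; omega
      omega
    subst hd
    have hk : n = 2 ^ (k - 1) ∧ 2 ≤ k := by
      rcases k with _ | _ | k
      · omega
      · simp at hmd; omega
      · refine ⟨?_, by omega⟩
        rw [pow_succ] at hmd
        simp only [Nat.add_sub_cancel]
        omega
    obtain ⟨j, rfl⟩ : ∃ j, k = j + 2 := ⟨k - 2, by omega⟩
    have ha1 : ¬ (2 : ℤ) ∣ a := by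
      intro h2
      have h1 := hprim.pow_eq_one
      rw [pow_one] at h1
      have : ((a : ℤ) : ZMod 2) = 0 := (ZMod.intCast_zmod_eq_zero_iff_dvd _ _).2 h2
      rw [Int.cast_natCast, h1] at this
      exact one_ne_zero this
    have ho : Odd ((a : ℤ) ^ 2 ^ j) := (Int.not_even_iff_odd.1 (by rwa [even_iff_two_dvd])).pow
    have h4 := Int.sq_mod_four_eq_one_of_odd ho
    rw [← pow_mul, ← pow_succ] at h4
    rw [hk.1] at hsq
    simp only [Finset.sum_range_succ, Finset.sum_range_zero, pow_zero, pow_one] at hsq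
    norm_num at hsq
    omega
  · refine not_sq_dvd_geom_sum_of_odd hp hodd ?_ hsq
    have hpow : (a : ZMod p) ^ (p * n) = 1 := by
      rw [hmd, mul_comm, pow_mul, hprim.pow_eq_one, one_pow]
    rw [mul_comm, pow_mul, ZMod.pow_card] at hpow
    rw [← ZMod.intCast_zmod_eq_zero_iff_dvd]
    push_cast
    rw [hpow, sub_self]

theorem eight_mul_succ_lt_two_pow {t : ℕ} (ht : 6 ≤ t) : 8 * (t + 1) < 2 ^ t := by
  induction t, ht using Nat.le_induction with
  | base => norm_num
  | succ t ht ih => rw [pow_succ]; omega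

theorem bang_primitive_prime_divisors (a : ℕ) (ha : 2 ≤ a) :
    ∃ M : ℕ, 0 < M ∧ ∀ m : ℕ, M < m →
      ∃ p : ℕ, p.Prime ∧ p ∣ a ^ m - 1 ∧
        ∀ k : ℕ, 1 ≤ k → k < m → ¬ p ∣ a ^ k - 1 := by
  refine ⟨60, by norm_num, fun m hm => ?_⟩
  by_contra! hcon
  have hiff (p : ℕ) (k : ℕ) : p ∣ a ^ k - 1 ↔ (a : ZMod p) ^ k = 1 := by
    rw [← ZMod.natCast_eq_zero_iff, Nat.cast_sub (Nat.one_le_pow _ _ (by omega)), sub_eq_zero]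
    push_cast
    rfl
  have hdvd (p : ℕ) (hp : p.Prime) (h : (p : ℤ) ∣ (Polynomial.cyclotomic m ℤ).eval (a : ℤ)) :
      ∃ k d : ℕ, m = p ^ (k + 1) * d ∧ d < p := by
    obtain ⟨k, d, hmd, hdp, hprim⟩ :=
      exists_isPrimitiveRoot_of_prime_dvd_cyclotomic_eval (by omega) hp h
    rcases k with _ | k
    · rw [pow_zero, one_mul] at hmd
      subst hmd
      obtain ⟨j, hj1, hjm, hj⟩ := hcon p hp ((hiff p m).2 hprim.pow_eq_one)
      exact absurd ((hiff p j).1 hj) (hprim.pow_ne_one_of_pos_of_lt (by omega) hjm)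
    · exact ⟨k, d, hmd, hdp⟩
  set N := ((Polynomial.cyclotomic m ℤ).eval (a : ℤ)).natAbs with hN
  have hcast (c : ℕ) : (c : ℤ) ∣ (Polynomial.cyclotomic m ℤ).eval (a : ℤ) ↔ c ∣ N :=
    Int.natCast_dvd
  have hN1 : N ≠ 1 := by
    have := Polynomial.sub_one_lt_natAbs_cyclotomic_eval (n := m) (q := a) (by omega) (by omega)
    omega
  obtain ⟨p, hp, hpN⟩ := Nat.exists_prime_and_dvd hN1
  obtain ⟨k, d, hmd, hdp⟩ := hdvd p hp ((hcast p).2 hpN)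
  have hlt (q r i d : ℕ) (hr : r.Prime) (hq : q.Prime) (hne : r ≠ q) (hrm : r ∣ m)
      (hmq : m = q ^ i * d) (hdq : d < q) : r < q := by
    rw [hmq] at hrm
    have hd : 0 < d := Nat.pos_of_ne_zero (by rintro rfl; simp at hmq; omega)
    rcases hr.dvd_mul.1 hrm with h | h
    · exact absurd ((Nat.prime_dvd_prime_iff_eq hr hq).1 (hr.dvd_of_dvd_pow h)) hne
    · exact (Nat.le_of_dvd hd h).trans_lt hdq
  have hpm : p ∣ m := by rw [hmd, pow_succ, mul_assoc]; exact (dvd_mul_right p d).mul_left _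
  have huniq (q : ℕ) (hq : q.Prime) (hqN : q ∣ N) : q = p := by
    by_contra hne
    obtain ⟨i, e, hme, heq⟩ := hdvd q hq ((hcast q).2 hqN)
    have hqm : q ∣ m := by rw [hme, pow_succ, mul_assoc]; exact (dvd_mul_right q e).mul_left _
    have h1 := hlt p q _ d hq hp hne hqm hmd hdp
    have h2 := hlt q p _ e hp hq (Ne.symm hne) hpm hme heq
    omega
  have hNp : N = p := by
    obtain ⟨c, hc⟩ := hpN
    by_cases hc1 : c = 1
    · rw [hc, hc1, mul_one]
    · obtain ⟨q, hq, hqc⟩ := Nat.exists_prime_and_dvd hc1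
      have hqp := huniq q hq (hc ▸ hqc.mul_left p)
      subst hqp
      refine absurd ?_ (not_sq_dvd_cyclotomic_eval ha (by omega) hp hpm ((hcast q).2 ?_))
      · have : q ^ 2 ∣ N := by rw [hc, sq]; exact mul_dvd_mul_left q hqc
        exact_mod_cast (hcast (q ^ 2)).2 this
      · exact hc ▸ dvd_mul_right q c
  have hbig := pow_totient_lt_eight_mul_natAbs_cyclotomic_eval (n := m) ha (by omega)
  rw [← hN, hNp] at hbig
  set t := p ^ k * (p - 1) with ht
  have htφ : t ≤ m.totient := by
    refine Nat.le_of_dvd (Nat.totient_pos.2 (by omega)) ?_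
    rw [ht, ← Nat.totient_prime_pow_succ hp]
    exact Nat.totient_dvd_of_dvd (hmd ▸ dvd_mul_right _ _)
  have h2t : 2 ^ t < 8 * p :=
    ((Nat.pow_le_pow_left ha t).trans (Nat.pow_le_pow_right (by omega) htφ)).trans_lt hbig
  have hp2 := hp.two_le
  have hpt : p - 1 ≤ t := Nat.le_mul_of_pos_left _ (by positivity)
  have ht5 : t ≤ 5 := by
    by_contra! h6
    have := eight_mul_succ_lt_two_pow h6
    omega
  have hpk : p ^ (k + 1) ≤ 2 * t := by
    rw [pow_succ, ht, mul_left_comm]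
    exact Nat.mul_le_mul_left _ (by omega)
  have : m ≤ 10 * 6 := by
    rw [hmd]
    exact Nat.mul_le_mul (by omega) (by omega)
  omega
end

section
/- (Goldberg, uniqueness) Let d ≥ 2, n ≥ 1 and m be integers with 0 ≤ m < n. Suppose θ, θ' : {0, 1, ..., n-1} → ℝ are strictly increasing functions with 0 ≤ θ_0, θ_{n-1} < 1, 0 ≤ θ'_0, θ'_{n-1} < 1, and for every index i: d·θ_i - θ_{(i+m) mod n} ∈ ℤ and d·θ'_i - θ'_{(i+m) mod n} ∈ ℤ (i.e., multiplication by d modulo 1 acts on the indexed angles as the shift i ↦ i + m mod n). If for every i ∈ {1, ..., d-1} the cardinalities #{j : θ_j < i/(d-1)} and #{j : θ'_j < i/(d-1)} are equal, then θ_i = θ'_i for all i. -/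
/-- Two lower sets of a finite linear order with the same cardinality coincide; stated for strict
sublevel sets of monotone functions. -/
theorem sublevel_eq_of_ncard_eq {n : ℕ} {f g : Fin n → ℝ} (hf : Monotone f) (hg : Monotone g)
    {c : ℝ} (h : {j | f j < c}.ncard = {j | g j < c}.ncard) :
    {j | f j < c} = {j | g j < c} := by
  have hfl : IsLowerSet {j | f j < c} := fun a b hab ha => (hf hab).trans_lt ha
  have hgl : IsLowerSet {j | g j < c} := fun a b hab ha => (hg hab).trans_lt ha
  rcases hfl.total hgl with hs | hs
  · exact Set.eq_of_subset_of_ncard_le hs h.ge (Set.toFinite _)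
  · exact (Set.eq_of_subset_of_ncard_le hs h.le (Set.toFinite _)).symm

/-- If `x < 1` and `y ≥ 0` are separated in the same way by the points `i / (d - 1)`, and
`d x`, `d y` have remainders `u ≥ 0`, `v < 1` lying on the same side of `x`, `y`, then the
integer part of `d x` is at most that of `d y`. -/
theorem integer_part_le {d : ℕ} (hd : 2 ≤ d) {x y u v : ℝ}
    (hx : x < 1) (hy : 0 ≤ y) (hu : 0 ≤ u) (hv : v < 1)
    (hside : (x ≤ u ∧ y ≤ v) ∨ (u < x ∧ v < y)) {k l : ℤ}
    (hk : (d : ℝ) * x - u = k) (hl : (d : ℝ) * y - v = l)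
    (hsep : ∀ i : ℕ, 1 ≤ i → i ≤ d - 1 →
      (x < (i : ℝ) / ((d : ℝ) - 1) ↔ y < (i : ℝ) / ((d : ℝ) - 1))) :
    k ≤ l := by
  have hd1 : (0 : ℝ) < (d : ℝ) - 1 := by
    have : (2 : ℝ) ≤ d := by exact_mod_cast hd
    linarith
  have hy0 : 0 ≤ ((d : ℝ) - 1) * y := mul_nonneg hd1.le hy
  have hx1 : ((d : ℝ) - 1) * x < d - 1 := mul_lt_of_lt_one_right hd1 hx
  have key : ∀ p : ℤ, (p : ℝ) ≤ ((d : ℝ) - 1) * x → ((d : ℝ) - 1) * y < p → False := by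
    intro p hp1 hp2
    have hp0 : 0 < p := by exact_mod_cast hy0.trans_lt hp2
    have hpd : p < (d : ℤ) - 1 := by
      have : (p : ℝ) < d - 1 := hp1.trans_lt hx1
      exact_mod_cast this
    lift p to ℕ using hp0.le
    have hs := hsep p (by omega) (by omega)
    rw [lt_div_iff₀ hd1, lt_div_iff₀ hd1] at hs
    push_cast at hp1 hp2
    linarith [hs.2 (by linarith)]
  by_contra! hlt
  have hlt' : (l : ℝ) + 1 ≤ k := by exact_mod_cast hlt
  rcases hside with ⟨h1, h2⟩ | ⟨h1, h2⟩
  · exact key k (by linarith) (by linarith)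
  · exact key l (by linarith) (by linarith)

/-- A real function on a finite type with `d * f i = f (σ i)` for some `d > 1` vanishes. -/
theorem eq_zero_of_mul_eq_comp {ι : Type*} [Finite ι] {d : ℝ} (hd : 1 < d) {f : ι → ℝ}
    {σ : ι → ι} (h : ∀ i, d * f i = f (σ i)) (i : ι) : f i = 0 := by
  have : Nonempty ι := ⟨i⟩
  obtain ⟨j, hj⟩ := Finite.exists_max fun i => |f i|
  have h1 : d * |f j| ≤ |f j| := by
    have := hj (σ j)
    rwa [← h j, abs_mul, abs_of_pos (by linarith)] at this
  have h2 : |f j| ≤ 0 := by nlinarith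
  exact abs_nonpos_iff.1 ((hj i).trans h2)

theorem goldberg_uniqueness (d n m : ℕ) (hd : 2 ≤ d) (hn : 1 ≤ n) (hm : m < n)
    (θ θ' : Fin n → ℝ)
    (hmono : StrictMono θ) (hmono' : StrictMono θ')
    (h0 : 0 ≤ θ ⟨0, by omega⟩) (h1 : θ ⟨n - 1, by omega⟩ < 1)
    (h0' : 0 ≤ θ' ⟨0, by omega⟩) (h1' : θ' ⟨n - 1, by omega⟩ < 1)
    (hrot : ∀ i : Fin n, ∃ k : ℤ,
      (d : ℝ) * θ i - θ ⟨(i.val + m) % n, Nat.mod_lt _ (by omega)⟩ = k)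
    (hrot' : ∀ i : Fin n, ∃ k : ℤ,
      (d : ℝ) * θ' i - θ' ⟨(i.val + m) % n, Nat.mod_lt _ (by omega)⟩ = k)
    (hdep : ∀ i : ℕ, 1 ≤ i → i ≤ d - 1 →
      {j : Fin n | θ j < (i : ℝ) / ((d : ℝ) - 1)}.ncard =
        {j : Fin n | θ' j < (i : ℝ) / ((d : ℝ) - 1)}.ncard) :
    θ = θ' := by
  have hz : ∀ i : Fin n, (⟨0, by omega⟩ : Fin n) ≤ i := fun i => Fin.mk_le_of_le_val (by simp)
  have hl : ∀ i : Fin n, i ≤ (⟨n - 1, by omega⟩ : Fin n) := fun i =>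
    Fin.le_def.2 (by have := i.isLt; simp only; omega)
  have b0 : ∀ i, 0 ≤ θ i := fun i => h0.trans (hmono.monotone (hz i))
  have b1 : ∀ i, θ i < 1 := fun i => (hmono.monotone (hl i)).trans_lt h1
  have b0' : ∀ i, 0 ≤ θ' i := fun i => h0'.trans (hmono'.monotone (hz i))
  have b1' : ∀ i, θ' i < 1 := fun i => (hmono'.monotone (hl i)).trans_lt h1'
  have hsep : ∀ (j : Fin n) (i : ℕ), 1 ≤ i → i ≤ d - 1 →
      (θ j < (i : ℝ) / ((d : ℝ) - 1) ↔ θ' j < (i : ℝ) / ((d : ℝ) - 1)) := fun j i hi hi' =>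
    Set.ext_iff.1 (sublevel_eq_of_ncard_eq hmono.monotone hmono'.monotone (hdep i hi hi')) j
  let σ : Fin n → Fin n := fun i => ⟨(i.val + m) % n, Nat.mod_lt _ (by omega)⟩
  have hd1 : (1 : ℝ) < d := by exact_mod_cast hd
  have hdiff : ∀ i, (d : ℝ) * (θ i - θ' i) = θ (σ i) - θ' (σ i) := by
    intro i
    obtain ⟨k, hk⟩ := hrot i
    obtain ⟨l, hl⟩ := hrot' i
    change (d : ℝ) * θ i - θ (σ i) = k at hk
    change (d : ℝ) * θ' i - θ' (σ i) = l at hl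
    have hside : (θ i ≤ θ (σ i) ∧ θ' i ≤ θ' (σ i)) ∨ (θ (σ i) < θ i ∧ θ' (σ i) < θ' i) := by
      rcases le_or_gt i (σ i) with h | h
      · exact .inl ⟨hmono.monotone h, hmono'.monotone h⟩
      · exact .inr ⟨hmono h, hmono' h⟩
    have hkl : k = l := le_antisymm
      (integer_part_le hd (b1 _) (b0' _) (b0 _) (b1' _)
        hside hk hl (hsep i))
      (integer_part_le hd (b1' _) (b0 _) (b0' _) (b1 _)
        (hside.imp And.symm And.symm) hl hk fun j hj hj' => (hsep i j hj hj').symm)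
    subst hkl
    linarith
  funext i
  exact sub_eq_zero.1 (eq_zero_of_mul_eq_comp (f := fun i => θ i - θ' i) hd1 hdiff i)
end
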